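/- arXiv:1406.0408 — 8 statements merged into one kernel-verified Lean document; each statement's English description precedes it below -/
import Mathlib

section
/- Let N ≥ 1, let χ be an odd Dirichlet character modulo N with values in ℂ (i.e. χ(−1) = −1), and let ℓ be a prime not dividing N. Let Λ be a finite nonempty set of nonzero modular forms in M_1(N, χ^{-1}). Define V'_Λ = { h ∈ ℂ((q)) : for every λ ∈ Λ, the product h · qexp(λ) is the q-expansion of some cusp form in S_2(N, 1), where 1 is the trivial character mod N }, and define V'_{Λ,ℓ} = { h ∈ V'_Λ : T^m h ∈ V'_Λ for all m ≥ 1 }, the largest T-stable subspace of V'_Λ. Then qexp(S_1(N,χ)) ⊆ V'_{Λ,ℓ} ⊆ qexp(M_1(N,χ)); that is, every weight-1 cusp form of level N and nebentypus χ has its q-expansion in V'_{Λ,ℓ}, and every element of V'_{Λ,ℓ} is the q-expansion of a modular form of weight 1, level N and nebentypus χ. (Hecke stability method in characteristic zero.) -/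
open UpperHalfPlane CongruenceSubgroup Function
open scoped ModularForm MatrixGroups

noncomputable section

/-- `f` has nebentypus `ψ` in weight `k`: `f ∣[k] γ = ψ(d) • f` for all `γ = (a b; c d)` in
`Γ₀(N)`. -/
def HasNeben {N : ℕ} (k : ℤ) (ψ : DirichletCharacter ℂ N) (f : ℍ → ℂ) : Prop :=
  ∀ γ : SL(2, ℤ), γ ∈ Gamma0 N → f ∣[k] γ = ψ ((γ 1 1 : ℤ) : ZMod N) • f

/-- The `q`-expansion of a `1`-periodic function on the upper half-plane, as a formal power
series: its coefficients are the Taylor coefficients at `q = 0` of the associated cusp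
function `F` (with `f τ = F (e^{2πiτ})`). -/
def qExpansionPS (f : ℍ → ℂ) : PowerSeries ℂ :=
  PowerSeries.mk fun n =>
    iteratedDeriv n (Function.Periodic.cuspFunction 1 (f ∘ ofComplex)) 0 / n.factorial

/-- The `q`-expansion, regarded as a formal Laurent series in `ℂ((q))`. -/
def qExpansionL (f : ℍ → ℂ) : LaurentSeries ℂ :=
  HahnSeries.ofPowerSeries ℤ ℂ (qExpansionPS f)

/-- The graph of the weight-`1`, character-`χ` Hecke operator `T = T_ℓ` on `q`-expansions:
`T(∑ₙ aₙ qⁿ) = ∑ₙ a_{ℓn} qⁿ + χ(ℓ) · ∑ₙ aₙ q^{ℓn}`. -/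
def IsHeckeT (ℓ : ℕ) (c : ℂ) (f g : LaurentSeries ℂ) : Prop :=
  ∀ n : ℤ, g.coeff n =
    f.coeff (ℓ * n) + c * (if (ℓ : ℤ) ∣ n then f.coeff (n / ℓ) else 0)

/-- `V'_Λ`: the set of `h ∈ ℂ((q))` such that for every `λ ∈ Λ` the product `h · qexp(λ)` is
the `q`-expansion of some cusp form of weight `2`, level `N` and trivial nebentypus. -/
def VLam (N : ℕ) (Λ : Finset (ModularForm (Gamma1 N) 1)) : Set (LaurentSeries ℂ) :=
  {h | ∀ l ∈ Λ, ∃ g : CuspForm (Gamma1 N) 2,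
    HasNeben 2 (1 : DirichletCharacter ℂ N) ⇑g ∧ h * qExpansionL ⇑l = qExpansionL ⇑g}

/-- `V'_{Λ,ℓ}`: the largest `T`-stable subspace of `V'_Λ`, i.e. the set of `h ∈ V'_Λ` all of
whose iterates `T^m h` (`m ≥ 1`) under the Hecke operator `T = T_ℓ` remain in `V'_Λ`. -/
def VLamEll (N : ℕ) (χ : DirichletCharacter ℂ N) (ℓ : ℕ)
    (Λ : Finset (ModularForm (Gamma1 N) 1)) : Set (LaurentSeries ℂ) :=
  {h ∈ VLam N Λ | ∀ s : ℕ → LaurentSeries ℂ, s 0 = h →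
    (∀ m : ℕ, IsHeckeT ℓ (χ ((ℓ : ZMod N))) (s m) (s (m + 1))) →
      ∀ m : ℕ, 1 ≤ m → s m ∈ VLam N Λ}

/-- The map `τ ↦ (τ + b) / ℓ` on the upper half-plane. -/
def dn (ℓ : ℕ) [NeZero ℓ] (b : ℕ) (τ : ℍ) : ℍ :=
  ⟨((τ : ℂ) + b) / ℓ, by
    have h : (0 : ℝ) < ℓ := Nat.cast_pos.mpr (NeZero.pos ℓ)
    have : (((τ : ℂ) + b) / ℓ).im = τ.im / ℓ := by
      rw [← Complex.ofReal_natCast ℓ, Complex.div_ofReal_im]; simp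
    rw [this]; exact div_pos τ.im_pos h⟩

/-- The map `τ ↦ ℓτ` on the upper half-plane. -/
def up (ℓ : ℕ) [NeZero ℓ] (τ : ℍ) : ℍ :=
  ⟨(ℓ : ℂ) * τ, by
    have h : (0 : ℝ) < ℓ := Nat.cast_pos.mpr (NeZero.pos ℓ)
    have : ((ℓ : ℂ) * τ).im = ℓ * τ.im := by
      rw [← Complex.ofReal_natCast, Complex.im_ofReal_mul]; simp
    rw [this]; exact mul_pos h τ.im_pos⟩

@[simp] lemma coe_dn (ℓ : ℕ) [NeZero ℓ] (b : ℕ) (τ : ℍ) : (dn ℓ b τ : ℂ) = ((τ : ℂ) + b) / ℓ := rfl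
@[simp] lemma coe_up (ℓ : ℕ) [NeZero ℓ] (τ : ℍ) : (up ℓ τ : ℂ) = (ℓ : ℂ) * τ := rfl

lemma im_dn (ℓ : ℕ) [NeZero ℓ] (b : ℕ) (τ : ℍ) : (dn ℓ b τ).im = τ.im / ℓ := by
  rw [← UpperHalfPlane.coe_im, coe_dn, ← Complex.ofReal_natCast ℓ, Complex.div_ofReal_im]; simp

lemma im_up (ℓ : ℕ) [NeZero ℓ] (τ : ℍ) : (up ℓ τ).im = ℓ * τ.im := by
  rw [← UpperHalfPlane.coe_im, coe_up, ← Complex.ofReal_natCast ℓ, Complex.im_ofReal_mul]; simp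

/-- The weight-one Hecke operator `T_ℓ` with character value `c`, on functions. -/
def heckeFun (ℓ : ℕ) [NeZero ℓ] (c : ℂ) (f : ℍ → ℂ) (τ : ℍ) : ℂ :=
  (ℓ : ℂ)⁻¹ * ∑ b ∈ Finset.range ℓ, f (dn ℓ b τ) + c * f (up ℓ τ)

/-- `f` is represented by the Laurent series `h` in `q = e^{2πiτ}` on the half-plane `Im τ > Y`. -/
def HasLExp (f : ℍ → ℂ) (h : LaurentSeries ℂ) (Y : ℝ) : Prop :=
  ∀ τ : ℍ, Y < τ.im → HasSum (fun n : ℤ => h.coeff n * Periodic.qParam 1 τ ^ n) (f τ)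

lemma qExpansionPS_eq (f : ℍ → ℂ) : qExpansionPS f = UpperHalfPlane.qExpansion 1 f := by
  ext n
  simp [qExpansionPS, UpperHalfPlane.qExpansion_coeff, UpperHalfPlane.cuspFunction,
    div_eq_inv_mul]

lemma hasSum_int_iff_shift {a : ℤ → ℂ} {o : ℤ} (h : ∀ n < o, a n = 0) {s : ℂ} :
    HasSum a s ↔ HasSum (fun m : ℕ => a (o + m)) s := by
  have hinj : Injective (fun m : ℕ => o + (m : ℤ)) := fun _ _ hab => by simpa using hab
  refine (hinj.hasSum_iff fun n hn => h n ?_).symm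
  by_contra hlt
  exact hn ⟨(n - o).toNat, by simp; omega⟩

lemma ofPowerSeries_coeff_neg (p : PowerSeries ℂ) {n : ℤ} (hn : n < 0) :
    (HahnSeries.ofPowerSeries ℤ ℂ p).coeff n = 0 := by
  rw [HahnSeries.ofPowerSeries_apply]
  refine HahnSeries.embDomain_of_notMem_range ?_
  rintro ⟨m, hm⟩
  simp at hm
  omega

lemma one_mem_strictPeriods (N : ℕ) :
    (1 : ℝ) ∈ ((Gamma1 N : Subgroup SL(2, ℤ)) : Subgroup (GL (Fin 2) ℝ)).strictPeriods := by
  simp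

lemma HasLExp.eq_zero {c : LaurentSeries ℂ} {Y : ℝ} (h : HasLExp (fun _ => 0) c Y) : c = 0 := by
  by_contra hc
  set o := c.order
  have hY : 0 < max Y 0 + 1 := by positivity
  set σ : ℍ := ⟨(max Y 0 + 1 : ℝ) * Complex.I, by simpa using hY⟩
  have hsum : ∀ τ : ℍ, HasSum
      (fun m : ℕ => (c.coeff (o + m) * Periodic.qParam 1 (σ : ℂ) ^ m) •
        Periodic.qParam 1 (τ : ℂ) ^ m)
      ((0 : ℍ → ℂ) τ) := by
    intro τ
    set w : ℍ := ⟨(τ : ℂ) + σ, by simpa using add_pos τ.im_pos σ.im_pos⟩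
    have hw : Y < w.im := by
      have h1 : w.im = τ.im + (max Y 0 + 1) := by
        rw [← UpperHalfPlane.coe_im]; simp [w, σ]
      have := τ.im_pos
      have := le_max_left Y 0
      linarith
    have hq : Periodic.qParam 1 (w : ℂ) =
        Periodic.qParam 1 (σ : ℂ) * Periodic.qParam 1 (τ : ℂ) := by
      simp only [Periodic.qParam, ← Complex.exp_add, w]
      congr 1
      push_cast
      ring
    have h2 := h w hw
    rw [hasSum_int_iff_shift (o := o) (fun n hn => by
      rw [HahnSeries.coeff_eq_zero_of_lt_order hn, zero_mul])] at h2
    have h3 := h2.mul_left ((Periodic.qParam 1 (w : ℂ)) ^ (-o))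
    simp only [mul_zero] at h3
    refine h3.congr_fun fun m => ?_
    have hne : Periodic.qParam 1 (w : ℂ) ≠ 0 := Periodic.qParam_ne_zero _
    rw [smul_eq_mul, mul_assoc, ← mul_pow, ← hq, zpow_add₀ hne, zpow_neg, zpow_natCast]
    field_simp
  have := ModularFormClass.qExpansion_coeff_unique (h := 1) (f := (0 : CuspForm (Gamma1 1) 1))
    one_pos (one_mem_strictPeriods 1) (by simpa using hsum) 0
  simp only [Nat.cast_zero, add_zero, pow_zero, mul_one, FunLike.coe_zero,
    UpperHalfPlane.qExpansion_zero, map_zero] at this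
  exact HahnSeries.coeff_order_eq_zero.not.mpr hc this

lemma HasLExp.mono {f : ℍ → ℂ} {h : LaurentSeries ℂ} {Y Y' : ℝ} (hf : HasLExp f h Y)
    (hY : Y ≤ Y') : HasLExp f h Y' := fun τ hτ => hf τ (hY.trans_lt hτ)

lemma HasLExp.unique {f : ℍ → ℂ} {h h' : LaurentSeries ℂ} {Y Y' : ℝ} (hf : HasLExp f h Y)
    (hf' : HasLExp f h' Y') : h = h' := by
  rw [← sub_eq_zero]
  refine HasLExp.eq_zero (Y := max Y Y') fun τ hτ => ?_
  have := (hf τ ((le_max_left _ _).trans_lt hτ)).sub (hf' τ ((le_max_right _ _).trans_lt hτ))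
  simpa [sub_mul] using this

lemma HasLExp.of_powerSeries {f : ℍ → ℂ} {p : PowerSeries ℂ} {Y : ℝ}
    (h : ∀ τ : ℍ, Y < τ.im → HasSum (fun m : ℕ => p.coeff m * Periodic.qParam 1 τ ^ m) (f τ)) :
    HasLExp f (HahnSeries.ofPowerSeries ℤ ℂ p) Y := by
  intro τ hτ
  rw [hasSum_int_iff_shift (o := 0) (fun n hn => by rw [ofPowerSeries_coeff_neg _ hn, zero_mul])]
  simpa [HahnSeries.ofPowerSeries_apply_coeff] using h τ hτ

lemma hasLExp_modularForm {N : ℕ} [NeZero N] {k : ℤ} {F : Type*} [FunLike F ℍ ℂ]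
    [ModularFormClass F (Gamma1 N) k] (f : F) : HasLExp f (qExpansionL f) 0 := by
  refine HasLExp.of_powerSeries fun τ _ => ?_
  rw [qExpansionPS_eq]
  have : Fact (IsCusp OnePoint.infty ((Gamma1 N : Subgroup SL(2, ℤ)) : Subgroup (GL (Fin 2) ℝ))) :=
    ⟨Subgroup.isCusp_of_mem_strictPeriods one_pos (one_mem_strictPeriods N)⟩
  exact ModularForm.hasSum_qExpansion f one_pos (one_mem_strictPeriods N) τ

lemma sum_rootOfUnity_zpow {ℓ : ℕ} [NeZero ℓ] (n : ℤ) :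
    ∑ b ∈ Finset.range ℓ, (Complex.exp (2 * Real.pi * Complex.I / ℓ) ^ b) ^ n =
      if (ℓ : ℤ) ∣ n then (ℓ : ℂ) else 0 := by
  set ζ := Complex.exp (2 * Real.pi * Complex.I / ℓ)
  have hζ : IsPrimitiveRoot ζ ℓ := Complex.isPrimitiveRoot_exp ℓ (NeZero.ne ℓ)
  have h1 : ∀ b : ℕ, (ζ ^ b) ^ n = (ζ ^ n) ^ b := fun b => by
    rw [← zpow_natCast, ← zpow_natCast, ← zpow_mul, ← zpow_mul, mul_comm]
  simp only [h1]
  split_ifs with h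
  · rw [(hζ.zpow_eq_one_iff_dvd n).mpr h]; simp
  · have hne : ζ ^ n ≠ 1 := fun h' => h ((hζ.zpow_eq_one_iff_dvd n).mp h')
    rw [geom_sum_eq hne, ← h1, hζ.pow_eq_one]
    simp

lemma qParam_dn (ℓ : ℕ) [NeZero ℓ] (b : ℕ) (τ : ℍ) :
    Periodic.qParam 1 (dn ℓ b τ) =
      Periodic.qParam 1 (dn ℓ 0 τ) * Complex.exp (2 * Real.pi * Complex.I / ℓ) ^ b := by
  simp only [Periodic.qParam, ← Complex.exp_nat_mul, ← Complex.exp_add, coe_dn]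
  congr 1
  push_cast
  ring

lemma qParam_dn_pow (ℓ : ℕ) [NeZero ℓ] (τ : ℍ) :
    Periodic.qParam 1 (dn ℓ 0 τ) ^ ℓ = Periodic.qParam 1 τ := by
  have : (ℓ : ℂ) ≠ 0 := Nat.cast_ne_zero.mpr (NeZero.ne ℓ)
  simp only [Periodic.qParam, ← Complex.exp_nat_mul, coe_dn]
  congr 1
  push_cast
  field_simp
  simp

lemma qParam_up (ℓ : ℕ) [NeZero ℓ] (τ : ℍ) :
    Periodic.qParam 1 (up ℓ τ) = Periodic.qParam 1 τ ^ ℓ := by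
  simp only [Periodic.qParam, ← Complex.exp_nat_mul, coe_up]
  congr 1
  push_cast
  ring

lemma HasLExp.heckeFun {ℓ : ℕ} [NeZero ℓ] {c : ℂ} {f : ℍ → ℂ} {h h' : LaurentSeries ℂ} {Y : ℝ}
    (hf : HasLExp f h Y) (hY : 0 ≤ Y) (hh : IsHeckeT ℓ c h h') :
    HasLExp (heckeFun ℓ c f) h' (ℓ * Y) := by
  intro τ hτ
  have hℓ : (0 : ℝ) < ℓ := Nat.cast_pos.mpr (NeZero.pos ℓ)
  have hℓ1 : (1 : ℝ) ≤ ℓ := Nat.one_le_cast.mpr (NeZero.one_le)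
  have hℓC : (ℓ : ℂ) ≠ 0 := Nat.cast_ne_zero.mpr (NeZero.ne ℓ)
  have hℓZ : (ℓ : ℤ) ≠ 0 := Nat.cast_ne_zero.mpr (NeZero.ne ℓ)
  have hinj : Injective (fun n : ℤ => (ℓ : ℤ) * n) := fun a b hab => mul_left_cancel₀ hℓZ hab
  set x := Periodic.qParam 1 (dn ℓ 0 τ : ℂ)
  have hxpow (n : ℤ) : x ^ ((ℓ : ℤ) * n) = Periodic.qParam 1 (τ : ℂ) ^ n := by
    rw [zpow_mul, zpow_natCast, qParam_dn_pow]
  have key (n : ℤ) : ∑ b ∈ Finset.range ℓ, h.coeff n * Periodic.qParam 1 (dn ℓ b τ : ℂ) ^ n =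
      h.coeff n * (x ^ n * if (ℓ : ℤ) ∣ n then (ℓ : ℂ) else 0) := by
    rw [← sum_rootOfUnity_zpow, Finset.mul_sum, Finset.mul_sum]
    exact Finset.sum_congr rfl fun b _ => by rw [qParam_dn, mul_zpow]
  have h1 : HasSum (fun n : ℤ => h.coeff (ℓ * n) * Periodic.qParam 1 (τ : ℂ) ^ n)
      ((ℓ : ℂ)⁻¹ * ∑ b ∈ Finset.range ℓ, f (dn ℓ b τ)) := by
    have h2 := (hasSum_sum (s := Finset.range ℓ) fun b _ => hf (dn ℓ b τ) (by
      rw [im_dn, lt_div_iff₀ hℓ, mul_comm]; exact hτ)).mul_left (ℓ : ℂ)⁻¹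
    simp only [key] at h2
    rw [← hinj.hasSum_iff] at h2
    · refine h2.congr_fun fun n => ?_
      simp only [comp_apply, dvd_mul_right, if_true, hxpow]
      field_simp
    · intro n hn
      rw [if_neg]
      · simp
      · rintro ⟨m, rfl⟩
        exact hn ⟨m, rfl⟩
  have h4 : HasSum (fun n : ℤ => c * (if (ℓ : ℤ) ∣ n then h.coeff (n / ℓ) else 0) *
      Periodic.qParam 1 (τ : ℂ) ^ n) (c * f (up ℓ τ)) := by
    have h5 := hf (up ℓ τ) (by
      rw [im_up]; nlinarith [τ.im_pos])
    have h6 : HasSum (fun n : ℤ => (if (ℓ : ℤ) ∣ n then h.coeff (n / ℓ) else 0) *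
        Periodic.qParam 1 (τ : ℂ) ^ n) (f (up ℓ τ)) := by
      rw [← hinj.hasSum_iff]
      · refine h5.congr_fun fun n => ?_
        simp only [comp_apply, dvd_mul_right, if_true, Int.mul_ediv_cancel_left _ hℓZ]
        rw [qParam_up, zpow_mul, zpow_natCast]
      · intro n hn
        rw [if_neg, zero_mul]
        rintro ⟨m, rfl⟩
        exact hn ⟨m, rfl⟩
    simpa only [mul_assoc] using h6.mul_left c
  refine (h1.add h4).congr_fun fun n => ?_
  rw [hh n]
  ring

lemma exists_isHeckeT {ℓ : ℕ} [NeZero ℓ] (c : ℂ) (h : LaurentSeries ℂ) :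
    ∃ h' : LaurentSeries ℂ, IsHeckeT ℓ c h h' := by
  have hℓ : (0 : ℤ) < ℓ := Nat.cast_pos.mpr (NeZero.pos ℓ)
  have hbdd : BddBelow (support fun n : ℤ => h.coeff (ℓ * n) +
      c * (if (ℓ : ℤ) ∣ n then h.coeff (n / ℓ) else 0)) := by
    refine ⟨-ℓ * |h.order|, fun n hn => ?_⟩
    by_contra! hlt
    refine hn ?_
    have habs := neg_abs_le h.order
    have ha0 := abs_nonneg h.order
    have hn1 : n < -|h.order| := by nlinarith
    have h1 : h.coeff (ℓ * n) = 0 := HahnSeries.coeff_eq_zero_of_lt_order (by nlinarith)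
    simp only [h1, zero_add]
    split_ifs with hd
    · obtain ⟨m, rfl⟩ := hd
      rw [Int.mul_ediv_cancel_left _ hℓ.ne', HahnSeries.coeff_eq_zero_of_lt_order (by nlinarith)]
      simp
    · simp
  exact ⟨HahnSeries.ofSuppBddBelow _ hbdd, fun n => by rw [HahnSeries.coeff_ofSuppBddBelow]⟩

lemma IsHeckeT.unique {ℓ : ℕ} {c : ℂ} {h a b : LaurentSeries ℂ} (ha : IsHeckeT ℓ c h a)
    (hb : IsHeckeT ℓ c h b) : a = b := by
  ext n
  rw [ha n, hb n]

/-- The Taylor series at `0` as a formal power series. -/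
def taylorPS (f : ℂ → ℂ) : PowerSeries ℂ :=
  PowerSeries.mk fun n => iteratedDeriv n f 0 / n.factorial

lemma qExpansionPS_eq_taylorPS (f : ℍ → ℂ) :
    qExpansionPS f = taylorPS (UpperHalfPlane.cuspFunction 1 f) := rfl

lemma taylorPS_mul {f g : ℂ → ℂ} (hf : AnalyticAt ℂ f 0) (hg : AnalyticAt ℂ g 0) :
    taylorPS (f * g) = taylorPS f * taylorPS g := by
  ext
  simp only [taylorPS, PowerSeries.coeff_mk,
    iteratedDeriv_mul hf.contDiffAt hg.contDiffAt, Finset.sum_div, PowerSeries.coeff_mul,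
    Finset.Nat.sum_antidiagonal_eq_sum_range_succ_mk, Nat.succ_eq_add_one]
  refine Finset.sum_congr rfl fun i hi ↦ ?_
  rw [Nat.cast_choose _ (by grind)]
  field_simp [Nat.factorial_ne_zero]

lemma taylorPS_congr {f g : ℂ → ℂ} (h : f =ᶠ[nhds 0] g) : taylorPS f = taylorPS g := by
  ext n
  simp [taylorPS, h.iteratedDeriv_eq]

lemma taylorPS_pow (k : ℕ) : taylorPS (fun z => z ^ k) = PowerSeries.X ^ k := by
  ext n
  rw [taylorPS, PowerSeries.coeff_mk, iteratedDeriv_pow, PowerSeries.coeff_X_pow]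
  rcases lt_trichotomy n k with h | h | h
  · rw [zero_pow (by omega), if_neg h.ne]; simp
  · subst h
    simp [Nat.descFactorial_self, Nat.factorial_ne_zero]
  · simp [Nat.descFactorial_of_lt h, h.ne']

lemma hasSum_taylorPS {f : ℂ → ℂ} (hf : AnalyticAt ℂ f 0) :
    ∀ᶠ q in nhds (0 : ℂ), HasSum (fun m : ℕ => (taylorPS f).coeff m * q ^ m) (f q) := by
  have h := hf.hasFPowerSeriesAt.eventually_hasSum
  filter_upwards [h] with q hq
  simpa [taylorPS, mul_comm] using hq

lemma eventually_qParam {P : ℂ → Prop} (h : ∀ᶠ q in nhdsWithin (0 : ℂ) {0}ᶜ, P q) :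
    ∃ Y : ℝ, 0 ≤ Y ∧ ∀ τ : ℍ, Y < τ.im → P (Periodic.qParam 1 τ) := by
  have h1 := (Periodic.qParam_tendsto (h := 1) one_pos).eventually h
  have h2 := tendsto_coe_atImInfty.eventually h1
  obtain ⟨A, hA⟩ := (atImInfty_mem _).mp h2
  exact ⟨max A 0, le_max_right _ _, fun τ hτ => hA τ ((le_max_left _ _).trans hτ.le)⟩

lemma hasLExp_quotient {N : ℕ} [NeZero N] (l : ModularForm (Gamma1 N) 1) (hl : l ≠ 0)
    (g : CuspForm (Gamma1 N) 2) (h : LaurentSeries ℂ)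
    (hh : h * qExpansionL l = qExpansionL g) :
    ∃ Y : ℝ, 0 ≤ Y ∧ (∀ τ : ℍ, Y < τ.im → l τ ≠ 0) ∧ HasLExp (fun τ => g τ / l τ) h Y := by
  have hLa := ModularFormClass.analyticAt_cuspFunction_zero l one_pos (one_mem_strictPeriods N)
  have hGa := ModularFormClass.analyticAt_cuspFunction_zero g one_pos (one_mem_strictPeriods N)
  set L := UpperHalfPlane.cuspFunction 1 l
  set G := UpperHalfPlane.cuspFunction 1 g
  have hLe (τ : ℍ) : L (Periodic.qParam 1 τ) = l τ :=
    SlashInvariantFormClass.eq_cuspFunction l τ (one_mem_strictPeriods N) one_ne_zero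
  have hGe (τ : ℍ) : G (Periodic.qParam 1 τ) = g τ :=
    SlashInvariantFormClass.eq_cuspFunction g τ (one_mem_strictPeriods N) one_ne_zero
  have hLne : ¬ ∀ᶠ z in nhds 0, L z = 0 := by
    intro h0
    apply hl
    have h1 : taylorPS L = 0 := by
      rw [taylorPS_congr (g := 0) h0]
      ext n; simp [taylorPS]
    rw [← qExpansionPS_eq_taylorPS, qExpansionPS_eq] at h1
    exact (ModularForm.qExpansion_eq_zero_iff one_pos (one_mem_strictPeriods N) l).mp h1
  obtain ⟨k, U, hUa, hU0, hU⟩ := hLa.exists_eventuallyEq_pow_smul_nonzero_iff.mpr hLne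
  simp only [sub_zero, smul_eq_mul] at hU
  have hVa : AnalyticAt ℂ (G / U) 0 := hGa.div hUa hU0
  have hUne : ∀ᶠ z in nhds 0, U z ≠ 0 := hUa.continuousAt.eventually_ne hU0
  have hTL : taylorPS L = PowerSeries.X ^ k * taylorPS U := by
    rw [← taylorPS_pow, ← taylorPS_mul (by fun_prop) hUa]
    exact taylorPS_congr hU
  have hTG : taylorPS G = taylorPS (G / U) * taylorPS U := by
    rw [← taylorPS_mul hVa hUa]
    refine taylorPS_congr ?_
    filter_upwards [hUne] with z hz
    simp [hz]
  have hTU : taylorPS U ≠ 0 := fun h0 => hU0 (by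
    have := congrArg (PowerSeries.coeff 0) h0
    simpa [taylorPS] using this)
  have hX : h * HahnSeries.single (k : ℤ) 1 =
      HahnSeries.ofPowerSeries ℤ ℂ (taylorPS (G / U)) := by
    have hne : HahnSeries.ofPowerSeries ℤ ℂ (taylorPS U) ≠ 0 := fun h0 => hTU
      (HahnSeries.ofPowerSeries_injective (by rw [h0, map_zero]))
    apply mul_right_cancel₀ hne
    rw [← map_mul, ← hTG, ← qExpansionPS_eq_taylorPS]
    change _ = qExpansionL g
    rw [← hh, qExpansionL, qExpansionPS_eq_taylorPS, hTL, map_mul, HahnSeries.ofPowerSeries_X_pow,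
      mul_assoc]
  have hcoeff (n : ℤ) : h.coeff n =
      (HahnSeries.ofPowerSeries ℤ ℂ (taylorPS (G / U))).coeff (k + n) := by
    rw [← hX, add_comm, HahnSeries.coeff_mul_single_add, mul_one]
  have hev : ∀ᶠ q in nhdsWithin (0 : ℂ) {0}ᶜ,
      HasSum (fun m : ℕ => (taylorPS (G / U)).coeff m * q ^ m) ((G / U) q) ∧ U q ≠ 0 ∧
        L q = q ^ k * U q ∧ q ≠ 0 := by
    filter_upwards [nhdsWithin_le_nhds (hasSum_taylorPS hVa), nhdsWithin_le_nhds hUne,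
      nhdsWithin_le_nhds hU, self_mem_nhdsWithin] with q h1 h2 h3 h4 using ⟨h1, h2, h3, h4⟩
  obtain ⟨Y, hY0, hY⟩ := eventually_qParam hev
  refine ⟨Y, hY0, fun τ hτ => ?_, fun τ hτ => ?_⟩
  · obtain ⟨-, h2, h3, h4⟩ := hY τ hτ
    rw [← hLe, h3]
    exact mul_ne_zero (pow_ne_zero _ h4) h2
  · obtain ⟨h1, h2, h3, h4⟩ := hY τ hτ
    rw [hasSum_int_iff_shift (o := -(k : ℤ))]
    · beta_reduce
      rw [← hLe, ← hGe, h3]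
      convert! h1.mul_left (Periodic.qParam 1 (τ : ℂ) ^ (-(k : ℤ))) using 1
      · ext m
        rw [hcoeff, add_neg_cancel_left, HahnSeries.ofPowerSeries_apply_coeff, zpow_add₀ h4,
          zpow_natCast]
        ring
      · rw [zpow_neg, zpow_natCast, Pi.div_apply]
        field_simp
    · intro n hn
      rw [hcoeff, ofPowerSeries_coeff_neg _ (by omega), zero_mul]

lemma HasNeben.slash_eq_of_mem_Gamma1 {N : ℕ} {k : ℤ} {χ : DirichletCharacter ℂ N} {f : ℍ → ℂ}
    (hf : HasNeben k χ f) (γ : GL (Fin 2) ℝ)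
    (hγ : γ ∈ ((Gamma1 N : Subgroup SL(2, ℤ)) : Subgroup (GL (Fin 2) ℝ))) : f ∣[k] γ = f := by
  obtain ⟨γ, hγ, rfl⟩ := hγ
  have h1 := (Gamma1_mem N γ).mp hγ
  have h2 := hf γ (Gamma0_mem.mpr h1.2.2)
  rw [h1.2.1, map_one, one_smul] at h2
  exact h2

/-- The rational matrix attached to an integral matrix of nonzero determinant. -/
def intGLQ (A : Matrix (Fin 2) (Fin 2) ℤ) : GL (Fin 2) ℚ :=
  if h : (A.map (Int.cast : ℤ → ℚ)).det ≠ 0 then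
    Matrix.GeneralLinearGroup.mkOfDetNeZero (A.map (Int.cast : ℤ → ℚ)) h else 1

/-- The real matrix attached to an integral matrix of nonzero determinant. -/
def intGL (A : Matrix (Fin 2) (Fin 2) ℤ) : GL (Fin 2) ℝ :=
  (intGLQ A).map (Rat.castHom ℝ)

lemma det_map_intCast (A : Matrix (Fin 2) (Fin 2) ℤ) :
    (A.map (Int.cast : ℤ → ℚ)).det = (A.det : ℚ) := by
  simp [Matrix.det_fin_two]

lemma intGL_apply {A : Matrix (Fin 2) (Fin 2) ℤ} (hA : A.det ≠ 0) (i j : Fin 2) :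
    intGL A i j = (A i j : ℝ) := by
  have h : (A.map (Int.cast : ℤ → ℚ)).det ≠ 0 := by
    rw [det_map_intCast]; exact_mod_cast hA
  simp [intGL, intGLQ, dif_pos h, Matrix.GeneralLinearGroup.mkOfDetNeZero]

lemma intGL_mul {A : Matrix (Fin 2) (Fin 2) ℤ} (hA : A.det ≠ 0) {B : Matrix (Fin 2) (Fin 2) ℤ}
    (hB : B.det ≠ 0) : intGL (A * B) = intGL A * intGL B := by
  have hAB : (A * B).det ≠ 0 := by rw [Matrix.det_mul]; exact mul_ne_zero hA hB
  rw [Matrix.GeneralLinearGroup.ext_iff]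
  intro i j
  rw [intGL_apply hAB, Matrix.GeneralLinearGroup.coe_mul, Matrix.mul_apply, Matrix.mul_apply]
  simp only [intGL_apply hA, intGL_apply hB]
  push_cast
  rfl

lemma intGL_SL (γ : SL(2, ℤ)) : intGL (γ : Matrix (Fin 2) (Fin 2) ℤ) =
    Matrix.SpecialLinearGroup.mapGL ℝ γ := by
  have h : (γ : Matrix (Fin 2) (Fin 2) ℤ).det ≠ 0 := by simp
  rw [Matrix.GeneralLinearGroup.ext_iff]
  intro i j
  rw [intGL_apply h]
  simp

lemma intGL_det {A : Matrix (Fin 2) (Fin 2) ℤ} (hA : A.det ≠ 0) :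
    (intGL A).det.val = (A.det : ℝ) := by
  rw [Matrix.GeneralLinearGroup.val_det_apply, Matrix.det_fin_two, Matrix.det_fin_two]
  simp only [intGL_apply hA]
  push_cast
  rfl

lemma isZeroAt_slash_intGL {N : ℕ} [NeZero N] {k : ℤ} (f : CuspForm (Gamma1 N) k)
    (A : Matrix (Fin 2) (Fin 2) ℤ) {c : OnePoint ℝ}
    (hc : IsCusp c ((Gamma1 N : Subgroup SL(2, ℤ)) : Subgroup (GL (Fin 2) ℝ))) :
    c.IsZeroAt (⇑f ∣[k] intGL A) k := by
  rw [← OnePoint.IsZeroAt.smul_iff]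
  refine f.zero_at_cusps' ?_
  rw [Subgroup.IsArithmetic.isCusp_iff_isCusp_SL2Z, isCusp_SL2Z_iff] at hc ⊢
  obtain ⟨c, rfl⟩ := hc
  exact ⟨intGLQ A • c, by rw [← Rat.coe_castHom, OnePoint.map_smul]; rfl⟩

/-- Representatives of `Γ₀(N)` acting on the integral matrices of determinant `ℓ`. -/
def heckeRep (ℓ : ℕ) : Option (Fin ℓ) → Matrix (Fin 2) (Fin 2) ℤ
  | none => !![(ℓ : ℤ), 0; 0, 1]
  | some b => !![1, (b : ℤ); 0, (ℓ : ℤ)]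

lemma heckeRep_det (ℓ : ℕ) (i : Option (Fin ℓ)) : (heckeRep ℓ i).det = ℓ := by
  cases i <;> simp [heckeRep, Matrix.det_fin_two]

lemma heckeRep_lower (ℓ : ℕ) (i : Option (Fin ℓ)) : heckeRep ℓ i 1 0 = 0 := by
  cases i <;> simp [heckeRep]

lemma heckeRep_unique {ℓ : ℕ} (hℓ : 1 < ℓ) {i j : Option (Fin ℓ)} {δ : SL(2, ℤ)}
    (h : heckeRep ℓ i = δ * heckeRep ℓ j) : i = j := by
  have e (a b : Fin 2) := congrFun (congrFun h a) b
  have e00 := e 0 0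
  have e01 := e 0 1
  have e10 := e 1 0
  have e11 := e 1 1
  have hℓ0 : (1 : ℤ) < ℓ := by exact_mod_cast hℓ
  rcases i with _ | i <;> rcases j with _ | j <;>
    simp only [heckeRep, Matrix.mul_apply, Fin.sum_univ_two, Matrix.of_apply, Matrix.cons_val',
      Matrix.cons_val_zero, Matrix.cons_val_one, mul_zero, mul_one, add_zero, zero_add,
      Matrix.cons_val_fin_one] at e00 e01 e10 e11
  · rfl
  · exfalso
    rw [← e10] at e11
    have : (ℓ : ℤ) ∣ 1 := ⟨δ.1 1 1, by linarith⟩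
    have := Int.le_of_dvd one_pos this
    omega
  · exfalso
    have : (ℓ : ℤ) ∣ 1 := ⟨δ.1 0 0, by linarith⟩
    have := Int.le_of_dvd one_pos this
    omega
  · rw [← e00] at e01
    have h1 : ((i : ℕ) : ℤ) ≡ (j : ℕ) [ZMOD ℓ] := by
      rw [e01, one_mul]
      exact (Int.modEq_iff_dvd.mpr ⟨-δ.1 0 1, by ring⟩)
    have h2 := (Int.natCast_modEq_iff.mp h1)
    have h3 := Nat.ModEq.eq_of_lt_of_lt h2 i.2 j.2
    rw [Fin.ext h3]

lemma heckeRep_exists {N ℓ : ℕ} (hℓ : ℓ.Prime) (hℓN : ¬ ℓ ∣ N) {A : Matrix (Fin 2) (Fin 2) ℤ}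
    (hA : A.det = ℓ) (hAN : (N : ℤ) ∣ A 1 0) :
    ∃ i : Option (Fin ℓ), ∃ δ : SL(2, ℤ), δ ∈ Gamma0 N ∧ A = δ * heckeRep ℓ i := by
  have : Fact ℓ.Prime := ⟨hℓ⟩
  have hℓ0 : (ℓ : ℤ) ≠ 0 := by exact_mod_cast hℓ.ne_zero
  have hcop : IsCoprime (N : ℤ) (ℓ : ℤ) :=
    Nat.isCoprime_iff_coprime.mpr ((Nat.Prime.coprime_iff_not_dvd hℓ).mpr hℓN).symm
  rw [Matrix.det_fin_two] at hA
  by_cases hd : (ℓ : ℤ) ∣ A 0 0 ∧ (ℓ : ℤ) ∣ A 1 0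
  · obtain ⟨⟨a, ha⟩, ⟨c, hc⟩⟩ := hd
    refine ⟨none, ⟨!![a, A 0 1; c, A 1 1], ?_⟩, ?_, ?_⟩
    · rw [Matrix.det_fin_two_of]
      rw [ha, hc] at hA
      exact mul_left_cancel₀ hℓ0 (by linarith)
    · refine Gamma0_mem.mpr ?_
      change ((c : ℤ) : ZMod N) = 0
      rw [ZMod.intCast_zmod_eq_zero_iff_dvd]
      exact hcop.dvd_of_dvd_mul_left (hc ▸ hAN)
    · ext i j
      fin_cases i <;> fin_cases j <;> simp [heckeRep, Matrix.mul_apply, ha, hc, mul_comm]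
  · have hb : ∃ b : ℕ, b < ℓ ∧ (ℓ : ℤ) ∣ A 0 1 - A 0 0 * b ∧ (ℓ : ℤ) ∣ A 1 1 - A 1 0 * b := by
      have hA' : ((A 0 0 : ℤ) : ZMod ℓ) * (A 1 1 : ℤ) - (A 0 1 : ℤ) * (A 1 0 : ℤ) = 0 := by
        have := congrArg (Int.cast : ℤ → ZMod ℓ) hA
        simpa using this
      have key : ∃ b : ZMod ℓ, ((A 0 1 : ℤ) : ZMod ℓ) - (A 0 0 : ℤ) * b = 0 ∧
          ((A 1 1 : ℤ) : ZMod ℓ) - (A 1 0 : ℤ) * b = 0 := by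
        by_cases h0 : ((A 0 0 : ℤ) : ZMod ℓ) = 0
        · have h1 : ((A 1 0 : ℤ) : ZMod ℓ) ≠ 0 := fun h1 => hd
            ⟨(ZMod.intCast_zmod_eq_zero_iff_dvd _ _).mp h0,
              (ZMod.intCast_zmod_eq_zero_iff_dvd _ _).mp h1⟩
          refine ⟨(A 1 1 : ℤ) / (A 1 0 : ℤ), ?_, ?_⟩
          · field_simp
            linear_combination -hA'
          · field_simp
            ring
        · refine ⟨(A 0 1 : ℤ) / (A 0 0 : ℤ), ?_, ?_⟩
          · field_simp
            ring
          · field_simp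
            linear_combination hA'
      obtain ⟨b, hb1, hb2⟩ := key
      refine ⟨b.val, ZMod.val_lt b, ?_, ?_⟩
      · rw [← ZMod.intCast_zmod_eq_zero_iff_dvd]
        simpa using hb1
      · rw [← ZMod.intCast_zmod_eq_zero_iff_dvd]
        simpa using hb2
    obtain ⟨b, hbl, ⟨x, hx⟩, ⟨y, hy⟩⟩ := hb
    refine ⟨some ⟨b, hbl⟩, ⟨!![A 0 0, x; A 1 0, y], ?_⟩, ?_, ?_⟩
    · rw [Matrix.det_fin_two_of]
      refine mul_left_cancel₀ hℓ0 ?_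
      linear_combination hA - A 0 0 * hy + A 1 0 * hx
    · refine Gamma0_mem.mpr ?_
      change ((A 1 0 : ℤ) : ZMod N) = 0
      rwa [ZMod.intCast_zmod_eq_zero_iff_dvd]
    · ext i j
      fin_cases i <;> fin_cases j <;> simp [heckeRep, Matrix.mul_apply] <;> linarith

lemma slash_intGL_apply {A : Matrix (Fin 2) (Fin 2) ℤ} (hA : 0 < A.det) (f : ℍ → ℂ) (τ : ℍ) :
    (f ∣[(1 : ℤ)] intGL A) τ =
      f (intGL A • τ) * ((A 1 0 : ℂ) * τ + (A 1 1 : ℂ))⁻¹ := by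
  have hdet : 0 < (intGL A).det.val := by
    rw [intGL_det hA.ne']; exact_mod_cast hA
  have hdet' : 0 < (intGL A : Matrix (Fin 2) (Fin 2) ℝ).det := hdet
  simp [ModularForm.slash_apply, UpperHalfPlane.σ, hdet', UpperHalfPlane.denom,
    intGL_apply hA.ne']

lemma intGL_smul_coe {A : Matrix (Fin 2) (Fin 2) ℤ} (hA : 0 < A.det) (τ : ℍ) :
    ((intGL A • τ : ℍ) : ℂ) =
      ((A 0 0 : ℂ) * τ + (A 0 1 : ℂ)) / ((A 1 0 : ℂ) * τ + (A 1 1 : ℂ)) := by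
  have hdet : 0 < (intGL A).det.val := by
    rw [intGL_det hA.ne']; exact_mod_cast hA
  rw [UpperHalfPlane.coe_smul_of_det_pos hdet]
  simp [UpperHalfPlane.num, UpperHalfPlane.denom, intGL_apply hA.ne']

lemma heckeFun_eq_sum (ℓ : ℕ) [NeZero ℓ] {N : ℕ} (χ : DirichletCharacter ℂ N) (f : ℍ → ℂ) :
    heckeFun ℓ (χ (ℓ : ZMod N)) f = ∑ i : Option (Fin ℓ),
      χ ((heckeRep ℓ i 0 0 : ℤ) : ZMod N) • (f ∣[(1 : ℤ)] intGL (heckeRep ℓ i)) := by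
  have hdet (i : Option (Fin ℓ)) : 0 < (heckeRep ℓ i).det := by
    rw [heckeRep_det]; exact_mod_cast NeZero.pos ℓ
  ext τ
  rw [Fintype.sum_option, Pi.add_apply, Finset.sum_apply, heckeFun, add_comm]
  congr 1
  · rw [Pi.smul_apply, slash_intGL_apply (hdet none)]
    have : intGL (heckeRep ℓ none) • τ = up ℓ τ := by
      ext
      rw [intGL_smul_coe (hdet none)]
      simp [heckeRep]
    rw [this]
    simp [heckeRep]
  · rw [Finset.mul_sum, Finset.sum_range]
    refine Finset.sum_congr rfl fun b _ => ?_
    rw [Pi.smul_apply, slash_intGL_apply (hdet (some b))]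
    have : intGL (heckeRep ℓ (some b)) • τ = dn ℓ b τ := by
      ext
      rw [intGL_smul_coe (hdet (some b))]
      simp [heckeRep]
    rw [this]
    simp [heckeRep, mul_comm]

lemma slash_SL_eq (k : ℤ) (f : ℍ → ℂ) (γ : SL(2, ℤ)) :
    f ∣[k] γ = f ∣[k] intGL (γ : Matrix (Fin 2) (Fin 2) ℤ) := by
  rw [intGL_SL]; rfl

lemma heckeFun_hasNeben {N ℓ : ℕ} [NeZero ℓ] (hℓ : ℓ.Prime) (hℓN : ¬ ℓ ∣ N)
    {χ : DirichletCharacter ℂ N} {f : ℍ → ℂ} (hf : HasNeben 1 χ f) :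
    HasNeben 1 χ (heckeFun ℓ (χ (ℓ : ZMod N)) f) := by
  intro γ hγ
  have hℓ0 : (ℓ : ℤ) ≠ 0 := by exact_mod_cast hℓ.ne_zero
  have hdet (i : Option (Fin ℓ)) : (heckeRep ℓ i).det ≠ 0 := by rwa [heckeRep_det]
  have hdet1 (δ : SL(2, ℤ)) : (δ : Matrix (Fin 2) (Fin 2) ℤ).det ≠ 0 := by simp
  have hγN : (N : ℤ) ∣ γ.1 1 0 := (ZMod.intCast_zmod_eq_zero_iff_dvd _ _).mp (Gamma0_mem.mp hγ)
  have hex (i : Option (Fin ℓ)) := heckeRep_exists (N := N) hℓ hℓN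
    (A := heckeRep ℓ i * γ) (by rw [Matrix.det_mul, heckeRep_det]; simp) (by
      rw [Matrix.mul_apply, Fin.sum_univ_two, heckeRep_lower]
      simpa using hγN.mul_left _)
  choose σ δ hδ hσ using hex
  have hinj : Injective σ := by
    intro i j hij
    apply heckeRep_unique hℓ.one_lt (δ := δ i * (δ j)⁻¹)
    have h1 : heckeRep ℓ i = δ i * heckeRep ℓ (σ i) * (γ⁻¹ : SL(2, ℤ)) := by
      rw [← hσ i, mul_assoc, ← Matrix.SpecialLinearGroup.coe_mul]; simp
    have h2 : heckeRep ℓ j = δ j * heckeRep ℓ (σ i) * (γ⁻¹ : SL(2, ℤ)) := by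
      rw [hij, ← hσ j, mul_assoc, ← Matrix.SpecialLinearGroup.coe_mul]; simp
    rw [h1, h2, Matrix.SpecialLinearGroup.coe_mul]
    simp only [← mul_assoc]
    congr 2
    rw [mul_assoc (δ i : Matrix (Fin 2) (Fin 2) ℤ), ← Matrix.SpecialLinearGroup.coe_mul]
    simp
  have hbij : Bijective σ := Finite.injective_iff_bijective.mp hinj
  have had (δ : SL(2, ℤ)) (hδ : δ ∈ Gamma0 N) :
      ((δ.1 0 0 : ℤ) : ZMod N) * ((δ.1 1 1 : ℤ) : ZMod N) = 1 := by
    have h1 := δ.det_coe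
    rw [Matrix.det_fin_two] at h1
    have h2 := congrArg (Int.cast : ℤ → ZMod N) h1
    push_cast at h2
    have h3 : ((δ.1 1 0 : ℤ) : ZMod N) = 0 := Gamma0_mem.mp hδ
    rw [h3] at h2
    simpa using h2
  rw [heckeFun_eq_sum, SlashAction.sum_slash, Finset.smul_sum]
  rw [← hbij.sum_comp (fun i => χ ((γ 1 1 : ℤ) : ZMod N) •
    χ ((heckeRep ℓ i 0 0 : ℤ) : ZMod N) • (f ∣[(1 : ℤ)] intGL (heckeRep ℓ i)))]
  refine Finset.sum_congr rfl fun i _ => ?_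
  rw [ModularForm.SL_smul_slash, slash_SL_eq, ← SlashAction.slash_mul,
    ← intGL_mul (hdet i) (hdet1 γ), hσ i, intGL_mul (hdet1 _) (hdet _), SlashAction.slash_mul,
    ← slash_SL_eq, hf _ (hδ i)]
  have hsl : (χ (((δ i) 1 1 : ℤ) : ZMod N) • f) ∣[(1 : ℤ)] intGL (heckeRep ℓ (σ i)) =
      χ (((δ i) 1 1 : ℤ) : ZMod N) • (f ∣[(1 : ℤ)] intGL (heckeRep ℓ (σ i))) := by
    rw [ModularForm.smul_slash]
    have hpos : 0 < (intGL (heckeRep ℓ (σ i)) : Matrix (Fin 2) (Fin 2) ℝ).det := by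
      rw [← Matrix.GeneralLinearGroup.val_det_apply, intGL_det (hdet _), heckeRep_det]
      exact_mod_cast hℓ.pos
    simp [UpperHalfPlane.σ, hpos]
  rw [hsl, smul_smul, smul_smul]
  congr 1
  have e00 := congrFun (congrFun (hσ i) 0) 0
  rw [Matrix.mul_apply, Matrix.mul_apply, Fin.sum_univ_two, Fin.sum_univ_two, heckeRep_lower] at e00
  have e00' := congrArg (Int.cast : ℤ → ZMod N) e00
  push_cast at e00'
  have h3 : ((γ.1 1 0 : ℤ) : ZMod N) = 0 := Gamma0_mem.mp hγ
  rw [h3, mul_zero, mul_zero, add_zero, add_zero] at e00'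
  rw [← map_mul, ← map_mul]
  congr 1
  have hd1 := had (δ i) (hδ i)
  have hg1 := had γ hγ
  linear_combination ((heckeRep ℓ i 0 0 : ℤ) : ZMod N) * (-((δ i).1 1 1 : ℤ)) * hg1 +
    ((γ.1 1 1 : ℤ) : ZMod N) * ((δ i).1 1 1 : ℤ) * e00' +
    ((γ.1 1 1 : ℤ) : ZMod N) * (heckeRep ℓ (σ i) 0 0 : ℤ) * hd1

/-- The Hecke operator `T_ℓ` on weight-one cusp forms of level `N` and nebentypus `χ`. -/
lemma exists_heckeCuspForm {N ℓ : ℕ} [NeZero N] [NeZero ℓ] (hℓ : ℓ.Prime) (hℓN : ¬ ℓ ∣ N)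
    {χ : DirichletCharacter ℂ N} (f : CuspForm (Gamma1 N) 1) (hf : HasNeben 1 χ ⇑f) :
    ∃ g : CuspForm (Gamma1 N) 1, HasNeben 1 χ ⇑g ∧ ⇑g = heckeFun ℓ (χ (ℓ : ZMod N)) f := by
  have hn := heckeFun_hasNeben hℓ hℓN hf
  refine ⟨⟨⟨heckeFun ℓ (χ (ℓ : ZMod N)) f, hn.slash_eq_of_mem_Gamma1⟩, ?_, ?_⟩, hn, rfl⟩
  · change MDifferentiable _ _ (heckeFun ℓ (χ (ℓ : ZMod N)) f)
    rw [heckeFun_eq_sum]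
    refine Finset.sum_induction _ (fun g : ℍ → ℂ => MDifferentiable (modelWithCornersSelf ℂ ℂ)
      (modelWithCornersSelf ℂ ℂ) g) (fun _ _ => MDifferentiable.add) mdifferentiable_const
      fun i _ => (MDifferentiable.slash f.holo' 1 _).const_smul _
  · intro c hc
    change c.IsZeroAt (heckeFun ℓ (χ (ℓ : ZMod N)) f) 1
    rw [heckeFun_eq_sum]
    refine Finset.sum_induction _ (fun g : ℍ → ℂ => c.IsZeroAt g 1)
      (fun _ _ => OnePoint.IsZeroAt.add) (fun g _ => ?_)
      fun i _ => ?_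
    · rw [SlashAction.zero_slash]; exact Filter.zero_zeroAtFilter _
    · have hz := isZeroAt_slash_intGL f (heckeRep ℓ i) hc
      intro g hg
      rw [ModularForm.smul_slash]
      exact (hz g hg).smul _

lemma qExpansionL_mul {N : ℕ} {j k : ℤ} {F G : Type*} [FunLike F ℍ ℂ] [FunLike G ℍ ℂ]
    [ModularFormClass F (Gamma1 N) j] [ModularFormClass G (Gamma1 N) k] (f : F) (g : G) :
    qExpansionL (⇑f * ⇑g) = qExpansionL f * qExpansionL g := by
  rw [qExpansionL, qExpansionPS_eq, ModularForm.qExpansion_mul_coe one_pos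
    (one_mem_strictPeriods N) f g, map_mul, qExpansionL, qExpansionL, qExpansionPS_eq,
    qExpansionPS_eq]

lemma isUnit_of_mem_Gamma0 {N : ℕ} {γ : SL(2, ℤ)} (hγ : γ ∈ Gamma0 N) :
    IsUnit ((γ 1 1 : ℤ) : ZMod N) := by
  have h1 := γ.det_coe
  rw [Matrix.det_fin_two] at h1
  have h2 := congrArg (Int.cast : ℤ → ZMod N) h1
  push_cast at h2
  have h3 : ((γ.1 1 0 : ℤ) : ZMod N) = 0 := Gamma0_mem.mp hγ
  rw [h3] at h2
  exact IsUnit.of_mul_eq_one_right ((γ.1 0 0 : ℤ) : ZMod N) (by simpa using h2)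

lemma HasNeben.mul {N : ℕ} {j k : ℤ} {χ ψ : DirichletCharacter ℂ N} {f g : ℍ → ℂ}
    (hf : HasNeben j χ f) (hg : HasNeben k ψ g) : HasNeben (j + k) (χ * ψ) (f * g) := by
  intro γ hγ
  rw [ModularForm.mul_slash_SL2, hf γ hγ, hg γ hγ, smul_mul_smul_comm, MulChar.mul_apply]

/-- Multiplication by a form of nebentypus `χ⁻¹` sends `S₁(N, χ)` to `S₂(N, 1)`. -/
lemma exists_cuspForm_mul {N : ℕ} {χ : DirichletCharacter ℂ N} (f : CuspForm (Gamma1 N) 1)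
    (hf : HasNeben 1 χ f) (l : ModularForm (Gamma1 N) 1) (hl : HasNeben 1 χ⁻¹ l) :
    ∃ g : CuspForm (Gamma1 N) 2, HasNeben 2 (1 : DirichletCharacter ℂ N) g ∧
      qExpansionL f * qExpansionL l = qExpansionL g := by
  refine ⟨(f.mulModularForm l).mcast (by norm_num), ?_, (qExpansionL_mul f l).symm⟩
  have := hf.mul hl
  rwa [mul_inv_cancel] at this

/-- The `q`-expansion of a weight-one cusp form lies in `V'_{Λ,ℓ}`. -/
lemma qExpansionL_mem_VLamEll {N ℓ : ℕ} [NeZero N] [NeZero ℓ] (hℓ : ℓ.Prime) (hℓN : ¬ ℓ ∣ N)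
    {χ : DirichletCharacter ℂ N} (Λ : Finset (ModularForm (Gamma1 N) 1))
    (hΛ : ∀ l ∈ Λ, HasNeben 1 χ⁻¹ ⇑l) (f : CuspForm (Gamma1 N) 1) (hf : HasNeben 1 χ f) :
    qExpansionL f ∈ VLamEll N χ ℓ Λ := by
  have mem (f : CuspForm (Gamma1 N) 1) (hf : HasNeben 1 χ f) : qExpansionL f ∈ VLam N Λ :=
    fun l hl => exists_cuspForm_mul f hf l (hΛ l hl)
  refine ⟨mem f hf, fun s h0 hs m _ => ?_⟩
  have key (m : ℕ) : ∃ g : CuspForm (Gamma1 N) 1, HasNeben 1 χ g ∧ qExpansionL g = s m := by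
    induction m with
    | zero => exact ⟨f, hf, h0.symm⟩
    | succ m ih =>
      obtain ⟨g, hg, hgs⟩ := ih
      obtain ⟨g', hg', hg's⟩ := exists_heckeCuspForm hℓ hℓN g hg
      refine ⟨g', hg', ?_⟩
      have h1 := (hasLExp_modularForm g).heckeFun le_rfl (hgs ▸ hs m)
      have h2 := hasLExp_modularForm g'
      rw [← hg's] at h1
      exact h2.unique h1
  obtain ⟨g, hg, hgs⟩ := key m
  exact hgs ▸ mem g hg

/-- The first coefficient `φ(|τ|²/y)` of the binary quadratic form attached to `τ = x + iy` and
a `ℚ`-linear functional `φ`. -/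
def formA (φ : ℝ →ₗ[ℚ] ℚ) (τ : ℍ) : ℚ := φ ((τ.re ^ 2 + τ.im ^ 2) / τ.im)

/-- The middle coefficient `φ(2x/y)` of the form attached to `τ = x + iy`. -/
def formB (φ : ℝ →ₗ[ℚ] ℚ) (τ : ℍ) : ℚ := φ (2 * τ.re / τ.im)

/-- The last coefficient `φ(1/y)` of the form attached to `τ = x + iy`. -/
def formC (φ : ℝ →ₗ[ℚ] ℚ) (τ : ℍ) : ℚ := φ (1 / τ.im)

/-- The `ℓ`-adic size of the binary quadratic form attached to `τ`. -/
def formNorm (ℓ : ℕ) (φ : ℝ →ₗ[ℚ] ℚ) (τ : ℍ) : ℚ :=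
  max (padicNorm ℓ (formA φ τ)) (max (padicNorm ℓ (formB φ τ)) (padicNorm ℓ (formC φ τ)))

lemma map_rat_mul (φ : ℝ →ₗ[ℚ] ℚ) (q : ℚ) (x : ℝ) : φ ((q : ℝ) * x) = q * φ x := by
  have := φ.map_smul q x
  rwa [Rat.smul_def, smul_eq_mul] at this

lemma map_comb (φ : ℝ →ₗ[ℚ] ℚ) (p q r : ℚ) (x y z : ℝ) :
    φ (p * x + q * y + r * z) = p * φ x + q * φ y + r * φ z := by
  simp only [map_add, map_rat_mul]

lemma re_dn (ℓ : ℕ) [NeZero ℓ] (b : ℕ) (τ : ℍ) : (dn ℓ b τ).re = (τ.re + b) / ℓ := by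
  rw [← coe_re, coe_dn, ← Complex.ofReal_natCast ℓ, Complex.div_ofReal_re]; simp

lemma re_up (ℓ : ℕ) [NeZero ℓ] (τ : ℍ) : (up ℓ τ).re = ℓ * τ.re := by
  rw [← coe_re, coe_up, ← Complex.ofReal_natCast ℓ, Complex.re_ofReal_mul]; simp

section forms
variable (ℓ : ℕ) [NeZero ℓ] (φ : ℝ →ₗ[ℚ] ℚ)

lemma formA_dn (b : ℕ) (τ : ℍ) :
    formA φ (dn ℓ b τ) = (formA φ τ + b * formB φ τ + b ^ 2 * formC φ τ) / ℓ := by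
  have h1 := τ.im_ne_zero
  have h2 : (ℓ : ℝ) ≠ 0 := Nat.cast_ne_zero.mpr (NeZero.ne ℓ)
  have := map_comb φ (1 / ℓ) (b / ℓ) (b ^ 2 / ℓ) ((τ.re ^ 2 + τ.im ^ 2) / τ.im)
    (2 * τ.re / τ.im) (1 / τ.im)
  rw [formA, formA, formB, formC, re_dn, im_dn]
  convert this using 1
  · congr 1
    push_cast
    field_simp
    ring
  · ring

lemma formB_dn (b : ℕ) (τ : ℍ) :
    formB φ (dn ℓ b τ) = formB φ τ + 2 * b * formC φ τ := by
  have h1 := τ.im_ne_zero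
  have h2 : (ℓ : ℝ) ≠ 0 := Nat.cast_ne_zero.mpr (NeZero.ne ℓ)
  have := map_comb φ 0 1 (2 * b) 0 (2 * τ.re / τ.im) (1 / τ.im)
  rw [formB, formB, formC, re_dn, im_dn]
  convert this using 1
  · congr 1
    push_cast
    field_simp
    ring
  · ring

lemma formC_dn (b : ℕ) (τ : ℍ) : formC φ (dn ℓ b τ) = ℓ * formC φ τ := by
  have h2 : (ℓ : ℝ) ≠ 0 := Nat.cast_ne_zero.mpr (NeZero.ne ℓ)
  rw [formC, formC, im_dn, ← map_rat_mul]
  congr 1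
  push_cast
  field_simp

lemma formA_up (τ : ℍ) : formA φ (up ℓ τ) = ℓ * formA φ τ := by
  have h1 := τ.im_ne_zero
  have h2 : (ℓ : ℝ) ≠ 0 := Nat.cast_ne_zero.mpr (NeZero.ne ℓ)
  rw [formA, formA, re_up, im_up, ← map_rat_mul]
  congr 1
  push_cast
  field_simp

lemma formB_up (τ : ℍ) : formB φ (up ℓ τ) = formB φ τ := by
  have h1 := τ.im_ne_zero
  have h2 : (ℓ : ℝ) ≠ 0 := Nat.cast_ne_zero.mpr (NeZero.ne ℓ)
  rw [formB, formB, re_up, im_up]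
  congr 1
  field_simp

lemma formC_up (τ : ℍ) : formC φ (up ℓ τ) = formC φ τ / ℓ := by
  have h1 := τ.im_ne_zero
  have h2 : (ℓ : ℝ) ≠ 0 := Nat.cast_ne_zero.mpr (NeZero.ne ℓ)
  rw [formC, formC, im_up, div_eq_inv_mul (φ _), ← map_rat_mul]
  congr 1
  push_cast
  field_simp

end forms

lemma forms_aux₁ {a b c d x y : ℝ} (hy : y ≠ 0) (hD : (c * x + d) ^ 2 + (c * y) ^ 2 ≠ 0)
    (hdet : a * d - b * c = 1) :
    ((((a * x + b) * (c * x + d) + a * c * y ^ 2) / ((c * x + d) ^ 2 + (c * y) ^ 2)) ^ 2 +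
        (y / ((c * x + d) ^ 2 + (c * y) ^ 2)) ^ 2) / (y / ((c * x + d) ^ 2 + (c * y) ^ 2)) =
      a ^ 2 * ((x ^ 2 + y ^ 2) / y) + a * b * (2 * x / y) + b ^ 2 * (1 / y) := by
  have key : ((a * x + b) * (c * x + d) + a * c * y ^ 2) ^ 2 + y ^ 2 =
      ((c * x + d) ^ 2 + (c * y) ^ 2) * ((a * x + b) ^ 2 + (a * y) ^ 2) := by
    linear_combination (-y ^ 2 * (a * d - b * c + 1)) * hdet
  generalize (c * x + d) ^ 2 + (c * y) ^ 2 = D at *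
  field_simp
  linear_combination key

lemma forms_aux₂ {a b c d x y : ℝ} (hy : y ≠ 0) (hD : (c * x + d) ^ 2 + (c * y) ^ 2 ≠ 0) :
    2 * (((a * x + b) * (c * x + d) + a * c * y ^ 2) / ((c * x + d) ^ 2 + (c * y) ^ 2)) /
        (y / ((c * x + d) ^ 2 + (c * y) ^ 2)) =
      2 * a * c * ((x ^ 2 + y ^ 2) / y) + (a * d + b * c) * (2 * x / y) +
        2 * b * d * (1 / y) := by
  generalize (c * x + d) ^ 2 + (c * y) ^ 2 = D at *
  field_simp
  ring

lemma re_im_SL_smul (γ : SL(2, ℤ)) (τ : ℍ) :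
    (γ • τ).im = τ.im / ((γ 1 0 * τ.re + γ 1 1) ^ 2 + (γ 1 0 * τ.im) ^ 2) ∧
    (γ • τ).re = ((γ 0 0 * τ.re + γ 0 1) * (γ 1 0 * τ.re + γ 1 1) +
      γ 0 0 * γ 1 0 * τ.im ^ 2) / ((γ 1 0 * τ.re + γ 1 1) ^ 2 + (γ 1 0 * τ.im) ^ 2) := by
  constructor
  · rw [ModularGroup.im_smul_eq_div_normSq, ModularGroup.denom_apply, Complex.normSq_apply]
    simp [pow_two]
  · rw [← coe_re, UpperHalfPlane.specialLinearGroup_apply, Complex.div_re, ← add_div,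
      Complex.normSq_apply]
    simp [pow_two]
    ring_nf

lemma formNorm_smul_le (ℓ : ℕ) [Fact ℓ.Prime] (φ : ℝ →ₗ[ℚ] ℚ) (γ : SL(2, ℤ)) (τ : ℍ) :
    formNorm ℓ φ (γ • τ) ≤ formNorm ℓ φ τ := by
  obtain ⟨him, hre⟩ := re_im_SL_smul γ τ
  have hy := τ.im_ne_zero
  have hden : ((γ 1 0 * τ.re + γ 1 1 : ℝ) ^ 2 + (γ 1 0 * τ.im) ^ 2) ≠ 0 := by
    intro h
    rw [h, div_zero] at him
    exact (γ • τ).im_ne_zero him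
  have hdet : (γ 0 0 : ℝ) * γ 1 1 - γ 0 1 * γ 1 0 = 1 := by
    have h1 := γ.det_coe
    rw [Matrix.det_fin_two] at h1
    exact_mod_cast h1
  have bound (p q r : ℤ) : padicNorm ℓ (p * formA φ τ + q * formB φ τ + r * formC φ τ) ≤
      formNorm ℓ φ τ := by
    have aux (n : ℤ) (x : ℚ) (hx : padicNorm ℓ x ≤ formNorm ℓ φ τ) :
        padicNorm ℓ (n * x) ≤ formNorm ℓ φ τ := by
      rw [padicNorm.mul]
      exact (mul_le_of_le_one_left (padicNorm.nonneg _) (padicNorm.of_int n)).trans hx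
    refine padicNorm.nonarchimedean.trans
      (max_le (padicNorm.nonarchimedean.trans (max_le ?_ ?_)) ?_)
    · exact aux _ _ (le_max_left _ _)
    · exact aux _ _ ((le_max_left _ _).trans (le_max_right _ _))
    · exact aux _ _ ((le_max_right _ _).trans (le_max_right _ _))
  have comb (p q r : ℤ) (x : ℝ) (hx : x = p * ((τ.re ^ 2 + τ.im ^ 2) / τ.im) +
      q * (2 * τ.re / τ.im) + r * (1 / τ.im)) : padicNorm ℓ (φ x) ≤ formNorm ℓ φ τ := by
    have := map_comb φ p q r ((τ.re ^ 2 + τ.im ^ 2) / τ.im) (2 * τ.re / τ.im) (1 / τ.im)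
    simp only [Rat.cast_intCast] at this
    rw [hx, this]
    exact bound p q r
  refine max_le (comb (γ 0 0 ^ 2) (γ 0 0 * γ 0 1) (γ 0 1 ^ 2) _ ?_)
    (max_le (comb (2 * γ 0 0 * γ 1 0) (γ 0 0 * γ 1 1 + γ 0 1 * γ 1 0) (2 * γ 0 1 * γ 1 1) _ ?_)
    (comb (γ 1 0 ^ 2) (γ 1 0 * γ 1 1) (γ 1 1 ^ 2) _ ?_))
  · rw [him, hre]
    push_cast
    exact forms_aux₁ hy hden hdet
  · rw [him, hre]
    push_cast
    exact forms_aux₂ hy hden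
  · rw [him]
    push_cast
    field_simp
    ring

lemma formNorm_smul (ℓ : ℕ) [Fact ℓ.Prime] (φ : ℝ →ₗ[ℚ] ℚ) (γ : SL(2, ℤ)) (τ : ℍ) :
    formNorm ℓ φ (γ • τ) = formNorm ℓ φ τ := by
  refine le_antisymm (formNorm_smul_le ℓ φ γ τ) ?_
  simpa using formNorm_smul_le ℓ φ γ⁻¹ (γ • τ)

lemma exists_linearMap_ne_zero {x : ℝ} (hx : x ≠ 0) : ∃ φ : ℝ →ₗ[ℚ] ℚ, φ x ≠ 0 := by
  by_contra! h
  exact hx ((Module.forall_dual_apply_eq_zero_iff ℚ x).mp h)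

lemma padicNorm_add_eq_left {p : ℕ} [Fact p.Prime] {x y : ℚ} (h : padicNorm p y < padicNorm p x) :
    padicNorm p (x + y) = padicNorm p x := by
  rw [padicNorm.add_eq_max_of_ne h.ne', max_eq_left h.le]

lemma padicNorm_natCast_mul_le {p : ℕ} [Fact p.Prime] (n : ℕ) (x : ℚ) :
    padicNorm p (n * x) ≤ padicNorm p x := by
  rw [padicNorm.mul]
  exact mul_le_of_le_one_left (padicNorm.nonneg _) (padicNorm.of_nat n)

lemma padicNorm_div_natCast_self {p : ℕ} [Fact p.Prime] (x : ℚ) :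
    padicNorm p (x / p) = p * padicNorm p x := by
  rw [padicNorm.div, padicNorm.padicNorm_p_of_prime, div_inv_eq_mul, mul_comm]

/-- A set of points of `ℍ` closed under the propagation rules coming from a Hecke correspondence
and whose complement meets finitely many `SL(2, ℤ)`-orbits is all of `ℍ`. -/
lemma forall_of_hecke_propagation {ℓ : ℕ} [NeZero ℓ] [Fact ℓ.Prime] {R : ℍ → Prop}
    (hT : ∀ τ, R (up ℓ (dn ℓ 1 τ)) → R τ)
    (hup : ∀ w, R w → (∀ b < ℓ, R (dn ℓ b w)) → R (up ℓ w))
    (hdn : ∀ w, R w → R (up ℓ w) → (∀ b < ℓ, 1 ≤ b → R (dn ℓ b w)) → R (dn ℓ 0 w))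
    {S : Set ℍ} (hS : S.Finite) (hRS : ∀ τ, ¬ R τ → ∃ γ : SL(2, ℤ), γ • τ ∈ S) (τ : ℍ) : R τ := by
  by_contra hτ
  obtain ⟨φ, hφ⟩ := exists_linearMap_ne_zero (x := 1 / τ.im) (one_div_ne_zero τ.im_ne_zero)
  have hfin : (formNorm ℓ φ '' {z | ¬ R z}).Finite := by
    refine (hS.image (formNorm ℓ φ)).subset ?_
    rintro _ ⟨z, hz, rfl⟩
    obtain ⟨γ, hγ⟩ := hRS z hz
    exact ⟨γ • z, hγ, formNorm_smul ℓ φ γ z⟩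
  obtain ⟨_, ⟨⟨z, hz, rfl⟩, hmax⟩⟩ := hfin.exists_maximal ⟨_, τ, hτ, rfl⟩
  set M := formNorm ℓ φ z with hM
  have hlt (w : ℍ) (hw : M < formNorm ℓ φ w) : R w := by
    by_contra h
    exact absurd (hmax ⟨w, h, rfl⟩ hw.le) (not_le.mpr hw)
  have hMpos : 0 < M := by
    have h1 : 0 < formNorm ℓ φ τ := lt_of_lt_of_le
      (lt_of_le_of_ne (padicNorm.nonneg _) (padicNorm.nonzero hφ).symm)
      ((le_max_right _ _).trans (le_max_right _ _))
    rcases le_total M (formNorm ℓ φ τ) with h | h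
    · exact h1.trans_le (hmax ⟨τ, hτ, rfl⟩ h)
    · exact h1.trans_le h
  have hℓ : (1 : ℚ) < ℓ := by exact_mod_cast (Fact.out : ℓ.Prime).one_lt
  have hA : padicNorm ℓ (formA φ z) ≤ M := le_max_left _ _
  have hB : padicNorm ℓ (formB φ z) ≤ M := (le_max_left _ _).trans (le_max_right _ _)
  have hC : padicNorm ℓ (formC φ z) ≤ M := (le_max_right _ _).trans (le_max_right _ _)
  have leA (w : ℍ) : padicNorm ℓ (formA φ w) ≤ formNorm ℓ φ w := le_max_left _ _
  have leC (w : ℍ) : padicNorm ℓ (formC φ w) ≤ formNorm ℓ φ w :=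
    (le_max_right _ _).trans (le_max_right _ _)
  have hM1 : M < ℓ * M := by nlinarith
  have hM2 : M < ℓ * (ℓ * M) := by nlinarith
  -- the case where a value of the form at `(1, b)` is maximal
  have case1 (b : ℕ) (hb : padicNorm ℓ (formA φ z + b * formB φ z + b ^ 2 * formC φ z) = M) :
      R (up ℓ (dn ℓ b z)) := by
    have hAw : padicNorm ℓ (formA φ (dn ℓ b z)) = ℓ * M := by
      rw [formA_dn, padicNorm_div_natCast_self, hb]
    refine hup _ (hlt _ (hM1.trans_le (hAw ▸ leA _))) fun b' _ => hlt _ ?_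
    refine lt_of_lt_of_le ?_ (leA _)
    rw [formA_dn, padicNorm_div_natCast_self, add_assoc, padicNorm_add_eq_left, hAw]
    · exact hM2
    · rw [hAw]
      refine lt_of_le_of_lt (padicNorm.nonarchimedean.trans (max_le ?_ ?_)) hM1
      · refine (padicNorm_natCast_mul_le _ _).trans ?_
        rw [formB_dn]
        refine padicNorm.nonarchimedean.trans (max_le hB ?_)
        have := (padicNorm_natCast_mul_le (p := ℓ) (2 * b) (formC φ z)).trans hC
        push_cast at this
        exact this
      · have := (padicNorm_natCast_mul_le (p := ℓ) (b' ^ 2) (formC φ (dn ℓ b z)))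
        push_cast at this
        refine this.trans ?_
        rw [formC_dn]
        exact (padicNorm_natCast_mul_le _ _).trans hC
  have case2 (hCM : padicNorm ℓ (formC φ z) = M) : R z := by
    have hCw : padicNorm ℓ (formC φ (up ℓ z)) = ℓ * M := by
      rw [formC_up, padicNorm_div_natCast_self, hCM]
    have hCw' : padicNorm ℓ (formC φ (up ℓ (up ℓ z))) = ℓ * (ℓ * M) := by
      rw [formC_up, padicNorm_div_natCast_self, hCw]
    have h0 : dn ℓ 0 (up ℓ z) = z := by
      have : (ℓ : ℂ) ≠ 0 := Nat.cast_ne_zero.mpr (NeZero.ne ℓ)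
      ext
      simp [this]
    rw [← h0]
    refine hdn _ (hlt _ (hM1.trans_le (hCw ▸ leC _))) (hlt _ (hM2.trans_le (hCw' ▸ leC _)))
      fun b hbl hb1 => hlt _ (lt_of_lt_of_le ?_ (leA _))
    have hb : padicNorm ℓ ((b : ℚ) ^ 2 * formC φ (up ℓ z)) = ℓ * M := by
      have : padicNorm ℓ (b : ℚ) = 1 := by
        rw [padicNorm.nat_eq_one_iff]
        exact fun h => absurd (Nat.le_of_dvd hb1 h) (not_le.mpr hbl)
      rw [padicNorm.mul, pow_two, padicNorm.mul, this, hCw]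
      ring
    rw [formA_dn, padicNorm_div_natCast_self, add_comm (_ + _), padicNorm_add_eq_left, hb]
    · exact hM2
    · rw [hb]
      refine lt_of_le_of_lt (padicNorm.nonarchimedean.trans (max_le ?_ ?_)) hM1
      · rw [formA_up]
        exact (padicNorm_natCast_mul_le _ _).trans hA
      · rw [formB_up]
        exact (padicNorm_natCast_mul_le _ _).trans hB
  by_cases hC' : padicNorm ℓ (formC φ z) = M
  · exact hz (case2 hC')
  by_cases hA' : padicNorm ℓ (formA φ z) = M
  · have := case1 0 (by simpa using hA')
    have h0 : up ℓ (dn ℓ 0 z) = z := by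
      have : (ℓ : ℂ) ≠ 0 := Nat.cast_ne_zero.mpr (NeZero.ne ℓ)
      ext
      simp
      field_simp
    exact hz (h0 ▸ this)
  · have hAlt := lt_of_le_of_ne hA hA'
    have hClt := lt_of_le_of_ne hC hC'
    have hBM : padicNorm ℓ (formB φ z) = M := by
      refine le_antisymm hB (le_of_not_gt fun h => ?_)
      exact absurd hM (max_lt hAlt (max_lt h hClt)).ne'
    refine hz (hT z (case1 1 ?_))
    have h1 : padicNorm ℓ (formB φ z + formA φ z) = M := by
      rw [padicNorm_add_eq_left (hBM ▸ hAlt), hBM]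
    rw [Nat.cast_one, one_pow, one_mul, one_mul, add_comm (formA φ z),
      padicNorm_add_eq_left (h1 ▸ hClt), h1]

section slash
variable {N : ℕ} {k : ℤ} {f : ℍ → ℂ} (hf : ∀ γ ∈ Gamma1 N, f ∣[k] γ = f)
include hf

lemma periodic_slash (γ : SL(2, ℤ)) : Periodic ((f ∣[k] γ) ∘ ofComplex) N := by
  have hmem : γ * ModularGroup.T ^ (N : ℤ) * γ⁻¹ ∈ Gamma1 N := by
    have h1 : ModularGroup.T ^ (N : ℤ) ∈ Gamma N :=
      ModularGroup_T_pow_mem_Gamma (N : ℤ) (N : ℤ) dvd_rfl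
    have h2 := Gamma_mem.mp ((Gamma_normal N).conj_mem _ h1 γ)
    exact (Gamma1_mem N _).mpr ⟨h2.1, h2.2.2.2, h2.2.2.1⟩
  have hT : (f ∣[k] γ) ∣[k] (ModularGroup.T ^ (N : ℤ)) = f ∣[k] γ := by
    conv_rhs => rw [← hf _ hmem]
    rw [← SlashAction.slash_mul, ← SlashAction.slash_mul]
    congr 1
    group
  intro w
  by_cases hw : 0 < w.im
  · have hw' : 0 < (w + N).im := by simpa using hw
    rw [comp_apply, comp_apply, ofComplex_apply_of_im_pos hw, ofComplex_apply_of_im_pos hw']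
    have h1 := congrFun hT ⟨w, hw⟩
    rw [ModularForm.SL_slash_apply] at h1
    have h2 : ModularGroup.T ^ (N : ℤ) • (⟨w, hw⟩ : ℍ) = ⟨w + N, hw'⟩ := by
      ext
      rw [ModularGroup.coe_T_zpow_smul_eq]
      simp
    rw [h2] at h1
    have h3 : denom (ModularGroup.T ^ (N : ℤ) : SL(2, ℤ)) (⟨w, hw⟩ : ℍ) = 1 := by
      rw [ModularGroup.denom_apply, ModularGroup.coe_T_zpow]
      simp
    rw [← h1]
    refine (mul_one _).symm.trans (congrArg _ ?_)
    exact ((congrArg (· ^ (-k)) h3).trans (one_zpow _)).symm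
  · have hw' : ¬ 0 < (w + N).im := by simpa using hw
    rw [comp_apply, comp_apply, ofComplex_apply_eq_of_im_nonpos (not_lt.mp hw') (not_lt.mp hw)]

lemma finite_range_slash [NeZero N] : (Set.range fun γ : SL(2, ℤ) => f ∣[k] γ).Finite := by
  let F : SL(2, ℤ) ⧸ Gamma1 N → ℍ → ℂ := Quotient.lift (fun γ : SL(2, ℤ) => f ∣[k] γ⁻¹) (by
    intro a b hab
    have h1 : a⁻¹ * b ∈ Gamma1 N := QuotientGroup.leftRel_apply.mp hab
    have h2 := hf _ h1
    change f ∣[k] a⁻¹ = f ∣[k] b⁻¹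
    rw [show a⁻¹ = a⁻¹ * b * b⁻¹ by group, SlashAction.slash_mul, h2])
  refine (Set.finite_range F).subset ?_
  rintro _ ⟨γ, rfl⟩
  refine ⟨QuotientGroup.mk γ⁻¹, ?_⟩
  change f ∣[k] γ⁻¹⁻¹ = f ∣[k] γ
  rw [inv_inv]

end slash

lemma exists_exp_lower_bound {f : ℍ → ℂ} {h : ℝ} (hh : 0 < h) (hper : Periodic (f ∘ ofComplex) h)
    (hol : MDifferentiable (modelWithCornersSelf ℂ ℂ) (modelWithCornersSelf ℂ ℂ) f)
    (hbdd : IsBoundedAtImInfty f) (hne : f ≠ 0) :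
    ∃ Y c C : ℝ, 0 ≤ c ∧ 0 < C ∧ ∀ τ : ℍ, Y ≤ τ.im → C * Real.exp (-c * τ.im) ≤ ‖f τ‖ := by
  have han := analyticAt_cuspFunction_zero hh hper hol hbdd
  have hnz : ¬ ∀ᶠ z in nhds 0, cuspFunction h f z = 0 := by
    intro h0
    refine hne ?_
    rw [← qExpansion_eq_zero_iff hh hper hol hbdd]
    ext n
    have h1 : cuspFunction h f =ᶠ[nhds 0] fun _ => 0 := h0
    rw [qExpansion_coeff, h1.iteratedDeriv_eq]
    simp
  obtain ⟨n, g, hg, hg0, hfg⟩ := han.exists_eventuallyEq_pow_smul_nonzero_iff.mpr hnz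
  have hgn : ∀ᶠ z in nhds (0 : ℂ), ‖g 0‖ / 2 < ‖g z‖ :=
    hg.continuousAt.norm.eventually_const_lt (half_lt_self (norm_pos_iff.mpr hg0))
  have hev := (qParam_tendsto_atImInfty hh).eventually (hfg.and hgn)
  obtain ⟨Y, hY⟩ := (atImInfty_mem _).mp hev
  refine ⟨Y, 2 * Real.pi * n / h, ‖g 0‖ / 2, by positivity, by positivity, fun τ hτ => ?_⟩
  obtain ⟨h1, h2⟩ := hY τ hτ
  rw [eq_cuspFunction τ hh.ne' hper, sub_zero] at h1
  rw [h1, norm_smul, norm_pow, Periodic.norm_qParam, ← Real.exp_nat_mul, mul_comm]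
  refine mul_le_mul (le_of_eq ?_) h2.le (by positivity) (by positivity)
  congr 1
  rw [coe_im]
  ring

lemma modularForm_slash_eq {N : ℕ} {k : ℤ} (l : ModularForm (Gamma1 N) k) (γ : SL(2, ℤ))
    (hγ : γ ∈ Gamma1 N) : ⇑l ∣[k] γ = l :=
  l.slash_action_eq' _ ⟨γ, hγ, rfl⟩

/-- Uniform lower bound at the cusps for a nonzero modular form. -/
lemma exists_uniform_lower_bound {N : ℕ} [NeZero N] {k : ℤ} (l : ModularForm (Gamma1 N) k)
    (hl : l ≠ 0) : ∃ Y c C : ℝ, 0 < Y ∧ 0 ≤ c ∧ 0 < C ∧ ∀ γ : SL(2, ℤ), ∀ τ : ℍ, Y ≤ τ.im →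
      C * Real.exp (-c * τ.im) ≤ ‖(⇑l ∣[k] γ) τ‖ := by
  have hN : (0 : ℝ) < N := Nat.cast_pos.mpr (NeZero.pos N)
  have key (γ : SL(2, ℤ)) : ∃ Y c C : ℝ, 0 ≤ c ∧ 0 < C ∧ ∀ τ : ℍ, Y ≤ τ.im →
      C * Real.exp (-c * τ.im) ≤ ‖(⇑l ∣[k] γ) τ‖ := by
    refine exists_exp_lower_bound hN (mod_cast periodic_slash (modularForm_slash_eq l) γ)
      (MDifferentiable.slash l.holo' k _) (ModularFormClass.bdd_at_infty_slash l γ) fun h0 => hl ?_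
    have : ⇑l = (⇑l ∣[k] γ) ∣[k] γ⁻¹ := by rw [← SlashAction.slash_mul]; simp
    rw [h0, SlashAction.zero_slash] at this
    exact DFunLike.coe_injective this
  have hfin := finite_range_slash (modularForm_slash_eq l)
  have main : ∀ S : Set (ℍ → ℂ), S.Finite → (∀ F ∈ S, ∃ Y c C : ℝ, 0 ≤ c ∧ 0 < C ∧ ∀ τ : ℍ,
      Y ≤ τ.im → C * Real.exp (-c * τ.im) ≤ ‖F τ‖) → ∃ Y c C : ℝ, 0 < Y ∧ 0 ≤ c ∧ 0 < C ∧
        ∀ F ∈ S, ∀ τ : ℍ, Y ≤ τ.im → C * Real.exp (-c * τ.im) ≤ ‖F τ‖ := by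
    intro S hS
    refine hS.induction_on _ (fun _ => ⟨1, 0, 1, by simp⟩) ?_
    intro F S _ _ ih hFS
    obtain ⟨Y, c, C, hY, hc, hC, h⟩ := ih fun G hG => hFS G (Set.mem_insert_of_mem _ hG)
    obtain ⟨Y', c', C', hc', hC', h'⟩ := hFS F (Set.mem_insert _ _)
    refine ⟨max Y Y', max c c', min C C', by positivity, by positivity, by positivity, ?_⟩
    intro G hG τ hτ
    have hτ0 := τ.im_pos.le
    rcases hG with rfl | hG
    · refine le_trans ?_ (h' τ ((le_max_right _ _).trans hτ))
      gcongr
      · exact min_le_right _ _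
      · exact le_max_right _ _
    · refine le_trans ?_ (h G hG τ ((le_max_left _ _).trans hτ))
      gcongr
      · exact min_le_left _ _
      · exact le_max_left _ _
  obtain ⟨Y, c, C, hY, hc, hC, h⟩ := main _ hfin (by rintro _ ⟨γ, rfl⟩; exact key γ)
  exact ⟨Y, c, C, hY, hc, hC, fun γ => h _ ⟨γ, rfl⟩⟩

section holomorphic
variable {f : ℍ → ℂ}
  (hol : MDifferentiable (modelWithCornersSelf ℂ ℂ) (modelWithCornersSelf ℂ ℂ) f)
include hol

lemma analyticAt_comp_ofComplex {z : ℂ} (hz : 0 < z.im) : AnalyticAt ℂ (f ∘ ofComplex) z :=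
  (UpperHalfPlane.mdifferentiable_iff.mp hol).analyticAt (isOpen_upperHalfPlaneSet.mem_nhds hz)

lemma eventually_ne_zero_of_ne_zero (hne : f ≠ 0) {z : ℂ} (hz : 0 < z.im) :
    ∀ᶠ w in nhdsWithin z {z}ᶜ, f (ofComplex w) ≠ 0 := by
  rcases (analyticAt_comp_ofComplex hol hz).eventually_eq_zero_or_eventually_ne_zero with h | h
  · exfalso
    have han : AnalyticOnNhd ℂ (f ∘ ofComplex) upperHalfPlaneSet :=
      fun w hw => analyticAt_comp_ofComplex hol hw
    have := han.eqOn_zero_of_preconnected_of_eventuallyEq_zero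
      (convex_halfSpace_im_gt 0).isPreconnected hz h
    refine hne (funext fun τ => ?_)
    simpa using this τ.im_pos
  · exact h

lemma dense_ne_zero (hne : f ≠ 0) : Dense {τ : ℍ | f τ ≠ 0} := by
  intro τ
  rw [mem_closure_iff_frequently]
  intro h
  have h1 := eventually_ne_zero_of_ne_zero hol hne τ.im_pos
  have h2 : ∀ᶠ w : ℂ in nhds (τ : ℂ), ¬ f (ofComplex w) ≠ 0 := by
    rw [← isOpenEmbedding_coe.map_nhds_eq, Filter.eventually_map]
    simpa using h
  obtain ⟨w, hw, hw'⟩ := (h1.and (h2.filter_mono nhdsWithin_le_nhds)).exists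
  exact hw' hw

lemma finite_zeros_of_isCompact (hne : f ≠ 0) {K : Set ℍ} (hK : IsCompact K) :
    {τ ∈ K | f τ = 0}.Finite := by
  by_contra h
  have hK' : IsCompact ((↑) '' K : Set ℂ) := hK.image UpperHalfPlane.continuous_coe
  have hinf : ((↑) '' {τ ∈ K | f τ = 0} : Set ℂ).Infinite :=
    Set.Infinite.image (UpperHalfPlane.coe_injective.injOn) h
  obtain ⟨z, ⟨τ, _, rfl⟩, hz⟩ := hinf.exists_accPt_of_subset_isCompact hK'
    (Set.image_mono fun τ hτ => hτ.1)
  rw [accPt_iff_frequently_nhdsNE] at hz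
  refine hz ?_
  filter_upwards [eventually_ne_zero_of_ne_zero hol hne τ.im_pos] with w hw
  rintro ⟨σ, ⟨_, hσ⟩, rfl⟩
  rw [ofComplex_apply] at hw
  exact hw hσ

end holomorphic

/-- The zeros of a nonzero modular form lie in finitely many `SL(2, ℤ)`-orbits. -/
lemma exists_finite_zeros {N : ℕ} [NeZero N] {k : ℤ} (l : ModularForm (Gamma1 N) k)
    (hl : l ≠ 0) : ∃ S : Set ℍ, S.Finite ∧ ∀ τ, l τ = 0 → ∃ γ : SL(2, ℤ), γ • τ ∈ S := by
  obtain ⟨Y, c, C, hY, hc, hC, hlow⟩ := exists_uniform_lower_bound l hl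
  have hfin := finite_range_slash (modularForm_slash_eq l)
  refine ⟨⋃ F ∈ Set.range fun γ : SL(2, ℤ) => ⇑l ∣[k] γ,
    {τ ∈ ModularGroup.truncatedFundamentalDomain Y | F τ = 0}, ?_, fun τ hτ => ?_⟩
  · refine hfin.biUnion ?_
    rintro _ ⟨γ, rfl⟩
    refine finite_zeros_of_isCompact (MDifferentiable.slash l.holo' k _) (fun h0 => hl ?_)
      (ModularGroup.isCompact_truncatedFundamentalDomain Y)
    have : ⇑l = (⇑l ∣[k] γ) ∣[k] γ⁻¹ := by rw [← SlashAction.slash_mul]; simp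
    have h0' : ⇑l ∣[k] γ = 0 := h0
    rw [h0', SlashAction.zero_slash] at this
    exact DFunLike.coe_injective this
  · obtain ⟨γ, hγ⟩ := ModularGroup.exists_smul_mem_fd τ
    have h0 : (⇑l ∣[k] γ⁻¹) (γ • τ) = 0 := by
      rw [ModularForm.SL_slash_apply, inv_smul_smul, hτ, zero_mul]
    refine ⟨γ, Set.mem_biUnion ⟨γ⁻¹, rfl⟩ ⟨⟨hγ, ?_⟩, h0⟩⟩
    by_contra hlt
    have := hlow γ⁻¹ (γ • τ) (not_le.mp hlt).le
    rw [h0, norm_zero] at this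
    exact absurd this (not_le.mpr (by positivity))

/-- `f` has a removable singularity at `z`. -/
def Reg (f : ℂ → ℂ) (z : ℂ) : Prop :=
  ∃ φ : ℂ → ℂ, AnalyticAt ℂ φ z ∧ f =ᶠ[nhdsWithin z {z}ᶜ] φ

lemma tendsto_affine_nhdsNE {a : ℂ} (ha : a ≠ 0) (b z : ℂ) :
    Filter.Tendsto (fun w => a * w + b) (nhdsWithin z {z}ᶜ)
      (nhdsWithin (a * z + b) {a * z + b}ᶜ) := by
  refine tendsto_nhdsWithin_iff.mpr ⟨Filter.Tendsto.mono_left ?_ nhdsWithin_le_nhds, ?_⟩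
  · exact Continuous.tendsto (by fun_prop) z
  · filter_upwards [self_mem_nhdsWithin] with w hw
    simpa [ha] using hw

namespace Reg

variable {f g : ℂ → ℂ} {z : ℂ}

lemma congr (hf : Reg f z) (h : g =ᶠ[nhdsWithin z {z}ᶜ] f) : Reg g z :=
  let ⟨φ, hφ, hfφ⟩ := hf
  ⟨φ, hφ, h.trans hfφ⟩

lemma sub (hf : Reg f z) (hg : Reg g z) : Reg (fun w => f w - g w) z :=
  let ⟨φ, hφ, hfφ⟩ := hf
  let ⟨ψ, hψ, hgψ⟩ := hg
  ⟨fun w => φ w - ψ w, hφ.sub hψ, hfφ.sub hgψ⟩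

lemma const_mul (a : ℂ) (hf : Reg f z) : Reg (fun w => a * f w) z :=
  let ⟨φ, hφ, hfφ⟩ := hf
  ⟨fun w => a * φ w, analyticAt_const.mul hφ, hfφ.fun_comp (a * ·)⟩

lemma sum {ι : Type*} (s : Finset ι) {f : ι → ℂ → ℂ} (h : ∀ i ∈ s, Reg (f i) z) :
    Reg (fun w => ∑ i ∈ s, f i w) z := by
  choose! φ hφ hfφ using h
  refine ⟨fun w => ∑ i ∈ s, φ i w, s.analyticAt_fun_sum hφ, ?_⟩
  filter_upwards [(Finset.eventually_all s).mpr hfφ] with w hw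
  exact Finset.sum_congr rfl hw

lemma comp_affine {a : ℂ} (ha : a ≠ 0) {b : ℂ} (hf : Reg f (a * z + b)) :
    Reg (fun w => f (a * w + b)) z := by
  obtain ⟨φ, hφ, hfφ⟩ := hf
  refine ⟨fun w => φ (a * w + b), ?_, (tendsto_affine_nhdsNE ha b z).eventually hfφ⟩
  exact AnalyticAt.fun_comp (f := fun w => a * w + b) hφ (by fun_prop)

lemma of_comp_affine {a : ℂ} (ha : a ≠ 0) {b : ℂ} (hf : Reg (fun w => f (a * w + b)) z) :
    Reg f (a * z + b) := by
  have h : a⁻¹ * (a * z + b) + (-(a⁻¹ * b)) = z := by field_simp; ring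
  rw [← h] at hf
  refine (hf.comp_affine (inv_ne_zero ha)).congr (Filter.Eventually.of_forall fun w => ?_)
  have : a * (a⁻¹ * w + -(a⁻¹ * b)) + b = w := by field_simp; simp
  simp only [this]

end Reg

lemma reg_of_hecke {ℓ : ℕ} [NeZero ℓ] [Fact ℓ.Prime] {c : ℂ} (hc : c ≠ 0) {f : ℕ → ℂ → ℂ}
    (hper : ∀ m w, f m (w + 1) = f m w)
    (hH : ∀ m (τ : ℍ), f (m + 1) =ᶠ[nhdsWithin (τ : ℂ) {(τ : ℂ)}ᶜ] fun w =>
      (ℓ : ℂ)⁻¹ * ∑ b ∈ Finset.range ℓ, f m ((w + b) / ℓ) + c * f m (ℓ * w))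
    {S : Set ℍ} (hS : S.Finite)
    (hfin : ∀ τ : ℍ, (¬ ∀ m, Reg (f m) τ) → ∃ γ : SL(2, ℤ), γ • τ ∈ S) (τ : ℍ) (m : ℕ) :
    Reg (f m) τ := by
  have hℓ : (ℓ : ℂ) ≠ 0 := Nat.cast_ne_zero.mpr (NeZero.ne ℓ)
  have hdn : ∀ (m b : ℕ) (w : ℍ), Reg (f m) (dn ℓ b w) ↔
      Reg (fun z => f m ((z + b) / ℓ)) w := fun m b w => by
    have e : ∀ z : ℂ, (z + b) / ℓ = (ℓ : ℂ)⁻¹ * z + b / ℓ := fun z => by field_simp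
    rw [coe_dn]
    simp only [e]
    exact ⟨fun h => h.comp_affine (inv_ne_zero hℓ), fun h => h.of_comp_affine (inv_ne_zero hℓ)⟩
  have hup : ∀ (m : ℕ) (w : ℍ), Reg (f m) (up ℓ w) ↔ Reg (fun z => f m (ℓ * z)) w :=
    fun m w => by
    rw [coe_up]
    refine ⟨fun h => ?_, fun h => ?_⟩
    · simpa using Reg.comp_affine (b := 0) hℓ (by simpa using h)
    · simpa using Reg.of_comp_affine (f := f m) (b := 0) (z := w) hℓ (by simpa using h)
  refine forall_of_hecke_propagation (ℓ := ℓ) (R := fun τ => ∀ m, Reg (f m) τ) ?_ ?_ ?_ hS hfin τ m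
  · intro τ h m
    have e : (up ℓ (dn ℓ 1 τ) : ℂ) = 1 * (τ : ℂ) + 1 := by
      rw [coe_up, coe_dn]; field_simp; simp
    have := h m
    rw [e] at this
    refine (this.comp_affine one_ne_zero).congr (Filter.Eventually.of_forall fun w => ?_)
    simp [hper]
  · intro w hw hb m
    rw [hup]
    have h1 := ((hw (m + 1)).sub ((Reg.sum (Finset.range ℓ) fun b hbm =>
      (hdn m b w).mp (hb b (Finset.mem_range.mp hbm) m)).const_mul (ℓ : ℂ)⁻¹)).const_mul c⁻¹
    refine h1.congr ?_
    filter_upwards [hH m w] with z hz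
    rw [hz]
    field_simp
    ring
  · intro w hw hu hb m
    rw [hdn]
    have h1 := (((hw (m + 1)).sub (((hup m w).mp (hu m)).const_mul c)).const_mul (ℓ : ℂ)).sub
      (Reg.sum ((Finset.range ℓ).erase 0) fun b hbm => (hdn m b w).mp (hb b
        (Finset.mem_range.mp (Finset.mem_of_mem_erase hbm))
        (Nat.one_le_iff_ne_zero.mpr (Finset.ne_of_mem_erase hbm)) m))
    refine h1.congr ?_
    filter_upwards [hH m w] with z hz
    rw [hz, ← Finset.add_sum_erase _ _ (Finset.mem_range.mpr (NeZero.pos ℓ))]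
    field_simp
    ring

lemma exists_extension {f : ℂ → ℂ} (h : ∀ τ : ℍ, Reg f τ) : ∃ F : ℍ → ℂ,
    MDifferentiable (modelWithCornersSelf ℂ ℂ) (modelWithCornersSelf ℂ ℂ) F ∧
    ∀ τ : ℍ, F ∘ ofComplex =ᶠ[nhdsWithin (τ : ℂ) {(τ : ℂ)}ᶜ] f := by
  set F : ℍ → ℂ := fun τ => Filter.limUnder (nhdsWithin (τ : ℂ) {(τ : ℂ)}ᶜ) f with hF
  have hval : ∀ (τ : ℍ) (φ : ℂ → ℂ), ContinuousAt φ τ →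
      f =ᶠ[nhdsWithin (τ : ℂ) {(τ : ℂ)}ᶜ] φ → F τ = φ τ := fun τ φ hφ he =>
    Filter.Tendsto.limUnder_eq ((hφ.tendsto.mono_left nhdsWithin_le_nhds).congr' he.symm)
  have key : ∀ (τ : ℍ) (φ : ℂ → ℂ), AnalyticAt ℂ φ τ →
      f =ᶠ[nhdsWithin (τ : ℂ) {(τ : ℂ)}ᶜ] φ → F ∘ ofComplex =ᶠ[nhds (τ : ℂ)] φ := by
    intro τ φ hφ he
    rw [Filter.EventuallyEq, eventually_nhdsWithin_iff] at he
    filter_upwards [he.eventually_nhds, hφ.eventually_analyticAt,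
      isOpen_upperHalfPlaneSet.mem_nhds τ.im_pos] with w hw hφw hwim
    obtain ⟨σ, rfl⟩ : ∃ σ : ℍ, (σ : ℂ) = w := ⟨⟨w, hwim⟩, rfl⟩
    simp only [comp_apply, ofComplex_apply]
    refine hval σ φ hφw.continuousAt ?_
    by_cases hστ : (σ : ℂ) = τ
    · rw [Filter.EventuallyEq, eventually_nhdsWithin_iff, hστ]
      rwa [hστ] at hw
    · have : ∀ᶠ x : ℂ in nhds (σ : ℂ), x ≠ (τ : ℂ) := isOpen_ne.mem_nhds hστ
      exact (hw.and this).filter_mono nhdsWithin_le_nhds |>.mono fun x hx => hx.1 hx.2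
  refine ⟨F, UpperHalfPlane.mdifferentiable_iff.mpr fun z hz => ?_, fun τ => ?_⟩
  · obtain ⟨φ, hφ, he⟩ := h ⟨z, hz⟩
    exact (hφ.congr (key ⟨z, hz⟩ φ hφ he).symm).differentiableAt.differentiableWithinAt
  · obtain ⟨φ, hφ, he⟩ := h τ
    exact ((key τ φ hφ he).filter_mono nhdsWithin_le_nhds).trans he.symm

lemma eventuallyEq_zero_of_meromorphicOn {E : ℂ → ℂ} (hE : MeromorphicOn E upperHalfPlaneSet)
    {Y : ℝ} (h : ∀ τ : ℍ, Y < τ.im → E τ = 0) (τ : ℍ) :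
    E =ᶠ[nhdsWithin (τ : ℂ) {(τ : ℂ)}ᶜ] 0 := by
  have hY : (0 : ℝ) < max Y 0 + 1 := by positivity
  set σ : ℍ := ⟨(max Y 0 + 1 : ℝ) * Complex.I, by simpa using hY⟩
  have hσim : Y < (σ : ℂ).im := by
    have : (σ : ℂ).im = max Y 0 + 1 := by simp [σ]
    linarith [le_max_left Y 0]
  have hσ : meromorphicOrderAt E σ = ⊤ := by
    rw [meromorphicOrderAt_eq_top_iff]
    have h1 : ∀ᶠ z : ℂ in nhds (σ : ℂ), Y < z.im :=
      (isOpen_lt continuous_const Complex.continuous_im).mem_nhds hσim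
    have h2 : ∀ᶠ z : ℂ in nhds (σ : ℂ), 0 < z.im := isOpen_upperHalfPlaneSet.mem_nhds σ.im_pos
    filter_upwards [(h1.and h2).filter_mono nhdsWithin_le_nhds] with z hz
    exact h ⟨z, hz.2⟩ hz.1
  rw [Filter.EventuallyEq]
  simp only [Pi.zero_apply]
  rw [← meromorphicOrderAt_eq_top_iff]
  by_contra hne
  exact hE.meromorphicOrderAt_ne_top_of_isPreconnected
    (convex_halfSpace_im_gt 0).isPreconnected τ.im_pos σ.im_pos hne hσ

lemma exists_holomorphic_quotients {N ℓ : ℕ} [NeZero N] [NeZero ℓ] [Fact ℓ.Prime] {c : ℂ}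
    (hc : c ≠ 0) (l : ModularForm (Gamma1 N) 1) (hl : l ≠ 0) (s : ℕ → LaurentSeries ℂ)
    (hs : ∀ m, IsHeckeT ℓ c (s m) (s (m + 1))) (g : ℕ → CuspForm (Gamma1 N) 2)
    (hg : ∀ m, s m * qExpansionL l = qExpansionL (g m)) :
    ∃ F : ℕ → ℍ → ℂ,
      (∀ m, MDifferentiable (modelWithCornersSelf ℂ ℂ) (modelWithCornersSelf ℂ ℂ) (F m)) ∧
      (∀ m, ⇑(g m) = F m * ⇑l) ∧ ∀ m, heckeFun ℓ c (F m) = F (m + 1) := by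
  have hℓ : (ℓ : ℂ) ≠ 0 := Nat.cast_ne_zero.mpr (NeZero.ne ℓ)
  have hl0 : (⇑l : ℍ → ℂ) ≠ 0 := fun h => hl (DFunLike.coe_injective h)
  have hlne (τ : ℍ) := eventually_ne_zero_of_ne_zero l.holo' hl0 τ.im_pos
  set f : ℕ → ℂ → ℂ := fun m w => g m (ofComplex w) / l (ofComplex w) with hf
  have hfmer (m : ℕ) (τ : ℍ) : MeromorphicAt (f m) τ :=
    (analyticAt_comp_ofComplex (g m).holo' τ.im_pos).meromorphicAt.div
      (analyticAt_comp_ofComplex l.holo' τ.im_pos).meromorphicAt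
  have htdn (b : ℕ) (τ : ℍ) : Filter.Tendsto (fun w : ℂ => (w + b) / ℓ)
      (nhdsWithin (τ : ℂ) {(τ : ℂ)}ᶜ) (nhdsWithin (dn ℓ b τ : ℂ) {(dn ℓ b τ : ℂ)}ᶜ) := by
    have e : ∀ z : ℂ, (z + b) / ℓ = (ℓ : ℂ)⁻¹ * z + b / ℓ := fun z => by field_simp
    rw [coe_dn]
    simp only [e]
    exact tendsto_affine_nhdsNE (inv_ne_zero hℓ) _ _
  have htup (τ : ℍ) : Filter.Tendsto (fun w : ℂ => ℓ * w)
      (nhdsWithin (τ : ℂ) {(τ : ℂ)}ᶜ) (nhdsWithin (up ℓ τ : ℂ) {(up ℓ τ : ℂ)}ᶜ) := by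
    rw [coe_up]
    simpa using tendsto_affine_nhdsNE hℓ 0 τ
  have hH (m : ℕ) (τ : ℍ) : f (m + 1) =ᶠ[nhdsWithin (τ : ℂ) {(τ : ℂ)}ᶜ] fun w =>
      (ℓ : ℂ)⁻¹ * ∑ b ∈ Finset.range ℓ, f m ((w + b) / ℓ) + c * f m (ℓ * w) := by
    obtain ⟨Y, hY, -, hYs⟩ := hasLExp_quotient l hl (g m) (s m) (hg m)
    obtain ⟨Y', hY', -, hYs'⟩ := hasLExp_quotient l hl (g (m + 1)) (s (m + 1)) (hg (m + 1))
    have hE : MeromorphicOn (fun w => f (m + 1) w - ((ℓ : ℂ)⁻¹ * ∑ b ∈ Finset.range ℓ,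
        f m ((w + b) / ℓ) + c * f m (ℓ * w))) upperHalfPlaneSet := by
      intro z hz
      have h1 := hfmer (m + 1) ⟨z, hz⟩
      have h2 (b : ℕ) : MeromorphicAt (fun w => f m ((w + b) / ℓ)) z :=
        (hfmer m (dn ℓ b ⟨z, hz⟩)).comp_analyticAt (g := fun w : ℂ => (w + b) / ℓ) (by fun_prop)
      have h3 : MeromorphicAt (fun w => f m (ℓ * w)) z :=
        (hfmer m (up ℓ ⟨z, hz⟩)).comp_analyticAt (g := fun w : ℂ => ℓ * w) (by fun_prop)
      exact h1.sub (((MeromorphicAt.const _ _).mul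
        (MeromorphicAt.fun_sum fun b _ => h2 b)).add ((MeromorphicAt.const _ _).mul h3))
    have := eventuallyEq_zero_of_meromorphicOn hE (Y := max (ℓ * Y) Y') (fun σ hσ => ?_) τ
    · filter_upwards [this] with w hw using sub_eq_zero.mp hw
    · have h1 := hYs.heckeFun hY (hs m) σ ((le_max_left _ _).trans_lt hσ)
      have h2 := hYs' σ ((le_max_right _ _).trans_lt hσ)
      have h3 := h2.unique h1
      simp only [heckeFun] at h3
      simp only [hf, ← coe_dn, ← coe_up, ofComplex_apply, h3, sub_self]
  have hreg (m : ℕ) (τ : ℍ) : Reg (f m) τ := by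
    obtain ⟨S, hS, hSz⟩ := exists_finite_zeros l hl
    refine reg_of_hecke hc (fun m w => ?_) hH hS (fun τ hτ => hSz τ ?_) τ m
    · have h1 := SlashInvariantFormClass.periodic_comp_ofComplex (g m) (one_mem_strictPeriods N) w
      have h2 := SlashInvariantFormClass.periodic_comp_ofComplex l (one_mem_strictPeriods N) w
      simp only [comp_apply, Complex.ofReal_one] at h1 h2
      simp only [hf, h1, h2]
    · by_contra h
      refine hτ fun m => ⟨f m, ?_, Filter.EventuallyEq.rfl⟩
      exact (analyticAt_comp_ofComplex (g m).holo' τ.im_pos).div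
        (analyticAt_comp_ofComplex l.holo' τ.im_pos) (by simpa using h)
  choose F hFhol hFf using fun m => exists_extension (hreg m)
  have hFc (m : ℕ) (τ : ℍ) : ContinuousAt (F m ∘ ofComplex) τ :=
    (analyticAt_comp_ofComplex (hFhol m) τ.im_pos).continuousAt
  refine ⟨F, hFhol, fun m => funext fun τ => ?_, fun m => funext fun τ => ?_⟩
  · have h1 := (analyticAt_comp_ofComplex (g m).holo' τ.im_pos).continuousAt
    have h2 := (hFc m τ).mul (analyticAt_comp_ofComplex l.holo' τ.im_pos).continuousAt
    have h3 := (h1.eventuallyEq_nhds_iff_eventuallyEq_nhdsNE h2).mp ?_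
    · simpa using h3.eq_of_nhds
    · filter_upwards [hFf m τ, hlne τ] with w hw hw'
      simp only [Pi.mul_apply, hw, comp_apply, hf]
      exact (div_mul_cancel₀ _ hw').symm
  · have h1 : ContinuousAt (fun w : ℂ => (ℓ : ℂ)⁻¹ * ∑ b ∈ Finset.range ℓ,
        (F m ∘ ofComplex) ((w + b) / ℓ) + c * (F m ∘ ofComplex) (ℓ * w)) τ := by
      refine (continuousAt_const.mul (tendsto_finsetSum _ fun b _ => ?_)).add
        (continuousAt_const.mul ?_)
      · exact ContinuousAt.comp (f := fun w : ℂ => (w + b) / ℓ) (hFc m (dn ℓ b τ))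
          (by fun_prop)
      · exact ContinuousAt.comp (f := fun w : ℂ => ℓ * w) (hFc m (up ℓ τ)) (by fun_prop)
    have h3 := (h1.eventuallyEq_nhds_iff_eventuallyEq_nhdsNE (hFc (m + 1) τ)).mp ?_
    · have := h3.eq_of_nhds
      simpa only [heckeFun, comp_apply, ← coe_dn, ← coe_up, ofComplex_apply] using this
    · filter_upwards [hFf (m + 1) τ, hH m τ, (htup τ).eventually (hFf m (up ℓ τ)),
        (Finset.eventually_all (Finset.range ℓ)).mpr
          fun b _ => (htdn b τ).eventually (hFf m (dn ℓ b τ))] with w h1 h2 h3 h4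
      rw [h1, h2, h3, Finset.sum_congr rfl h4]

lemma HasNeben.of_mul {N : ℕ} {j k : ℤ} {χ ψ : DirichletCharacter ℂ N} {F l : ℍ → ℂ}
    (hF : MDifferentiable (modelWithCornersSelf ℂ ℂ) (modelWithCornersSelf ℂ ℂ) F)
    (hl : MDifferentiable (modelWithCornersSelf ℂ ℂ) (modelWithCornersSelf ℂ ℂ) l) (hl0 : l ≠ 0)
    (hln : HasNeben k ψ l) (hFl : HasNeben (j + k) (χ * ψ) (F * l)) : HasNeben j χ F := by
  intro γ hγ
  have h1 := hFl γ hγ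
  rw [ModularForm.mul_slash_SL2, hln γ hγ] at h1
  have hu := ((isUnit_of_mem_Gamma0 hγ).map ψ).ne_zero
  refine Continuous.ext_on (dense_ne_zero hl hl0) (MDifferentiable.slash hF j _).continuous
    (hF.continuous.const_smul _) fun τ hτ => ?_
  have h2 := congrFun h1 τ
  simp only [Pi.mul_apply, Pi.smul_apply, smul_eq_mul, MulChar.mul_apply] at h2 ⊢
  refine mul_right_cancel₀ (mul_ne_zero hu hτ) ?_
  linear_combination h2

/-- A periodic holomorphic function growing slower than `|q|⁻¹` is bounded at `i∞`. -/
lemma isBoundedAtImInfty_of_exp_growth {f : ℍ → ℂ} {h : ℝ} (hh : 0 < h)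
    (hper : Periodic (f ∘ ofComplex) h)
    (hol : MDifferentiable (modelWithCornersSelf ℂ ℂ) (modelWithCornersSelf ℂ ℂ) f)
    {Y C : ℝ} (hf : ∀ τ : ℍ, Y ≤ τ.im → ‖f τ‖ ≤ C * Real.exp (Real.pi / h * τ.im)) :
    IsBoundedAtImInfty f := by
  set g : ℍ → ℂ := fun τ => Periodic.qParam h τ * f τ with hg
  have hnorm (τ : ℍ) : ‖Periodic.qParam h τ‖ = Real.exp (-2 * Real.pi * τ.im / h) := by
    rw [Periodic.norm_qParam, coe_im]
  have hgper : Periodic (g ∘ ofComplex) h := by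
    intro z
    by_cases hz : 0 < z.im
    · have hz' : 0 < (z + h).im := by simpa using hz
      have h1 := hper z
      simp only [comp_apply, hg] at h1 ⊢
      rw [h1, ofComplex_apply_of_im_pos hz, ofComplex_apply_of_im_pos hz']
      refine congrArg (· * _) ?_
      have hh0 : (h : ℂ) ≠ 0 := Complex.ofReal_ne_zero.mpr hh.ne'
      change Complex.exp (2 * Real.pi * Complex.I * (z + h) / h) = Complex.exp _
      rw [mul_add, add_div, mul_div_cancel_right₀ _ hh0, Complex.exp_periodic]
    · have hz' : ¬ 0 < (z + h).im := by simpa using hz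
      simp only [comp_apply]
      rw [ofComplex_apply_eq_of_im_nonpos (not_lt.mp hz') (not_lt.mp hz)]
  have hghol : MDifferentiable (modelWithCornersSelf ℂ ℂ) (modelWithCornersSelf ℂ ℂ) g := by
    refine UpperHalfPlane.mdifferentiable_iff.mpr fun z hz => ?_
    have h1 : DifferentiableAt ℂ (fun w => Periodic.qParam h w * (f ∘ ofComplex) w) z :=
      (Periodic.differentiable_qParam z).mul (analyticAt_comp_ofComplex hol hz).differentiableAt
    refine (h1.congr_of_eventuallyEq ?_).differentiableWithinAt
    filter_upwards [isOpen_upperHalfPlaneSet.mem_nhds hz] with w hw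
    simp only [comp_apply, hg]
    rw [ofComplex_apply_of_im_pos hw]
  have hgzero : IsZeroAtImInfty g := by
    have hlim : Filter.Tendsto (fun τ : ℍ => C * Real.exp (-(Real.pi / h * τ.im)))
        atImInfty (nhds 0) := by
      rw [← mul_zero C]
      refine Filter.Tendsto.const_mul C (Real.tendsto_exp_neg_atTop_nhds_zero.comp ?_)
      exact Filter.Tendsto.const_mul_atTop (by positivity) Filter.tendsto_comap
    refine squeeze_zero_norm' ?_ hlim
    filter_upwards [(atImInfty_mem _).mpr ⟨Y, fun τ hτ => hτ⟩] with τ hτ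
    rw [hg, norm_mul, hnorm]
    refine (mul_le_mul_of_nonneg_left (hf τ hτ) (Real.exp_nonneg _)).trans (le_of_eq ?_)
    rw [mul_left_comm, ← Real.exp_add]
    congr 2
    ring
  have hdecay := hgzero.exp_decay_atImInfty hh hgper hghol hgzero.isBoundedAtImInfty
  obtain ⟨M, hM⟩ := Asymptotics.isBigO_iff.mp hdecay
  obtain ⟨A, hA⟩ := (atImInfty_mem _).mp hM
  refine isBoundedAtImInfty_iff.mpr ⟨M, A, fun τ hτ => ?_⟩
  have h1 := hA τ hτ
  simp only [Set.mem_ofPred_eq, hg, norm_mul] at h1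
  rw [hnorm, Real.norm_of_nonneg (Real.exp_nonneg _), mul_comm] at h1
  exact le_of_mul_le_mul_right h1 (Real.exp_pos _)

/-- The invariant size of a weight-one form. -/
def size (f : ℍ → ℂ) (τ : ℍ) : ℝ := ‖f τ‖ * √τ.im

lemma size_nonneg (f : ℍ → ℂ) (τ : ℍ) : 0 ≤ size f τ :=
  mul_nonneg (norm_nonneg _) (Real.sqrt_nonneg _)

lemma size_slash (f : ℍ → ℂ) (γ : SL(2, ℤ)) (τ : ℍ) :
    size (f ∣[(1 : ℤ)] γ) τ = size f (γ • τ) := by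
  rw [size, size, ModularForm.SL_slash_apply, ModularGroup.im_smul_eq_div_normSq,
    Real.sqrt_div τ.im_pos.le, Complex.normSq_eq_norm_sq, Real.sqrt_sq (norm_nonneg _), norm_mul,
    norm_zpow, zpow_neg_one]
  ring

lemma exists_SL_im_smul_eq {p n : ℤ} (h : IsCoprime p n) : ∃ γ : SL(2, ℤ), ∀ τ : ℍ,
    (γ • τ).im = τ.im / Complex.normSq (p * τ + n) := by
  obtain ⟨γ, hp, hn⟩ := h.exists_SL2_row 1
  refine ⟨γ, fun τ => ?_⟩
  rw [ModularGroup.im_smul_eq_div_normSq, ModularGroup.denom_apply, hp, hn]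

lemma isCoprime_row (γ : SL(2, ℤ)) : IsCoprime (γ 1 0) (γ 1 1) := by
  have h := γ.det_coe
  rw [Matrix.det_fin_two] at h
  exact ⟨-γ 0 1, γ 0 0, by linear_combination h⟩

/-- Every `τ` has a translate `τ + b` whose images under the maps defining `T_ℓ` are lower in the
cusp near which `τ` lies. -/
lemma exists_lower_translate {ℓ : ℕ} [NeZero ℓ] (hℓ : ℓ.Prime) (γ : SL(2, ℤ)) (τ : ℍ) :
    ∃ b : ℕ, (∃ δ : SL(2, ℤ), (δ • dn ℓ b τ).im = (γ • τ).im / ℓ) ∧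
      ∀ b' : ℕ, ∃ δ : SL(2, ℤ), (δ • dn ℓ b' (dn ℓ b τ)).im = (γ • τ).im / ℓ ^ 2 := by
  have hℓ0 : (ℓ : ℂ) ≠ 0 := Nat.cast_ne_zero.mpr (NeZero.ne ℓ)
  have hp : Prime (ℓ : ℤ) := Nat.prime_iff_prime_int.mp hℓ
  set p := γ 1 0 with hpdef
  set n := γ 1 1 with hndef
  have hpn : IsCoprime p n := isCoprime_row γ
  obtain ⟨b, hb⟩ : ∃ b : ℕ, ¬ (ℓ : ℤ) ∣ n - b * p := by
    by_cases hn : (ℓ : ℤ) ∣ n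
    · refine ⟨1, fun h => hp.not_isUnit (hpn.isUnit_of_dvd' ?_ hn)⟩
      have := dvd_sub hn h
      simpa using this
    · exact ⟨0, by simpa using hn⟩
  have hcop (x : ℤ) (hx : IsCoprime p x) (hx' : ¬ (ℓ : ℤ) ∣ x) : IsCoprime (ℓ * p) x :=
    IsCoprime.mul_left (hp.coprime_iff_not_dvd.mpr hx') hx
  have hpb : IsCoprime p (n - b * p) := by
    have := hpn.add_mul_left_right (-(b : ℤ))
    rwa [show n + p * -(b : ℤ) = n - b * p by ring] at this
  have hγ : (γ • τ).im = τ.im / Complex.normSq (p * τ + n) := by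
    rw [ModularGroup.im_smul_eq_div_normSq, ModularGroup.denom_apply]
  refine ⟨b, ?_, fun b' => ?_⟩
  · obtain ⟨δ, hδ⟩ := exists_SL_im_smul_eq (hcop _ hpb hb)
    refine ⟨δ, ?_⟩
    rw [hδ, hγ, im_dn, coe_dn, div_right_comm]
    congr 3
    push_cast
    field_simp
    ring
  · have h1 : IsCoprime (ℓ * p) (n - b * p - b' * (ℓ * p)) := by
      have := (hcop _ hpb hb).add_mul_left_right (-(b' : ℤ))
      rwa [show n - b * p + ℓ * p * -(b' : ℤ) = n - b * p - b' * (ℓ * p) by ring] at this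
    have h2 : ¬ (ℓ : ℤ) ∣ n - b * p - b' * (ℓ * p) := fun h => hb <| by
      have := dvd_add h (Dvd.intro (b' * p) rfl : (ℓ : ℤ) ∣ ℓ * (b' * p))
      rwa [show n - b * p - b' * (ℓ * p) + ℓ * (b' * p) = n - b * p by ring] at this
    have h3 : IsCoprime (ℓ * (ℓ * p)) (n - b * p - b' * (ℓ * p)) :=
      IsCoprime.mul_left (hp.coprime_iff_not_dvd.mpr h2) h1
    obtain ⟨δ, hδ⟩ := exists_SL_im_smul_eq h3
    refine ⟨δ, ?_⟩
    rw [hδ, hγ, im_dn, im_dn, coe_dn, coe_dn, div_div τ.im, ← pow_two, div_right_comm]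
    congr 3
    push_cast
    field_simp
    ring

lemma size_le_of_hecke {ℓ : ℕ} [NeZero ℓ] {c : ℂ} (hc : ‖c‖ = 1) {f f' : ℍ → ℂ}
    (hper : Periodic (f ∘ ofComplex) (1 : ℂ)) (hf : heckeFun ℓ c f = f') (b : ℕ) (τ : ℍ) :
    size f τ ≤ ℓ * size f' (dn ℓ b τ) +
      ∑ b' ∈ Finset.range ℓ, size f (dn ℓ b' (dn ℓ b τ)) := by
  have hℓ : (0 : ℝ) < ℓ := Nat.cast_pos.mpr (NeZero.pos ℓ)
  have hℓ1 : (1 : ℝ) ≤ ℓ := Nat.one_le_cast.mpr (NeZero.pos ℓ)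
  have hℓ0 : (ℓ : ℂ) ≠ 0 := Nat.cast_ne_zero.mpr (NeZero.ne ℓ)
  have hup : f (up ℓ (dn ℓ b τ)) = f τ := by
    have h1 := (hper.nat_mul b) τ
    have h2 : ((τ : ℂ) + b * 1) = (up ℓ (dn ℓ b τ) : ℂ) := by
      rw [coe_up, coe_dn]; field_simp
    rw [h2] at h1
    simpa only [comp_apply, ofComplex_apply] using h1
  have h1 : c * f τ = f' (dn ℓ b τ) -
      (ℓ : ℂ)⁻¹ * ∑ b' ∈ Finset.range ℓ, f (dn ℓ b' (dn ℓ b τ)) := by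
    rw [← hf, heckeFun, hup]
    ring
  have h2 : ‖f τ‖ ≤ ‖f' (dn ℓ b τ)‖ +
      (ℓ : ℝ)⁻¹ * ∑ b' ∈ Finset.range ℓ, ‖f (dn ℓ b' (dn ℓ b τ))‖ := by
    have : ‖f τ‖ = ‖c * f τ‖ := by rw [norm_mul, hc, one_mul]
    rw [this, h1]
    refine (norm_sub_le _ _).trans ?_
    rw [norm_mul, norm_inv, Complex.norm_natCast]
    gcongr
    exact norm_sum_le _ _
  have hs1 : √τ.im ≤ ℓ * √(dn ℓ b τ).im := by
    rw [im_dn, Real.sqrt_div τ.im_pos.le, mul_div_assoc', le_div_iff₀ (Real.sqrt_pos.mpr hℓ),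
      mul_comm]
    gcongr
    exact Real.sqrt_le_self_iff.mpr (Or.inr hℓ1)
  have hs2 (b' : ℕ) : √τ.im = ℓ * √(dn ℓ b' (dn ℓ b τ)).im := by
    rw [im_dn, im_dn, div_div, Real.sqrt_div τ.im_pos.le, Real.sqrt_mul_self hℓ.le]
    field_simp
  calc size f τ ≤ (‖f' (dn ℓ b τ)‖ +
      (ℓ : ℝ)⁻¹ * ∑ b' ∈ Finset.range ℓ, ‖f (dn ℓ b' (dn ℓ b τ))‖) * √τ.im := by
        rw [size]; gcongr
    _ = ‖f' (dn ℓ b τ)‖ * √τ.im +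
      ∑ b' ∈ Finset.range ℓ, (ℓ : ℝ)⁻¹ * ‖f (dn ℓ b' (dn ℓ b τ))‖ * √τ.im := by
        rw [add_mul, Finset.mul_sum, Finset.sum_mul]
    _ ≤ _ := by
        refine add_le_add ?_ (Finset.sum_le_sum fun b' _ => le_of_eq ?_)
        · rw [size, mul_left_comm]
          gcongr
        · rw [hs2 b', size]
          field_simp

/-- `f` grows at most like `e^{κ h}` at height `h` above the cusps. -/
def CuspGrowth (Y κ : ℝ) (f : ℍ → ℂ) : Prop :=
  ∃ C : ℝ, 0 ≤ C ∧ ∀ (γ : SL(2, ℤ)) (τ : ℍ), Y ≤ (γ • τ).im →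
    size f τ ≤ C * Real.exp (κ * (γ • τ).im)

lemma CuspGrowth.mono {Y κ κ' : ℝ} (hY : 0 ≤ Y) (hκ : κ ≤ κ') {f : ℍ → ℂ}
    (h : CuspGrowth Y κ f) : CuspGrowth Y κ' f := by
  obtain ⟨C, hC, h⟩ := h
  refine ⟨C, hC, fun γ τ hτ => (h γ τ hτ).trans ?_⟩
  have := hY.trans hτ
  gcongr

lemma CuspGrowth.div_of_hecke {ℓ : ℕ} [NeZero ℓ] (hℓ : ℓ.Prime) {c : ℂ} (hc : ‖c‖ = 1)
    {f f' : ℍ → ℂ} (hper : Periodic (f ∘ ofComplex) (1 : ℂ)) (hf : heckeFun ℓ c f = f')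
    {Y κ : ℝ} (hY : 0 < Y) (hκ : 0 ≤ κ) (h : CuspGrowth Y κ f) (h' : CuspGrowth Y κ f') :
    CuspGrowth Y (κ / ℓ) f := by
  have hℓ1 : (1 : ℝ) ≤ ℓ := Nat.one_le_cast.mpr (NeZero.pos ℓ)
  have hℓ0 : (0 : ℝ) < ℓ := zero_lt_one.trans_le hℓ1
  obtain ⟨C, hC, h⟩ := h
  obtain ⟨C', hC', h'⟩ := h'
  refine ⟨max (C * Real.exp (κ * (ℓ ^ 2 * Y))) (ℓ * C' + ℓ * C), by positivity,
    fun γ τ hτ => ?_⟩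
  set H := (γ • τ).im with hH
  have hH0 : 0 < H := hY.trans_le hτ
  rcases lt_or_ge H (ℓ ^ 2 * Y) with hlt | hge
  · calc size f τ ≤ C * Real.exp (κ * H) := h γ τ hτ
      _ ≤ C * Real.exp (κ * (ℓ ^ 2 * Y)) * 1 := by rw [mul_one]; gcongr
      _ ≤ _ := by
        gcongr
        · exact le_max_left _ _
        · exact Real.one_le_exp (by positivity)
  · obtain ⟨b, ⟨δ, hδ⟩, hδ'⟩ := exists_lower_translate hℓ γ τ
    have hle : H / ℓ ^ 2 ≤ H / ℓ := by
      gcongr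
      exact le_self_pow₀ hℓ1 two_ne_zero
    have hge' : Y ≤ H / ℓ ^ 2 := by rw [le_div_iff₀ (by positivity), mul_comm]; exact hge
    have h1 : size f' (dn ℓ b τ) ≤ C' * Real.exp (κ / ℓ * H) := by
      have := h' δ (dn ℓ b τ) (by rw [hδ]; exact hge'.trans hle)
      rw [hδ] at this
      rwa [div_mul_eq_mul_div, mul_div_assoc]
    have h2 (b' : ℕ) : size f (dn ℓ b' (dn ℓ b τ)) ≤ C * Real.exp (κ / ℓ * H) := by
      obtain ⟨δ', hδ'⟩ := hδ' b'
      refine (h δ' _ (by rw [hδ']; exact hge')).trans ?_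
      rw [hδ', div_mul_eq_mul_div, mul_div_assoc]
      gcongr
    calc size f τ ≤ ℓ * (C' * Real.exp (κ / ℓ * H)) +
        ∑ b' ∈ Finset.range ℓ, C * Real.exp (κ / ℓ * H) := by
          refine (size_le_of_hecke hc hper hf b τ).trans ?_
          gcongr with b' _
          exact h2 b'
      _ = (ℓ * C' + ℓ * C) * Real.exp (κ / ℓ * H) := by
          rw [Finset.sum_const, Finset.card_range, nsmul_eq_mul]; ring
      _ ≤ _ := by
          gcongr
          exact le_max_right _ _

lemma cuspGrowth_quotient {N : ℕ} (l : ModularForm (Gamma1 N) 1) (g : CuspForm (Gamma1 N) 2)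
    [NeZero N] {F : ℍ → ℂ} (hF : ⇑g = F * ⇑l) {Y κ C : ℝ} (hY : 0 < Y) (hC : 0 < C)
    (hlow : ∀ γ : SL(2, ℤ), ∀ τ : ℍ, Y ≤ τ.im →
      C * Real.exp (-κ * τ.im) ≤ ‖(⇑l ∣[(1 : ℤ)] γ) τ‖) : CuspGrowth Y κ F := by
  obtain ⟨B, hB⟩ := CuspFormClass.exists_bound g
  have hB' (τ : ℍ) : size F τ * size l τ ≤ B := by
    have h1 := hB τ
    rw [hF] at h1
    rw [show ((2 : ℤ) : ℝ) / 2 = 1 by norm_num, Real.rpow_one, le_div_iff₀ τ.im_pos,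
      Pi.mul_apply, norm_mul] at h1
    refine le_trans (le_of_eq ?_) h1
    rw [size, size, mul_mul_mul_comm, Real.mul_self_sqrt τ.im_pos.le]
  have hsY : 0 < √Y := Real.sqrt_pos.mpr hY
  refine ⟨max B 0 / (C * √Y), by positivity, fun γ τ hτ => ?_⟩
  set H := (γ • τ).im with hH
  have h1 : C * Real.exp (-κ * H) * √Y ≤ size l τ := by
    have h2 : size l τ = size (⇑l ∣[(1 : ℤ)] γ⁻¹) (γ • τ) := by
      rw [size_slash, inv_smul_smul]
    rw [h2, size]
    gcongr
    exact hlow γ⁻¹ (γ • τ) hτ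
  have h2 : size F τ * (C * Real.exp (-κ * H) * √Y) ≤ max B 0 :=
    (mul_le_mul_of_nonneg_left h1 (size_nonneg F τ)).trans ((hB' τ).trans (le_max_left _ _))
  rw [div_mul_eq_mul_div, le_div_iff₀ (by positivity)]
  have h3 : Real.exp (-κ * H) * Real.exp (κ * H) = 1 := by
    rw [← Real.exp_add]; simp
  calc size F τ * (C * √Y) = size F τ * (C * Real.exp (-κ * H) * √Y) * Real.exp (κ * H) := by
        linear_combination (-size F τ * C * √Y) * h3
    _ ≤ _ := by gcongr

lemma cuspGrowth_of_hecke {ℓ : ℕ} [NeZero ℓ] (hℓ : ℓ.Prime) {c : ℂ} (hc : ‖c‖ = 1)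
    {F : ℕ → ℍ → ℂ} (hper : ∀ m, Periodic (F m ∘ ofComplex) (1 : ℂ))
    (hF : ∀ m, heckeFun ℓ c (F m) = F (m + 1)) {Y κ : ℝ} (hY : 0 < Y) (hκ : 0 ≤ κ)
    (h : ∀ m, CuspGrowth Y κ (F m)) {ε : ℝ} (hε : 0 < ε) (m : ℕ) : CuspGrowth Y ε (F m) := by
  have key (n : ℕ) : ∀ m, CuspGrowth Y (κ / ℓ ^ n) (F m) := by
    induction n with
    | zero => simpa using h
    | succ n ih =>
      intro m
      rw [pow_succ, ← div_div]
      exact (ih m).div_of_hecke hℓ hc (hper m) (hF m) hY (by positivity) (ih (m + 1))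
  have hℓ1 : (1 : ℝ) < ℓ := Nat.one_lt_cast.mpr hℓ.one_lt
  obtain ⟨n, hn⟩ := pow_unbounded_of_one_lt (κ / ε) hℓ1
  refine (key n m).mono hY.le ?_
  rw [div_lt_iff₀ hε] at hn
  rw [div_le_iff₀ (by positivity), mul_comm]
  exact hn.le

lemma isBoundedAtImInfty_slash_of_cuspGrowth {N : ℕ} [NeZero N] {F : ℍ → ℂ}
    (hol : MDifferentiable (modelWithCornersSelf ℂ ℂ) (modelWithCornersSelf ℂ ℂ) F)
    (hF : ∀ γ ∈ Gamma1 N, F ∣[(1 : ℤ)] γ = F) {Y : ℝ} (hY : 0 < Y)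
    (h : ∀ ε : ℝ, 0 < ε → CuspGrowth Y ε F) (γ : SL(2, ℤ)) :
    IsBoundedAtImInfty (F ∣[(1 : ℤ)] γ) := by
  have hN : (0 : ℝ) < N := Nat.cast_pos.mpr (NeZero.pos N)
  obtain ⟨C, hC, h⟩ := h (Real.pi / N) (by positivity)
  have hsY : 0 < √Y := Real.sqrt_pos.mpr hY
  refine isBoundedAtImInfty_of_exp_growth hN (mod_cast periodic_slash hF γ)
    (MDifferentiable.slash hol 1 _) (Y := Y) (C := C / √Y) fun τ hτ => ?_
  have h1 := h γ⁻¹ (γ • τ) (by rwa [inv_smul_smul])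
  rw [inv_smul_smul, ← size_slash, size] at h1
  rw [div_mul_eq_mul_div, le_div_iff₀ hsY]
  exact (by gcongr : _ ≤ _ * √τ.im).trans h1

/-- A holomorphic function of weight one and nebentypus `χ` with subexponential growth at the cusps
is a modular form. -/
lemma exists_modularForm {N : ℕ} [NeZero N] {χ : DirichletCharacter ℂ N} {F : ℍ → ℂ}
    (hol : MDifferentiable (modelWithCornersSelf ℂ ℂ) (modelWithCornersSelf ℂ ℂ) F)
    (hF : HasNeben 1 χ F)
    (hbdd : ∀ γ : SL(2, ℤ), IsBoundedAtImInfty (F ∣[(1 : ℤ)] γ)) :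
    ∃ f : ModularForm (Gamma1 N) 1, ⇑f = F := by
  refine ⟨⟨⟨F, fun γ hγ => hF.slash_eq_of_mem_Gamma1 γ hγ⟩, hol, fun {c} hc => ?_⟩, rfl⟩
  rw [Subgroup.IsArithmetic.isCusp_iff_isCusp_SL2Z] at hc
  exact (OnePoint.isBoundedAt_iff_forall_SL2Z hc).mpr fun γ _ => hbdd γ

lemma exists_modularForm_of_mem_VLamEll {N ℓ : ℕ} [NeZero N] [NeZero ℓ] (hℓ : ℓ.Prime)
    (hℓN : ¬ ℓ ∣ N) {χ : DirichletCharacter ℂ N} (Λ : Finset (ModularForm (Gamma1 N) 1))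
    (hΛne : Λ.Nonempty) (hΛ : ∀ l ∈ Λ, l ≠ 0 ∧ HasNeben 1 χ⁻¹ ⇑l) (h : LaurentSeries ℂ)
    (hh : h ∈ VLamEll N χ ℓ Λ) :
    ∃ F : ModularForm (Gamma1 N) 1, HasNeben 1 χ ⇑F ∧ h = qExpansionL ⇑F := by
  have : Fact ℓ.Prime := ⟨hℓ⟩
  have hunit : IsUnit (ℓ : ZMod N) :=
    (ZMod.isUnit_iff_coprime ℓ N).mpr ((Nat.Prime.coprime_iff_not_dvd hℓ).mpr hℓN)
  have hc : ‖χ (ℓ : ZMod N)‖ = 1 := by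
    obtain ⟨u, hu⟩ := hunit
    rw [← hu]
    exact χ.unit_norm_eq_one u
  have hc0 : χ (ℓ : ZMod N) ≠ 0 := fun h0 => by simp [h0] at hc
  obtain ⟨l, hl⟩ := hΛne
  obtain ⟨hl0, hln⟩ := hΛ l hl
  choose T hT using exists_isHeckeT (ℓ := ℓ) (χ (ℓ : ZMod N))
  set s : ℕ → LaurentSeries ℂ := fun m => T^[m] h with hs
  have hsT (m : ℕ) : IsHeckeT ℓ (χ (ℓ : ZMod N)) (s m) (s (m + 1)) := by
    simp only [hs, iterate_succ_apply']
    exact hT _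
  have hsV (m : ℕ) : s m ∈ VLam N Λ := by
    rcases Nat.eq_zero_or_pos m with rfl | hm
    · exact hh.1
    · exact hh.2 s rfl hsT m hm
  choose g hgn hg using fun m => hsV m l hl
  obtain ⟨F, hFhol, hFg, hFT⟩ := exists_holomorphic_quotients hc0 l hl0 s hsT g hg
  have hl0' : (⇑l : ℍ → ℂ) ≠ 0 := fun h => hl0 (DFunLike.coe_injective h)
  have hFn (m : ℕ) : HasNeben 1 χ (F m) := by
    refine HasNeben.of_mul (hFhol m) l.holo' hl0' hln ?_
    rw [mul_inv_cancel]
    have := hgn m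
    rwa [hFg m] at this
  have hFinv (m : ℕ) : ∀ γ ∈ Gamma1 N, F m ∣[(1 : ℤ)] γ = F m := fun γ hγ =>
    (hFn m).slash_eq_of_mem_Gamma1 _ ⟨γ, hγ, rfl⟩
  obtain ⟨Y, κ, C, hY, hκ, hC, hlow⟩ := exists_uniform_lower_bound l hl0
  have hper (m : ℕ) : Periodic (F m ∘ ofComplex) (1 : ℂ) := by
    have := SlashInvariantFormClass.periodic_comp_ofComplex (k := 1)
      (⟨F m, fun γ hγ => (hFn m).slash_eq_of_mem_Gamma1 γ hγ⟩ : SlashInvariantForm (Gamma1 N) 1)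
      (one_mem_strictPeriods N)
    exact_mod_cast this
  have hgrow (m : ℕ) : CuspGrowth Y κ (F m) := cuspGrowth_quotient l (g m) (hFg m) hY hC hlow
  obtain ⟨f, hf⟩ := exists_modularForm (hFhol 0) (hFn 0) <|
    isBoundedAtImInfty_slash_of_cuspGrowth (hFhol 0) (hFinv 0) hY fun ε hε =>
      cuspGrowth_of_hecke hℓ hc hper hFT hY hκ hgrow hε 0
  refine ⟨f, hf ▸ hFn 0, ?_⟩
  obtain ⟨Y', -, hlne, hexp⟩ := hasLExp_quotient l hl0 (g 0) h (hg 0)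
  refine HasLExp.unique (Y := Y') (Y' := max Y' 0) (f := f) (fun τ hτ => ?_)
    ((hasLExp_modularForm f).mono (le_max_right _ _))
  have h1 := hexp τ hτ
  rw [hFg 0] at h1
  simp only [Pi.mul_apply] at h1
  rwa [mul_div_cancel_right₀ _ (hlne τ hτ), ← hf] at h1

/-- The Hecke stability method in characteristic zero: for `N ≥ 1`, an odd Dirichlet character
`χ` mod `N`, a prime `ℓ ∤ N`, and a finite nonempty set `Λ` of nonzero modular forms of weight
`1`, level `N` and nebentypus `χ⁻¹`, one has
`qexp(S_1(N,χ)) ⊆ V'_{Λ,ℓ} ⊆ qexp(M_1(N,χ))`. -/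
theorem hecke_stability_method_char_zero (N : ℕ) (hN : 1 ≤ N)
    (χ : DirichletCharacter ℂ N) (hodd : χ (-1) = -1)
    (ℓ : ℕ) (hℓ : ℓ.Prime) (hℓN : ¬ ℓ ∣ N)
    (Λ : Finset (ModularForm (Gamma1 N) 1)) (hΛne : Λ.Nonempty)
    (hΛ : ∀ l ∈ Λ, l ≠ 0 ∧ HasNeben 1 χ⁻¹ ⇑l) :
    (∀ f : CuspForm (Gamma1 N) 1, HasNeben 1 χ ⇑f →
        qExpansionL ⇑f ∈ VLamEll N χ ℓ Λ) ∧
    (∀ h ∈ VLamEll N χ ℓ Λ, ∃ F : ModularForm (Gamma1 N) 1,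
        HasNeben 1 χ ⇑F ∧ h = qExpansionL ⇑F) := by
  have : NeZero N := ⟨by omega⟩
  have : NeZero ℓ := ⟨hℓ.ne_zero⟩
  exact ⟨fun f hf => qExpansionL_mem_VLamEll hℓ hℓN Λ (fun l hl => (hΛ l hl).2) f hf,
    fun h hh => exists_modularForm_of_mem_VLamEll hℓ hℓN Λ hΛne hΛ h hh⟩

end
end

section
/- Let F be a field, let ℓ ≥ 2 be an integer, and let c ∈ F be nonzero. If V is a finite-dimensional F-subspace of F((q)) with U(V) ⊆ V, then every element of V is a formal power series; that is, every nonzero f ∈ V satisfies ord(f) ≥ 0. Equivalently, any U-stable subspace of F((q)) containing an element of negative order is infinite-dimensional. (This is the abstract form, on q-expansions, of the statement that a finite-dimensional Hecke-stable space of modular ratios has no poles at the cusps.) -/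
/-- The graph of the `F`-linear operator `U` on formal Laurent series given by
`U(∑ₙ aₙ qⁿ) = ∑ₙ a_{ℓn} qⁿ + c • ∑ₙ aₙ q^{ℓn}`: `IsHeckeU ℓ c f g` says that `g = U f`,
expressed coefficientwise. -/
def IsHeckeU {F : Type*} [Field F] (ℓ : ℕ) (c : F)
    (f g : LaurentSeries F) : Prop :=
  ∀ n : ℤ, g.coeff n =
    f.coeff (ℓ * n) + c * (if (ℓ : ℤ) ∣ n then f.coeff (n / ℓ) else 0)

/-- The elements of a finite-dimensional space of Laurent series have uniformly bounded poles. -/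
theorem exists_coeff_eq_zero_of_finiteDimensional {F : Type*} [Field F]
    (V : Submodule F (LaurentSeries F)) [FiniteDimensional F V] :
    ∃ N : ℤ, ∀ f ∈ V, ∀ n < N, f.coeff n = 0 := by
  obtain ⟨S, rfl⟩ : V.FG := Submodule.fg_iff_finiteDimensional V |>.mpr inferInstance
  obtain ⟨N, hN⟩ := (S.finite_toSet.image HahnSeries.order).bddBelow
  refine ⟨N, fun f hf n hn => ?_⟩
  induction hf using Submodule.span_induction with
  | mem x hx =>
    exact HahnSeries.coeff_eq_zero_of_lt_order (hn.trans_le (hN (Set.mem_image_of_mem _ hx)))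
  | zero => simp
  | add x y _ _ hx hy => simp [hx, hy]
  | smul a x _ hx => simp [hx]

/-- If `V` is a finite-dimensional subspace of `F((q))` that is stable under `U`
(i.e. for each `f ∈ V`, the series `U f` again lies in `V`), then every element of `V` is a
formal power series: every nonzero `f ∈ V` has `ord f ≥ 0`. -/
theorem order_nonneg_of_heckeU_stable {F : Type*} [Field F] (ℓ : ℕ) (hℓ : 2 ≤ ℓ)
    (c : F) (hc : c ≠ 0) (V : Submodule F (LaurentSeries F)) (hV : FiniteDimensional F V)
    (hstab : ∀ f ∈ V, ∃ g ∈ V, IsHeckeU ℓ c f g) :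
    ∀ f ∈ V, f ≠ 0 → 0 ≤ f.order := by
  intro f hf hf0
  by_contra! hneg
  obtain ⟨N, hN⟩ := exists_coeff_eq_zero_of_finiteDimensional V
  obtain ⟨m, ⟨hm, x, hx, hxm⟩, hmin⟩ :=
    Int.exists_least_of_bdd (P := fun n => n < 0 ∧ ∃ x ∈ V, x.coeff n ≠ 0)
      ⟨N, fun n ⟨_, x, hx, hxn⟩ => not_lt.mp fun h => hxn (hN x hx n h)⟩
      ⟨f.order, hneg, f, hf, HahnSeries.coeff_order_eq_zero.not.mpr hf0⟩
  have hzero : ∀ y ∈ V, ∀ n < m, y.coeff n = 0 := fun y hy n hn => by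
    by_contra h
    exact hn.not_ge (hmin n ⟨hn.trans hm, y, hy, h⟩)
  obtain ⟨g, hg, hU⟩ := hstab x hx
  have hℓ' : (2 : ℤ) ≤ ℓ := by exact_mod_cast hℓ
  have hlt : (ℓ : ℤ) * m < m := by nlinarith
  have hlt' : (ℓ : ℤ) * (ℓ * m) < m := by nlinarith
  have h := hU (ℓ * m)
  rw [hzero g hg _ hlt, hzero x hx _ hlt', if_pos (dvd_mul_right _ _),
    Int.mul_ediv_cancel_left _ (by omega), zero_add] at h
  exact mul_ne_zero hc hxm h.symm
end

section
/- Let G and G' be directed multigraphs, let P be a polar condition on G, and let δ : G → G' be a homomorphism of directed multigraphs (a map of vertices together with a map of arcs preserving origins and destinations) that is surjective on vertices and satisfies: (i) for every vertex v of G, δ restricts to a bijection from the set of arcs of G with origin v onto the set of arcs of G' with origin δ(v); and (ii) for all vertices v', w' of G' with deg_{G'}(v',w') ≥ 1 and every vertex w of G with δ(w) = w', there exists a vertex v of G with δ(v) = v' and deg_G(v,w) ≥ 1. Then the image δ(P) is a polar condition on G'. -/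
/-- `polarDeg src tgt v P` is the number of arcs with origin `v` whose destination lies in `P`,
in the directed multigraph with arc set `E`, origin map `src` and destination map `tgt`
(this is `deg(v, P) = ∑_{w ∈ P} deg(v, w)`). -/
noncomputable def polarDeg {V E : Type*} (src tgt : E → V) (v : V) (P : Set V) : ℕ :=
  {e : E | src e = v ∧ tgt e ∈ P}.ncard

/-- `IsPolarCondition src tgt P` says that `P` is a polar condition on the directed multigraph
with origin map `src` and destination map `tgt`: whenever `deg(v, P) = 1`, one has `v ∈ P`. -/
def IsPolarCondition {V E : Type*} (src tgt : E → V) (P : Set V) : Prop :=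
  ∀ v : V, polarDeg src tgt v P = 1 → v ∈ P

/-- Pushforward of polar conditions along a suitable surjective homomorphism of directed
multigraphs.  `G` has vertex set `V` and arcs `E` with origin/destination maps `src`, `tgt`;
`G'` has vertex set `V'` and arcs `E'` with maps `src'`, `tgt'`; every vertex of either graph
has finitely many outgoing arcs.  The homomorphism `δ` is given by a vertex map `δV`, surjective
on vertices, and an arc map `δE` preserving origins and destinations, such that
(i) for every vertex `v`, `δE` restricts to a bijection from the arcs of `G` with origin `v`
onto the arcs of `G'` with origin `δV v`, and (ii) adjacency lifts along fibers of `δ`. Then the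
image of any polar condition `P` on `G` is a polar condition on `G'`. -/
theorem isPolarCondition_image {V E V' E' : Type*}
    (src tgt : E → V) (src' tgt' : E' → V')
    (hfin : ∀ v : V, {e : E | src e = v}.Finite)
    (hfin' : ∀ v' : V', {e' : E' | src' e' = v'}.Finite)
    (δV : V → V') (δE : E → E')
    (hsrc : ∀ e : E, src' (δE e) = δV (src e))
    (htgt : ∀ e : E, tgt' (δE e) = δV (tgt e))
    (hsurj : Function.Surjective δV)
    (hbij : ∀ v : V, Set.BijOn δE {e : E | src e = v} {e' : E' | src' e' = δV v})
    (hlift : ∀ v' w' : V', (∃ e' : E', src' e' = v' ∧ tgt' e' = w') →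
      ∀ w : V, δV w = w' → ∃ v : V, δV v = v' ∧ ∃ e : E, src e = v ∧ tgt e = w)
    (P : Set V) (hP : IsPolarCondition src tgt P) :
    IsPolarCondition src' tgt' (δV '' P) := by
  intro v' hv'
  obtain ⟨a, ha⟩ := Set.ncard_eq_one.mp hv'
  have ha_mem : a ∈ {e' : E' | src' e' = v' ∧ tgt' e' ∈ δV '' P} := ha ▸ Set.mem_singleton a
  obtain ⟨hav, w, hwP, hw⟩ := ha_mem
  obtain ⟨v, rfl, e, he, hew⟩ := hlift v' (tgt' a) ⟨a, hav, rfl⟩ w hw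
  have map_eq : ∀ f : E, src f = v → tgt f ∈ P → δE f = a := fun f hf hfP =>
    ha.subset ⟨(hsrc f).trans (congrArg δV hf), tgt f, hfP, (htgt f).symm⟩
  refine ⟨v, hP v (Set.ncard_eq_one.mpr ⟨e, ?_⟩), rfl⟩
  have heP : tgt e ∈ P := hew ▸ hwP
  ext f
  constructor
  · rintro ⟨hf, hfP⟩
    exact (hbij v).injOn hf he ((map_eq f hf hfP).trans (map_eq e he heP).symm)
  · rintro rfl
    exact ⟨he, heP⟩
end

section
/- Let n ≥ 2 and i > −n be integers, let T = T(n,i) be the rooted infinite tree with root v₀ of degree n+i and all other degrees n, and let r ≥ 0. For every quasipolar subset Q of the truncated tree T^r, there exists a set P of vertices of T satisfying the polar property such that the intersection of P with the vertex set of T^r equals Q. -/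
/-- A set `P` of vertices of a simple graph `G` satisfies the polar property if every vertex
having exactly one neighbor in `P` belongs to `P`. -/
def SatisfiesPolarProperty {V : Type*} (G : SimpleGraph V) (P : Set V) : Prop :=
  ∀ v : V, (∃! w : V, G.Adj v w ∧ w ∈ P) → v ∈ P

/-- `IsQuasipolar G v₀ r Q`: `Q` is a quasipolar subset of the truncated tree `T^r`, the subgraph
of `G` induced on the vertices at distance at most `r` from `v₀`: `Q` is a nonempty set of
vertices of `T^r` such that every vertex `v` of `T^r` having exactly one neighbor in `Q` within
`T^r` either lies in `Q` or is at distance exactly `r` from `v₀`. -/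
def IsQuasipolar {V : Type*} (G : SimpleGraph V) (v₀ : V) (r : ℕ) (Q : Set V) : Prop :=
  Q.Nonempty ∧ Q ⊆ {v | G.dist v₀ v ≤ r} ∧
    ∀ v : V, G.dist v₀ v ≤ r →
      (∃! w : V, G.Adj v w ∧ G.dist v₀ w ≤ r ∧ w ∈ Q) → (v ∈ Q ∨ G.dist v₀ v = r)

/-- In an acyclic graph, a vertex has at most one neighbor closer than itself to a given vertex
`u` reachable from it. -/
theorem SimpleGraph.IsAcyclic.eq_of_adj_of_dist_eq_add_one {V : Type*} {G : SimpleGraph V}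
    (hA : G.IsAcyclic) {u v w w' : V} (hu : G.Reachable v u)
    (hw : G.Adj v w) (hw' : G.Adj v w') (hd : G.dist u v = G.dist u w + 1)
    (hd' : G.dist u v = G.dist u w' + 1) : w = w' := by
  obtain ⟨p, hp⟩ := (hw.symm.reachable.trans hu).exists_walk_length_eq_dist
  obtain ⟨q, hq⟩ := (hw'.symm.reachable.trans hu).exists_walk_length_eq_dist
  have hP : (Walk.cons hw p).IsPath := Walk.isPath_of_length_eq_dist _ <| by
    rw [Walk.length_cons, hp, dist_comm, ← hd, dist_comm]
  have hQ : (Walk.cons hw' q).IsPath := Walk.isPath_of_length_eq_dist _ <| by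
    rw [Walk.length_cons, hq, dist_comm, ← hd', dist_comm]
  have h := congrArg (fun x : G.Path v u ↦ x.1.snd)
    ((hA.subsingleton_path v u).elim ⟨_, hP⟩ ⟨_, hQ⟩)
  simpa using h

/-- In a tree with root `u`, there is a function sending every vertex other than `u` to its
parent. -/
theorem SimpleGraph.IsTree.exists_parent {V : Type*} {G : SimpleGraph V} (hT : G.IsTree)
    (u : V) : ∃ par : V → V, ∀ v w, G.Adj v w → G.dist u w = G.dist u v + 1 → par w = v := by
  classical
  refine ⟨fun w ↦ if h : ∃ v, G.Adj w v ∧ G.dist u w = G.dist u v + 1 then h.choose else w,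
    fun v w hvw hd ↦ ?_⟩
  have h : ∃ v, G.Adj w v ∧ G.dist u w = G.dist u v + 1 := ⟨v, hvw.symm, hd⟩
  simp only [dif_pos h]
  exact hT.isAcyclic.eq_of_adj_of_dist_eq_add_one (hT.connected w u) h.choose_spec.1 hvw.symm
    h.choose_spec.2 hd

/-- In a tree with root `u`, there is a function fixing the vertices at distance `r` from `u` and
sending every vertex farther from `u` to its ancestor at distance `r`. -/
theorem SimpleGraph.IsTree.exists_ancestor {V : Type*} {G : SimpleGraph V} (hT : G.IsTree)
    (u : V) (r : ℕ) : ∃ anc : V → V, (∀ v, G.dist u v = r → anc v = v) ∧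
      ∀ v w, G.Adj v w → G.dist u w = G.dist u v + 1 → r ≤ G.dist u v → anc w = anc v := by
  obtain ⟨par, hpar⟩ := hT.exists_parent u
  refine ⟨fun v ↦ par^[G.dist u v - r] v, fun v hv ↦ by simp [hv], fun v w hvw hd hr ↦ ?_⟩
  have : G.dist u w - r = (G.dist u v - r) + 1 := by omega
  simp only [this, Function.iterate_succ_apply, hpar v w hvw hd]

/-- Let `T = T(n,i)` be the infinite tree rooted at `v₀` in which the root has degree `n + i`
and every other vertex has degree `n` (`n ≥ 2`, `i > -n`).  Every quasipolar subset `Q` of the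
truncated tree `T^r` is the intersection with `T^r` of some set of vertices of `T` satisfying
the polar property. -/
theorem exists_polar_extension_of_quasipolar {V : Type*} (G : SimpleGraph V) (v₀ : V)
    (n i : ℤ) (hn : 2 ≤ n) (hi : -n < i)
    (hG : G.Connected) (hA : G.IsAcyclic) (hinf : Infinite V)
    (hdeg₀ : ((G.neighborSet v₀).ncard : ℤ) = n + i)
    (hdeg : ∀ v : V, v ≠ v₀ → ((G.neighborSet v).ncard : ℤ) = n)
    (r : ℕ) (Q : Set V) (hQ : IsQuasipolar G v₀ r Q) :
    ∃ P : Set V, SatisfiesPolarProperty G P ∧ P ∩ {v | G.dist v₀ v ≤ r} = Q := by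
  have hT : G.IsTree := ⟨hG, hA⟩
  obtain ⟨⟨q, hq⟩, hQr, hpol⟩ := hQ
  obtain ⟨anc, hanc, hstep⟩ := hT.exists_ancestor v₀ r
  -- Beyond level `r`, include exactly the descendants of the level `r` vertices that lie in `Q`
  -- or have a neighbor in `Q`.
  let S : V → Prop := fun a ↦ a ∈ Q ∨ ∃ b ∈ Q, G.Adj a b
  refine ⟨{x | x ∈ Q ∨ r < G.dist v₀ x ∧ S (anc x)}, ?_, ?_⟩
  · rintro v ⟨w, ⟨hvw, hw⟩, huniq⟩
    by_contra hv
    simp only [Set.mem_ofPred_eq, not_or, not_and] at hv hw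
    obtain ⟨hvQ, hvS⟩ := hv
    have hdist := hT.dist_eq_dist_add_one_of_adj v₀ hvw
    rcases lt_trichotomy (G.dist v₀ v) r with hlt | heq | hgt
    · refine (hpol v hlt.le ⟨w, ⟨hvw, by omega, ?_⟩, ?_⟩).elim hvQ hlt.ne
      · exact hw.resolve_right fun h ↦ by omega
      · rintro y ⟨hy, -, hyQ⟩
        exact huniq y ⟨hy, Or.inl hyQ⟩
    · by_cases hb : ∃ b ∈ Q, G.Adj v b
      · obtain ⟨b, hbQ, hvb⟩ := hb
        have hbr : G.dist v₀ b ≤ r := hQr hbQ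
        have hne : v ≠ v₀ := by
          rintro rfl
          have hqr : G.dist v q ≤ r := hQr hq
          rw [SimpleGraph.dist_self] at heq
          have : v = q := hG.dist_eq_zero_iff.mp (by omega)
          exact hvQ (this ▸ hq)
        have hcard : 1 < (G.neighborSet v).ncard := by
          have := hdeg v hne
          omega
        obtain ⟨c, hvc, hcb⟩ := Set.exists_ne_of_one_lt_ncard hcard b
        have hvc : G.Adj v c := hvc
        have hdb := hT.dist_eq_dist_add_one_of_adj v₀ hvb
        rcases hT.dist_eq_dist_add_one_of_adj v₀ hvc with hdc | hdc
        · exact hcb (hA.eq_of_adj_of_dist_eq_add_one (hG v v₀) hvc hvb hdc (by omega))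
        · have hc : anc c = v := (hstep v c hvc hdc heq.ge).trans (hanc v heq)
          refine hcb ((huniq c ⟨hvc, Or.inr ⟨by omega, ?_⟩⟩).trans
            (huniq b ⟨hvb, Or.inl hbQ⟩).symm)
          rw [hc]
          exact Or.inr ⟨b, hbQ, hvb⟩
      · rcases hw with hw | ⟨hr, hw⟩
        · exact hb ⟨w, hw, hvw⟩
        · rw [hstep v w hvw (by omega) heq.ge, hanc v heq] at hw
          exact hw.elim hvQ hb
    · rcases hdist with hd | hd
      · have hvw' := hstep w v hvw.symm hd (by omega)
        rcases hw with hw | ⟨-, hw⟩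
        · have hwr : G.dist v₀ w ≤ r := hQr hw
          rw [hanc w (by omega)] at hvw'
          exact hvS hgt (hvw' ▸ Or.inl hw)
        · exact hvS hgt (hvw' ▸ hw)
      · rcases hw with hw | ⟨-, hw⟩
        · have hwr : G.dist v₀ w ≤ r := hQr hw
          omega
        · exact hvS hgt (hstep v w hvw hd hgt.le ▸ hw)
  · ext x
    simp only [Set.mem_inter_iff, Set.mem_ofPred_eq]
    exact ⟨fun ⟨h, hx⟩ ↦ h.resolve_right fun h' ↦ absurd h'.1 hx.not_gt,
      fun h ↦ ⟨Or.inl h, hQr h⟩⟩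
end

section
/- Let n ≥ 2 and i > −n be integers, let T = T(n,i) be the rooted infinite tree with root v₀ of degree n+i and all other degrees n, and let r ≥ 0. Then the minimum cardinality of a quasipolar subset of the truncated tree T^r that contains the root v₀ equals 1 + (n+i) · Σ_{j=0}^{⌊r/2⌋−1} (n−1)^j (the sum being empty, hence 0, when ⌊r/2⌋ = 0). -/
/-- `par` sends each vertex other than the root `v₀` to its unique neighbor closer to `v₀`, and
every edge of `G` joins a vertex to its parent. -/
structure IsParentMap {V : Type*} (G : SimpleGraph V) (v₀ : V) (par : V → V) : Prop where
  dist_parent : ∀ v, v ≠ v₀ → G.dist v₀ (par v) + 1 = G.dist v₀ v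
  adj_iff : ∀ v w, G.Adj v w ↔ (v ≠ v₀ ∧ par v = w) ∨ (w ≠ v₀ ∧ par w = v)

/-- The children of a vertex. -/
def childSet {V : Type*} (v₀ : V) (par : V → V) (v : V) : Set V := {c | c ≠ v₀ ∧ par c = v}

/-- The descendants of a vertex, itself included. -/
def descSet {V : Type*} (G : SimpleGraph V) (v₀ : V) (par : V → V) (v : V) : Set V :=
  {w | ∃ k, par^[k] w = v ∧ G.dist v₀ w = G.dist v₀ v + k}

/-- The `k`-th layer of the set obtained from the root by passing repeatedly from a vertex to the
chosen children `ch c` of all its children `c`. -/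
def evenLayer {V : Type*} (v₀ : V) (par ch : V → V) : ℕ → Set V
  | 0 => {v₀}
  | k + 1 => ⋃ v ∈ evenLayer v₀ par ch k, ch '' childSet v₀ par v

theorem SimpleGraph.IsAcyclic.eq_of_adj_of_dist_add_one {V : Type*} {G : SimpleGraph V}
    (hA : G.IsAcyclic) (hG : G.Connected) {v₀ u w v : V} (hu : G.Adj u v) (hw : G.Adj w v)
    (du : G.dist v₀ u + 1 = G.dist v₀ v) (dw : G.dist v₀ w + 1 = G.dist v₀ v) : u = w := by
  obtain ⟨p, hp⟩ := hG.exists_walk_length_eq_dist v₀ u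
  obtain ⟨q, hq⟩ := hG.exists_walk_length_eq_dist v₀ w
  have hp' : (p.concat hu).IsPath := (p.concat hu).isPath_of_length_eq_dist (by simp; lia)
  have hq' : (q.concat hw).IsPath := (q.concat hw).isPath_of_length_eq_dist (by simp; lia)
  have h := congrArg Subtype.val ((hA.subsingleton_path v₀ v).elim ⟨_, hp'⟩ ⟨_, hq'⟩)
  simpa using congrArg SimpleGraph.Walk.penultimate h

theorem SimpleGraph.IsTree.exists_isParentMap {V : Type*} {G : SimpleGraph V} (hT : G.IsTree)
    (v₀ : V) : ∃ par, IsParentMap G v₀ par := by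
  have key : ∀ v, ∃ u, v ≠ v₀ → G.Adj u v ∧ G.dist v₀ u + 1 = G.dist v₀ v := by
    intro v
    by_cases hv : v = v₀
    · exact ⟨v, fun h => absurd hv h⟩
    obtain ⟨p, hp⟩ := hT.connected.exists_walk_length_eq_dist v₀ v
    have hn : ¬ p.Nil := SimpleGraph.Walk.not_nil_of_ne (Ne.symm hv)
    have hadj := p.adj_penultimate hn
    refine ⟨p.penultimate, fun _ => ⟨hadj, ?_⟩⟩
    have h1 := SimpleGraph.dist_le p.dropLast
    have h2 := hT.dist_eq_dist_add_one_of_adj v₀ hadj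
    have h3 : p.dropLast.length + 1 = p.length := by
      have := SimpleGraph.Walk.not_nil_iff_lt_length.1 hn
      simp
      lia
    lia
  choose par hpar using key
  refine ⟨par, fun v hv => (hpar v hv).2, fun v w => ⟨fun h => ?_, ?_⟩⟩
  · rcases hT.dist_eq_dist_add_one_of_adj v₀ h with h' | h'
    · have hv : v ≠ v₀ := by rintro rfl; simp at h'
      exact .inl ⟨hv, hT.isAcyclic.eq_of_adj_of_dist_add_one hT.connected (hpar v hv).1 h.symm
        (hpar v hv).2 h'.symm⟩
    · have hw : w ≠ v₀ := by rintro rfl; simp at h'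
      exact .inr ⟨hw, hT.isAcyclic.eq_of_adj_of_dist_add_one hT.connected (hpar w hw).1 h
        (hpar w hw).2 h'.symm⟩
  · rintro (⟨hv, rfl⟩ | ⟨hw, rfl⟩)
    · exact (hpar v hv).1.symm
    · exact (hpar w hw).1

theorem Set.ncard_mul_le_ncard_of_pairwiseDisjoint {α β : Type*} {C : Set α} (hC : C.Finite)
    {D : α → Set β} {S : Set β} (hS : S.Finite) (hD : ∀ c ∈ C, D c ⊆ S)
    (hdisj : C.PairwiseDisjoint D) {g : ℕ} (hg : ∀ c ∈ C, g ≤ (D c).ncard) :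
    C.ncard * g ≤ S.ncard := by
  have hDf : ∀ c ∈ C, (D c).Finite := fun c hc => hS.subset (hD c hc)
  calc C.ncard * g = ∑ _c ∈ hC.toFinset, g := by
        simp [Set.ncard_eq_toFinset_card C hC]
    _ ≤ ∑ c ∈ hC.toFinset, (D c).ncard := Finset.sum_le_sum fun c hc => hg c (by simpa using hc)
    _ = (⋃ c ∈ C, D c).ncard := by
        rw [hC.ncard_biUnion hDf hdisj, finsum_mem_eq_finite_toFinset_sum _ hC]
    _ ≤ S.ncard := Set.ncard_le_ncard (Set.iUnion₂_subset hD) hS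

theorem Set.ncard_biUnion_le_ncard_mul {α β : Type*} {C : Set α} (hC : C.Finite)
    {D : α → Set β} {g : ℕ} (hg : ∀ c ∈ C, (D c).ncard ≤ g) :
    (⋃ c ∈ C, D c).ncard ≤ C.ncard * g := by
  calc (⋃ c ∈ C, D c).ncard = (⋃ c ∈ hC.toFinset, D c).ncard := by simp
    _ ≤ ∑ c ∈ hC.toFinset, (D c).ncard := hC.toFinset.set_ncard_biUnion_le D
    _ ≤ ∑ _c ∈ hC.toFinset, g := Finset.sum_le_sum fun c hc => hg c (by simpa using hc)
    _ = C.ncard * g := by simp [Set.ncard_eq_toFinset_card C hC]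

namespace IsParentMap

variable {V : Type*} {G : SimpleGraph V} {v₀ : V} {par : V → V}

theorem dist_of_mem_childSet (h : IsParentMap G v₀ par) {u c : V}
    (hc : c ∈ childSet v₀ par u) : G.dist v₀ c = G.dist v₀ u + 1 := by
  rw [← hc.2, h.dist_parent c hc.1]

theorem neighborSet_root (h : IsParentMap G v₀ par) :
    G.neighborSet v₀ = childSet v₀ par v₀ := by
  ext w
  simp [h.adj_iff, childSet]

theorem neighborSet_of_ne (h : IsParentMap G v₀ par) {v : V} (hv : v ≠ v₀) :
    G.neighborSet v = insert (par v) (childSet v₀ par v) := by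
  ext w
  simp [h.adj_iff, childSet, hv, eq_comm]

theorem parent_notMem_childSet (h : IsParentMap G v₀ par) {v : V} (hv : v ≠ v₀) :
    par v ∉ childSet v₀ par v := by
  intro hc
  have h1 := h.dist_of_mem_childSet hc
  have h2 := h.dist_parent v hv
  lia

theorem finite_dist_le (h : IsParentMap G v₀ par) (hG : G.Connected)
    (hfin : ∀ v, (childSet v₀ par v).Finite) (r : ℕ) : {v | G.dist v₀ v ≤ r}.Finite := by
  induction r with
  | zero =>
    refine (Set.finite_singleton v₀).subset fun v hv => ?_
    simpa [hG.dist_eq_zero_iff, eq_comm] using hv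
  | succ r ih =>
    refine ((Set.finite_singleton v₀).union (ih.biUnion fun v _ => hfin v)).subset fun v hv => ?_
    by_cases hv₀ : v = v₀
    · exact .inl hv₀
    · have := h.dist_parent v hv₀
      refine .inr (Set.mem_biUnion (x := par v) ?_ ⟨hv₀, rfl⟩)
      simp only [Set.mem_ofPred_eq] at hv ⊢
      lia

theorem self_mem_descSet (v : V) : v ∈ descSet G v₀ par v := ⟨0, rfl, rfl⟩

theorem descSet_subset_of_mem_childSet (h : IsParentMap G v₀ par) {u c : V}
    (hc : c ∈ childSet v₀ par u) : descSet G v₀ par c ⊆ descSet G v₀ par u := by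
  rintro w ⟨k, hk, hw⟩
  refine ⟨k + 1, ?_, ?_⟩
  · rw [Function.iterate_succ_apply', hk, hc.2]
  · rw [hw, h.dist_of_mem_childSet hc]
    lia

theorem notMem_descSet_of_mem_childSet (h : IsParentMap G v₀ par) {u c : V}
    (hc : c ∈ childSet v₀ par u) : u ∉ descSet G v₀ par c := by
  rintro ⟨k, -, hk⟩
  have := h.dist_of_mem_childSet hc
  lia

theorem pairwiseDisjoint_descSet (h : IsParentMap G v₀ par) (u : V) :
    (childSet v₀ par u).PairwiseDisjoint (descSet G v₀ par) := by
  intro c hc c' hc' hne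
  refine Set.disjoint_left.2 ?_
  rintro w ⟨k, hk, hw⟩ ⟨k', hk', hw'⟩
  have h1 := h.dist_of_mem_childSet hc
  have h2 := h.dist_of_mem_childSet hc'
  obtain rfl : k = k' := by lia
  exact hne (hk.symm.trans hk')

theorem exists_mem_childSet_of_isQuasipolar (h : IsParentMap G v₀ par) {r : ℕ} {Q : Set V}
    (hQ : IsQuasipolar G v₀ r Q) {u c : V} (hu : u ∈ Q) (hc : c ∈ childSet v₀ par u)
    (hr : G.dist v₀ c < r) (hcQ : c ∉ Q) : ∃ x ∈ childSet v₀ par c, x ∈ Q := by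
  by_contra! hx
  refine (hQ.2.2 c hr.le ⟨u, ⟨(h.adj_iff _ _).2 (.inl hc), hQ.2.1 hu, hu⟩, ?_⟩).elim hcQ hr.ne
  rintro w ⟨hw, -, hwQ⟩
  rcases (h.adj_iff _ _).1 hw with h' | h'
  · exact h'.2.symm.trans hc.2
  · exact absurd hwQ (hx w h')

theorem le_ncard_inter_descSet (h : IsParentMap G v₀ par)
    (hfin : ∀ v, (childSet v₀ par v).Finite) {m : ℕ}
    (hm : ∀ v, v ≠ v₀ → (childSet v₀ par v).ncard = m) {r : ℕ} {Q : Set V} (hQf : Q.Finite)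
    (hQ : IsQuasipolar G v₀ r Q) (s : ℕ) {u : V} (hu : u ∈ Q) (hs : G.dist v₀ u + s = r) :
    1 + (childSet v₀ par u).ncard * ∑ j ∈ Finset.range (s / 2), m ^ j ≤
      (Q ∩ descSet G v₀ par u).ncard := by
  induction s using Nat.strong_induction_on generalizing u with
  | _ s ih =>
  have hbranch : ∀ c ∈ childSet v₀ par u,
      ∑ j ∈ Finset.range (s / 2), m ^ j ≤ (Q ∩ descSet G v₀ par c).ncard := by
    intro c hc
    have hdc := h.dist_of_mem_childSet hc
    rcases Nat.lt_or_ge s 2 with hs2 | hs2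
    · simp [Nat.div_eq_of_lt hs2]
    have key : ∀ t < s, s ≤ t + 2 → ∀ x ∈ Q, x ≠ v₀ → G.dist v₀ x + t = r →
        descSet G v₀ par x ⊆ descSet G v₀ par c →
        ∑ j ∈ Finset.range (s / 2), m ^ j ≤ (Q ∩ descSet G v₀ par c).ncard := by
      intro t ht hst x hx hx₀ hxt hsub
      calc ∑ j ∈ Finset.range (s / 2), m ^ j
          ≤ ∑ j ∈ Finset.range (t / 2 + 1), m ^ j :=
            Finset.sum_le_sum_of_subset (Finset.range_mono (by lia))
        _ = 1 + (childSet v₀ par x).ncard * ∑ j ∈ Finset.range (t / 2), m ^ j := by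
            rw [Finset.sum_range_succ', hm x hx₀, Finset.mul_sum, pow_zero, add_comm]
            simp only [pow_succ']
        _ ≤ (Q ∩ descSet G v₀ par x).ncard := ih t ht hx hxt
        _ ≤ (Q ∩ descSet G v₀ par c).ncard :=
            Set.ncard_le_ncard (Set.inter_subset_inter_right Q hsub) (hQf.inter_of_left _)
    by_cases hcQ : c ∈ Q
    · exact key (s - 1) (by lia) (by lia) c hcQ hc.1 (by lia) subset_rfl
    · obtain ⟨x, hx, hxQ⟩ :=
        h.exists_mem_childSet_of_isQuasipolar hQ hu hc (by lia) hcQ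
      have hdx := h.dist_of_mem_childSet hx
      exact key (s - 2) (by lia) (by lia) x hxQ hx.1 (by lia)
        (h.descSet_subset_of_mem_childSet hx)
  have hle := Set.ncard_mul_le_ncard_of_pairwiseDisjoint (hfin u)
    (D := fun c => Q ∩ descSet G v₀ par c) (S := (Q ∩ descSet G v₀ par u) \ {u})
    ((hQf.inter_of_left _).sdiff)
    (fun c hc w hw => ⟨⟨hw.1, h.descSet_subset_of_mem_childSet hc hw.2⟩, by
      rintro rfl
      exact h.notMem_descSet_of_mem_childSet hc hw.2⟩)
    ((h.pairwiseDisjoint_descSet u).mono fun c => Set.inter_subset_right) hbranch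
  have hadd := Set.ncard_sdiff_singleton_add_one
    (show u ∈ Q ∩ descSet G v₀ par u from ⟨hu, self_mem_descSet u⟩) (hQf.inter_of_left _)
  lia

variable {ch : V → V}

theorem dist_of_mem_evenLayer (h : IsParentMap G v₀ par) (hch : ∀ v, ch v ∈ childSet v₀ par v)
    {k : ℕ} {v : V} (hv : v ∈ evenLayer v₀ par ch k) : G.dist v₀ v = 2 * k := by
  induction k generalizing v with
  | zero =>
    obtain rfl : v = v₀ := hv
    simp
  | succ k ih =>
    simp only [evenLayer, Set.mem_iUnion] at hv
    obtain ⟨u, hu, c, hc, rfl⟩ := hv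
    rw [h.dist_of_mem_childSet (hch c), h.dist_of_mem_childSet hc, ih hu]
    lia

theorem isQuasipolar_evenLayers (h : IsParentMap G v₀ par)
    (hch : ∀ v, ch v ∈ childSet v₀ par v) (r : ℕ) :
    IsQuasipolar G v₀ r (⋃ k ∈ Finset.range (r / 2 + 1), evenLayer v₀ par ch k) := by
  have hmem : ∀ v, v ∈ (⋃ k ∈ Finset.range (r / 2 + 1), evenLayer v₀ par ch k) ↔
      ∃ k ≤ r / 2, v ∈ evenLayer v₀ par ch k := by
    simp
  refine ⟨⟨v₀, (hmem _).2 ⟨0, by simp, rfl⟩⟩, fun v hv => ?_, fun v hv => ?_⟩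
  · obtain ⟨k, hk, hvk⟩ := (hmem v).1 hv
    rw [Set.mem_ofPred_eq, h.dist_of_mem_evenLayer hch hvk]
    lia
  rintro ⟨w, ⟨hvw, -, hw⟩, huniq⟩
  by_contra! hcon
  have hlt : G.dist v₀ v < r := lt_of_le_of_ne hv hcon.2
  obtain ⟨k, hk, hwk⟩ := (hmem w).1 hw
  have hdw := h.dist_of_mem_evenLayer hch hwk
  rcases (h.adj_iff _ _).1 hvw with hc | hc
  · have hdv := h.dist_of_mem_childSet hc
    have hdc := h.dist_of_mem_childSet (hch v)
    have hcw := huniq (ch v) ⟨(h.adj_iff _ _).2 (.inr (hch v)), by lia, (hmem _).2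
      ⟨k + 1, by lia, Set.mem_biUnion hwk ⟨v, hc, rfl⟩⟩⟩
    rw [hcw] at hdc
    lia
  · cases k with
    | zero => exact hc.1 hwk
    | succ k =>
      simp only [evenLayer, Set.mem_iUnion] at hwk
      obtain ⟨u, hu, c, hcu, rfl⟩ := hwk
      obtain rfl : c = v := (hch c).2.symm.trans hc.2
      have hdu := h.dist_of_mem_evenLayer hch hu
      have huw := huniq u ⟨(h.adj_iff _ _).2 (.inl hcu), by lia, (hmem _).2 ⟨k, by lia, hu⟩⟩
      rw [huw] at hdu
      lia

theorem finite_evenLayer (hfin : ∀ v, (childSet v₀ par v).Finite) (k : ℕ) :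
    (evenLayer v₀ par ch k).Finite := by
  induction k with
  | zero => exact Set.finite_singleton v₀
  | succ k ih => exact ih.biUnion fun v _ => (hfin v).image ch

theorem ncard_evenLayer_succ_le (h : IsParentMap G v₀ par)
    (hch : ∀ v, ch v ∈ childSet v₀ par v) (hfin : ∀ v, (childSet v₀ par v).Finite) {m : ℕ}
    (hm : ∀ v, v ≠ v₀ → (childSet v₀ par v).ncard = m) (k : ℕ) :
    (evenLayer v₀ par ch (k + 1)).ncard ≤ (childSet v₀ par v₀).ncard * m ^ k := by
  induction k with
  | zero => simpa [evenLayer] using Set.ncard_image_le (f := ch) (hfin v₀)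
  | succ k ih =>
    rw [pow_succ, ← mul_assoc]
    refine (Set.ncard_biUnion_le_ncard_mul (g := m) (finite_evenLayer hfin (k + 1))
      fun v hv => ?_).trans (Nat.mul_le_mul_right m ih)
    have hv₀ : v ≠ v₀ := by
      rintro rfl
      simpa using h.dist_of_mem_evenLayer hch hv
    exact (Set.ncard_image_le (hfin v)).trans_eq (hm v hv₀)

theorem ncard_evenLayers_le (h : IsParentMap G v₀ par)
    (hch : ∀ v, ch v ∈ childSet v₀ par v) (hfin : ∀ v, (childSet v₀ par v).Finite) {m : ℕ}
    (hm : ∀ v, v ≠ v₀ → (childSet v₀ par v).ncard = m) (N : ℕ) :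
    (⋃ k ∈ Finset.range (N + 1), evenLayer v₀ par ch k).ncard ≤
      1 + (childSet v₀ par v₀).ncard * ∑ j ∈ Finset.range N, m ^ j := by
  refine ((Finset.range (N + 1)).set_ncard_biUnion_le _).trans ?_
  rw [Finset.sum_range_succ', add_comm, Finset.mul_sum]
  exact add_le_add (by simp [evenLayer])
    (Finset.sum_le_sum fun k _ => h.ncard_evenLayer_succ_le hch hfin hm k)

end IsParentMap

/-- Let `T = T(n,i)` be the infinite tree rooted at `v₀` in which the root has degree `n + i`
and every other vertex has degree `n` (`n ≥ 2`, `i > -n`), and let `r ≥ 0`.  The minimum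
cardinality of a quasipolar subset of the truncated tree `T^r` containing the root equals
`1 + (n+i) · ∑_{j=0}^{⌊r/2⌋-1} (n-1)^j`. -/
theorem min_card_quasipolar {V : Type*} (G : SimpleGraph V) (v₀ : V)
    (n i : ℤ) (hn : 2 ≤ n) (hi : -n < i)
    (hG : G.Connected) (hA : G.IsAcyclic) (hinf : Infinite V)
    (hdeg₀ : ((G.neighborSet v₀).ncard : ℤ) = n + i)
    (hdeg : ∀ v : V, v ≠ v₀ → ((G.neighborSet v).ncard : ℤ) = n)
    (r : ℕ) :
    IsLeast {m : ℤ | ∃ Q : Set V, IsQuasipolar G v₀ r Q ∧ v₀ ∈ Q ∧ (Q.ncard : ℤ) = m}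
      (1 + (n + i) * ∑ j ∈ Finset.range (r / 2), (n - 1) ^ j) := by
  obtain ⟨par, h⟩ := SimpleGraph.IsTree.exists_isParentMap ⟨hG, hA⟩ v₀
  have hroot : ((childSet v₀ par v₀).ncard : ℤ) = n + i := by rw [← h.neighborSet_root, hdeg₀]
  obtain ⟨m, rfl⟩ : ∃ m : ℕ, n = m + 1 := ⟨(n - 1).toNat, by lia⟩
  have hm : ∀ v, v ≠ v₀ → (childSet v₀ par v).ncard = m := by
    intro v hv
    have hd := hdeg v hv
    have hf : (G.neighborSet v).Finite := Set.finite_of_ncard_pos (by lia)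
    rw [h.neighborSet_of_ne hv] at hd hf
    rw [Set.ncard_insert_of_notMem (h.parent_notMem_childSet hv)
      (hf.subset (Set.subset_insert _ _))] at hd
    lia
  have hpos : ∀ v, 0 < (childSet v₀ par v).ncard := by
    intro v
    by_cases hv : v = v₀
    · subst hv; lia
    · rw [hm v hv]; lia
  have hfin : ∀ v, (childSet v₀ par v).Finite := fun v => Set.finite_of_ncard_pos (hpos v)
  choose ch hch using fun v => Set.nonempty_of_ncard_ne_zero (hpos v).ne'
  have hval : (1 + (↑m + 1 + i) * ∑ j ∈ Finset.range (r / 2), ((m : ℤ) + 1 - 1) ^ j) =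
      ((1 + (childSet v₀ par v₀).ncard * ∑ j ∈ Finset.range (r / 2), m ^ j : ℕ) : ℤ) := by
    push_cast
    rw [hroot, add_sub_cancel_right]
  have hlow : ∀ Q, IsQuasipolar G v₀ r Q → v₀ ∈ Q →
      1 + (childSet v₀ par v₀).ncard * ∑ j ∈ Finset.range (r / 2), m ^ j ≤ Q.ncard := by
    intro Q hQ hv₀
    have hQf : Q.Finite := (h.finite_dist_le hG hfin r).subset hQ.2.1
    exact (h.le_ncard_inter_descSet hfin hm hQf hQ r hv₀ (by simp)).trans
      (Set.ncard_le_ncard Set.inter_subset_left hQf)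
  rw [hval]
  constructor
  · have hQ := h.isQuasipolar_evenLayers hch r
    have hv₀ : v₀ ∈ ⋃ k ∈ Finset.range (r / 2 + 1), evenLayer v₀ par ch k :=
      Set.mem_biUnion (x := 0) (by simp) rfl
    exact ⟨_, hQ, hv₀, congrArg _
      ((h.ncard_evenLayers_le hch hfin hm _).antisymm (hlow _ hQ hv₀))⟩
  · rintro _ ⟨Q, hQ, hv₀, rfl⟩
    exact_mod_cast hlow Q hQ hv₀
end

section
/- Let n ≥ 2 and i > −n be integers and let T = T(n,i) be the rooted infinite tree with root v₀ of degree n+i and all other degrees n. Then there exists a set P of vertices of T satisfying the polar property, with v₀ ∈ P, such that for every d ≥ 0 the number of elements of P at distance exactly d from v₀ equals: 1 if d = 0; (n+i)·(n−1)^{d/2−1} if d is even and d ≥ 2; and 0 if d is odd. -/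
namespace SimpleGraph

variable {V : Type*} {G : SimpleGraph V} {r u v w : V}

/-- In a tree, a vertex has at most one neighbor closer to a given root. -/
lemma IsTree.eq_of_adj_of_dist_add_one (hG : G.IsTree) (hu : G.Adj u v) (hw : G.Adj w v)
    (hdu : G.dist r u + 1 = G.dist r v) (hdw : G.dist r w + 1 = G.dist r v) : u = w := by
  obtain ⟨p, hp⟩ := hG.connected.exists_walk_length_eq_dist r u
  have hpath : (p.concat hu).IsPath :=
    (p.concat hu).isPath_of_length_eq_dist (by rw [Walk.length_concat, hp, hdu])
  obtain ⟨q, hq⟩ := hG.connected.exists_walk_length_eq_dist r w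
  have hqath : (q.concat hw).IsPath :=
    (q.concat hw).isPath_of_length_eq_dist (by rw [Walk.length_concat, hq, hdw])
  have h := congrArg (fun p : G.Path r v ↦ p.1.penultimate)
    ((hG.isAcyclic.subsingleton_path r v).elim ⟨_, hpath⟩ ⟨_, hqath⟩)
  simpa using h

/-- In a connected graph, every vertex other than the root has a neighbor closer to the root. -/
lemma Connected.exists_adj_dist_add_one (hG : G.Connected) (hv : v ≠ r) :
    ∃ u, G.Adj u v ∧ G.dist r u + 1 = G.dist r v := by
  obtain ⟨p, hp⟩ := hG.exists_walk_length_eq_dist v r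
  cases p with
  | nil => exact absurd rfl hv
  | @cons _ u _ h p =>
    refine ⟨u, h.symm, ?_⟩
    have h₁ := dist_le p
    have h₂ := hG.dist_triangle (u := v) (v := u) (w := r)
    rw [dist_eq_one_iff_adj.2 h] at h₂
    rw [Walk.length_cons] at hp
    rw [dist_comm, dist_comm (u := r) (v := v)]
    omega

/-- The children of `v` in the graph `G` rooted at `r`. -/
def children (G : SimpleGraph V) (r v : V) : Set V :=
  {w | G.Adj v w ∧ G.dist r w = G.dist r v + 1}

lemma children_root : G.children r r = G.neighborSet r := by
  ext w
  simp only [children, Set.mem_ofPred_eq, mem_neighborSet, dist_self, and_iff_left_iff_imp]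
  exact fun h ↦ dist_eq_one_iff_adj.2 h

lemma IsTree.ncard_children_add_one (hG : G.IsTree) (hv : v ≠ r)
    (hfin : (G.neighborSet v).Finite) :
    (G.children r v).ncard + 1 = (G.neighborSet v).ncard := by
  obtain ⟨u, hu, hdu⟩ := hG.connected.exists_adj_dist_add_one hv
  have h : G.neighborSet v = insert u (G.children r v) := by
    ext w
    simp only [children, Set.mem_insert_iff, Set.mem_ofPred_eq, mem_neighborSet]
    constructor
    · intro h
      rcases hG.dist_eq_dist_add_one_of_adj r h with h' | h'
      · exact .inl (hG.eq_of_adj_of_dist_add_one h.symm hu h'.symm hdu)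
      · exact .inr ⟨h, h'⟩
    · rintro (rfl | h)
      exacts [hu.symm, h.1]
  have hu' : u ∉ G.children r v := fun h ↦ by have := h.2; omega
  rw [h, Set.ncard_insert_of_notMem hu' (hfin.subset fun w h ↦ h.1)]

lemma IsTree.eq_of_mem_children (hG : G.IsTree) (hu : v ∈ G.children r u)
    (hw : v ∈ G.children r w) : u = w :=
  hG.eq_of_adj_of_dist_add_one hu.1 hw.1 hu.2.symm hw.2.symm

/-- The `k`-th level of the set obtained from the root `r` by passing repeatedly from a vertex
to one chosen child `c w` of each of its children `w`. -/
noncomputable def polarLevel (ch : V → Finset V) (c : V → V) (r : V) : ℕ → Finset V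
  | 0 => {r}
  | k + 1 => by
    classical exact ((polarLevel ch c r k).biUnion ch).image c

section polarLevel

variable {ch : V → Finset V} {c : V → V}

lemma mem_polarLevel_succ {k : ℕ} :
    v ∈ polarLevel ch c r (k + 1) ↔ ∃ u ∈ polarLevel ch c r k, ∃ w ∈ ch u, c w = v := by
  simp only [polarLevel, Finset.mem_image, Finset.mem_biUnion]
  grind

lemma dist_of_mem_polarLevel (hch : ∀ v, (ch v : Set V) = G.children r v)
    (hc : ∀ v ≠ r, c v ∈ G.children r v) :
    ∀ {k : ℕ} {v : V}, v ∈ polarLevel ch c r k → G.dist r v = 2 * k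
  | 0, v, h => by
    rw [polarLevel, Finset.mem_singleton] at h
    simp [h]
  | k + 1, v, h => by
    obtain ⟨u, hu, w, hw, rfl⟩ := mem_polarLevel_succ.1 h
    have h₁ := dist_of_mem_polarLevel hch hc hu
    have h₂ : w ∈ G.children r u := hch u ▸ hw
    have h₃ := h₂.2
    have h₄ := (hc w (by rintro rfl; simp at h₃)).2
    omega

lemma card_polarLevel_succ (hG : G.IsTree) (hch : ∀ v, (ch v : Set V) = G.children r v)
    (hc : ∀ v ≠ r, c v ∈ G.children r v) (k : ℕ) :
    (polarLevel ch c r (k + 1)).card = ∑ u ∈ polarLevel ch c r k, (ch u).card := by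
  classical
  have hmem : ∀ {u w}, w ∈ ch u → w ∈ G.children r u := fun {u w} h ↦ hch u ▸ h
  have hne : ∀ {u w}, w ∈ ch u → w ≠ r := by
    rintro u w h rfl
    simpa using (hmem h).2
  have h : polarLevel ch c r (k + 1) = ((polarLevel ch c r k).biUnion ch).image c := by
    ext; simp [mem_polarLevel_succ]; grind
  rw [h, Finset.card_image_of_injOn, Finset.card_biUnion]
  · intro u _ u' _ huu'
    exact Finset.disjoint_left.2
      fun w hw hw' ↦ huu' (hG.eq_of_mem_children (hmem hw) (hmem hw'))
  · intro w hw w' hw' hww'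
    simp only [Finset.coe_biUnion, Set.mem_iUnion, Finset.mem_coe] at hw hw'
    obtain ⟨u, -, hw⟩ := hw
    obtain ⟨u', -, hw'⟩ := hw'
    exact hG.eq_of_mem_children (hc w (hne hw)) (hww' ▸ hc w' (hne hw'))

lemma card_polarLevel (hG : G.IsTree) (hch : ∀ v, (ch v : Set V) = G.children r v)
    (hc : ∀ v ≠ r, c v ∈ G.children r v) {m : ℕ} (hm : ∀ v ≠ r, (ch v).card = m) :
    ∀ k : ℕ, (polarLevel ch c r (k + 1)).card = (ch r).card * m ^ k
  | 0 => by rw [card_polarLevel_succ hG hch hc]; simp [polarLevel]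
  | k + 1 => by
    rw [card_polarLevel_succ hG hch hc, Finset.sum_const_nat (m := m),
      card_polarLevel hG hch hc hm k, pow_succ, mul_assoc]
    refine fun u hu ↦ hm u ?_
    rintro rfl
    simpa using dist_of_mem_polarLevel hch hc hu

/-- No vertex has exactly one neighbor in the union of the levels. -/
lemma satisfiesPolarProperty_polarLevel (hG : G.IsTree)
    (hch : ∀ v, (ch v : Set V) = G.children r v) (hc : ∀ v ≠ r, c v ∈ G.children r v) :
    SatisfiesPolarProperty G {v | ∃ k, v ∈ polarLevel ch c r k} := by
  rintro v ⟨w, ⟨hvw, k, hw⟩, huniq⟩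
  exfalso
  have hdw := dist_of_mem_polarLevel hch hc hw
  rcases hG.dist_eq_dist_add_one_of_adj r hvw with h | h
  · have hv : v ∈ ch w := by
      rw [← Finset.mem_coe, hch]
      exact ⟨hvw.symm, h⟩
    have hcv := hc v (by rintro rfl; simp at h)
    have := huniq (c v) ⟨hcv.1, k + 1, mem_polarLevel_succ.2 ⟨w, hw, v, hv, rfl⟩⟩
    have h' := hcv.2
    rw [this] at h'
    omega
  · obtain _ | k := k
    · omega
    obtain ⟨u, hu, w', hw', rfl⟩ := mem_polarLevel_succ.1 hw
    have hw'' : w' ∈ G.children r u := hch u ▸ hw'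
    have hcw := hc w' (by rintro rfl; simpa using hw''.2)
    obtain rfl : v = w' := hG.eq_of_mem_children ⟨hvw, h⟩ hcw
    have := huniq u ⟨hw''.1.symm, k, hu⟩
    have h₁ := hw''.2
    rw [this] at h₁
    omega

end polarLevel

end SimpleGraph

/-- Let `T = T(n,i)` be the infinite tree rooted at `v₀` in which the root has degree `n + i`
and every other vertex has degree `n` (`n ≥ 2`, `i > -n`).  There is a set `P` of vertices of
`T` satisfying the polar property, containing `v₀`, such that for every `d ≥ 0` the number of
elements of `P` at distance exactly `d` from `v₀` is: `1` if `d = 0`;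
`(n+i)·(n-1)^{d/2-1}` if `d` is even and `d ≥ 2`; and `0` if `d` is odd. -/
theorem exists_polar_with_sphere_counts {V : Type*} (G : SimpleGraph V) (v₀ : V)
    (n i : ℤ) (hn : 2 ≤ n) (hi : -n < i)
    (hG : G.Connected) (hA : G.IsAcyclic) (hinf : Infinite V)
    (hdeg₀ : ((G.neighborSet v₀).ncard : ℤ) = n + i)
    (hdeg : ∀ v : V, v ≠ v₀ → ((G.neighborSet v).ncard : ℤ) = n) :
    ∃ P : Set V, SatisfiesPolarProperty G P ∧ v₀ ∈ P ∧
      ∀ d : ℕ, ((P ∩ {v | G.dist v₀ v = d}).ncard : ℤ) =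
        if d = 0 then 1
        else if Even d then (n + i) * (n - 1) ^ (d / 2 - 1)
        else 0 := by
  classical
  have hT : G.IsTree := ⟨hG, hA⟩
  have hfin₀ : (G.neighborSet v₀).Finite := Set.finite_of_ncard_pos (by omega)
  have hfin : ∀ v ≠ v₀, (G.neighborSet v).Finite := fun v hv ↦
    Set.finite_of_ncard_pos (by have := hdeg v hv; omega)
  have hchfin : ∀ v, (G.children v₀ v).Finite := fun v ↦ by
    by_cases hv : v = v₀
    · rw [hv, SimpleGraph.children_root]
      exact hfin₀
    · exact (hfin v hv).subset fun w h ↦ h.1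
  have hcard : ∀ v ≠ v₀, ((G.children v₀ v).ncard : ℤ) = n - 1 := fun v hv ↦ by
    have h₁ := hT.ncard_children_add_one hv (hfin v hv)
    have h₂ := hdeg v hv
    omega
  have hex : ∀ v, ∃ w, v ≠ v₀ → w ∈ G.children v₀ v := fun v ↦ by
    by_cases hv : v = v₀
    · exact ⟨v, fun h ↦ absurd hv h⟩
    · obtain ⟨w, hw⟩ := Set.nonempty_of_ncard_ne_zero (s := G.children v₀ v)
        (by have := hcard v hv; omega)
      exact ⟨w, fun _ ↦ hw⟩
  choose c hc using hex
  let ch : V → Finset V := fun v ↦ (hchfin v).toFinset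
  have hch : ∀ v, (ch v : Set V) = G.children v₀ v := fun v ↦ (hchfin v).coe_toFinset
  have hchcard : ∀ v, (ch v).card = (G.children v₀ v).ncard := fun v ↦ by
    rw [← hch, Set.ncard_coe_finset]
  obtain ⟨m, hm⟩ := Int.eq_ofNat_of_zero_le (show 0 ≤ n - 1 by omega)
  have hchm : ∀ v ≠ v₀, (ch v).card = m := fun v hv ↦ by
    have := hcard v hv
    rw [hchcard]
    omega
  refine ⟨{v | ∃ k, v ∈ SimpleGraph.polarLevel ch c v₀ k}, SimpleGraph.satisfiesPolarProperty_polarLevel hT hch hc,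
    ⟨0, by simp [SimpleGraph.polarLevel]⟩, fun d ↦ ?_⟩
  obtain ⟨k, rfl | rfl⟩ := d.even_or_odd'
  · have hlevel : {v | ∃ k, v ∈ SimpleGraph.polarLevel ch c v₀ k} ∩ {v | G.dist v₀ v = 2 * k} =
        SimpleGraph.polarLevel ch c v₀ k := by
      ext v
      constructor
      · rintro ⟨⟨j, hj⟩, hv⟩
        have := SimpleGraph.dist_of_mem_polarLevel hch hc hj
        rw [Set.mem_ofPred_eq] at hv
        obtain rfl : j = k := by omega
        exact hj
      · exact fun hv ↦ ⟨⟨k, hv⟩, SimpleGraph.dist_of_mem_polarLevel hch hc hv⟩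
    rw [hlevel, Set.ncard_coe_finset]
    obtain _ | k := k
    · simp [SimpleGraph.polarLevel]
    · rw [if_neg (by omega), if_pos (even_two_mul _), SimpleGraph.card_polarLevel hT hch hc hchm, hchcard,
        SimpleGraph.children_root, hm, ← hdeg₀]
      simp
  · have hlevel : {v | ∃ k, v ∈ SimpleGraph.polarLevel ch c v₀ k} ∩ {v | G.dist v₀ v = 2 * k + 1} = ∅ := by
      ext v
      simp only [Set.mem_inter_iff, Set.mem_ofPred_eq, Set.mem_empty_iff_false, iff_false]
      rintro ⟨⟨j, hj⟩, hv⟩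
      have := SimpleGraph.dist_of_mem_polarLevel hch hc hj
      omega
    rw [hlevel, if_neg (by omega), if_neg (by simp)]
    simp
end

section
/- Let n ≥ 3 and c ≥ 3 be integers, let V = V(n,c) be the infinite n-regular volcano with crater of length c, rooted at a vertex v₀ on its cycle, and let r ≥ 2. If P is a set of vertices of V satisfying the polar property and v₀ ∈ P, then the number of elements of P at distance at most r from v₀ is at least (n−1)^{⌊r/2⌋} + (n−1)^{⌊r/2⌋−1}. -/
namespace Volcano

open SimpleGraph

variable {V : Type*} {G : SimpleGraph V} {v₀ : V}

/-- `Child G v₀ E x y` says that `y` is a neighbor of `x` further away from the root `v₀`,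
joined to `x` by an edge outside of `E`. -/
def Child (G : SimpleGraph V) (v₀ : V) (E : Set (Sym2 V)) (x y : V) : Prop :=
  G.Adj x y ∧ s(x, y) ∉ E ∧ G.dist v₀ x < G.dist v₀ y

lemma false_of_walks_to_root {p : G.Walk v₀ v₀} (hp : p.IsCycle)
    (huniq : ∀ (u v : V) (p : G.Walk u u) (q : G.Walk v v),
      p.IsCycle → q.IsCycle → ∀ e : Sym2 V, e ∈ p.edges ↔ e ∈ q.edges)
    {x y : V} (hxy : G.Adj x y) (he : s(x, y) ∉ p.edges)
    (hx : ∃ w : G.Walk x v₀, s(x, y) ∉ w.edges)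
    (hy : ∃ w : G.Walk y v₀, s(x, y) ∉ w.edges) : False := by
  obtain ⟨w, hw⟩ := hx
  obtain ⟨w', hw'⟩ := hy
  have hr : (G.deleteEdges {s(x, y)}).Reachable x y := by
    rw [reachable_deleteEdges_iff_exists_walk]
    refine ⟨w.append w'.reverse, ?_⟩
    simp [Walk.edges_append, hw, hw']
  obtain ⟨u, q, hq, hmem⟩ := adj_and_reachable_delete_edges_iff_exists_cycle.1 ⟨hxy, hr⟩
  exact he ((huniq _ _ _ _ hp hq _).2 hmem)

lemma exists_walk_of_mem_support {p : G.Walk v₀ v₀} {x : V} (hx : x ∈ p.support)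
    {e : Sym2 V} (he : e ∉ p.edges) : ∃ w : G.Walk x v₀, e ∉ w.edges := by
  classical
  exact ⟨p.dropUntil x hx, fun h => he (p.edges_dropUntil_subset_edges hx h)⟩

lemma exists_walk_notMem_support (hconn : G.Connected) {x y : V} (hne : x ≠ y)
    (h : G.dist v₀ x ≤ G.dist v₀ y) : ∃ w : G.Walk x v₀, y ∉ w.support := by
  classical
  obtain ⟨w, hw⟩ := hconn.exists_walk_length_eq_dist x v₀
  refine ⟨w, fun hy => ?_⟩
  have h1 := congrArg Walk.length (w.take_spec hy)
  rw [Walk.length_append] at h1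
  have h2 : 0 < (w.takeUntil y hy).length := by
    rw [Nat.pos_iff_ne_zero]
    exact fun h0 => hne (Walk.eq_of_length_eq_zero h0)
  have h3 := dist_le (w.dropUntil y hy)
  rw [dist_comm] at h3
  rw [dist_comm] at hw
  omega

section UniqueCycle

variable {p : G.Walk v₀ v₀} (hconn : G.Connected) (hp : p.IsCycle)
  (huniq : ∀ (u v : V) (p : G.Walk u u) (q : G.Walk v v),
    p.IsCycle → q.IsCycle → ∀ e : Sym2 V, e ∈ p.edges ↔ e ∈ q.edges)

include hconn hp huniq

lemma mem_edges_of_two_lower_neighbors {x x' y : V} (hne : x ≠ x') (hx : G.Adj x y)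
    (hx' : G.Adj x' y) (h : G.dist v₀ x ≤ G.dist v₀ y) (h' : G.dist v₀ x' ≤ G.dist v₀ y) :
    s(x, y) ∈ p.edges := by
  by_contra he
  obtain ⟨w, hw⟩ := exists_walk_notMem_support hconn hx.ne h
  obtain ⟨w', hw'⟩ := exists_walk_notMem_support hconn hx'.ne h'
  refine false_of_walks_to_root hp huniq hx he
    ⟨w, fun h => hw (w.snd_mem_support_of_mem_edges h)⟩ ⟨Walk.cons hx'.symm w', ?_⟩
  rw [Walk.edges_cons, List.mem_cons, not_or]
  refine ⟨?_, fun h => hw' (w'.snd_mem_support_of_mem_edges h)⟩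
  rw [Sym2.eq_swap (a := y)]
  intro h
  exact hne (Sym2.congr_left.1 h)

lemma Child.left_unique {x x' y : V} (h : Child G v₀ {e | e ∈ p.edges} x y)
    (h' : Child G v₀ {e | e ∈ p.edges} x' y) : x = x' := by
  by_contra hne
  exact h.2.1 (mem_edges_of_two_lower_neighbors hconn hp huniq hne h.1 h'.1 h.2.2.le h'.2.2.le)

lemma Child.notMem_support {x y : V} (h : Child G v₀ {e | e ∈ p.edges} x y) :
    y ∉ p.support := by
  intro hy
  obtain ⟨w, hw⟩ := exists_walk_notMem_support hconn h.1.ne h.2.2.le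
  exact false_of_walks_to_root hp huniq h.1 h.2.1
    ⟨w, fun h => hw (w.snd_mem_support_of_mem_edges h)⟩ (exists_walk_of_mem_support hy h.2.1)

lemma child_of_mem_support {x y : V} (hx : x ∈ p.support) (hxy : G.Adj x y)
    (he : s(x, y) ∉ p.edges) : Child G v₀ {e | e ∈ p.edges} x y := by
  refine ⟨hxy, he, ?_⟩
  by_contra hlt
  obtain ⟨w, hw⟩ := exists_walk_notMem_support hconn hxy.ne' (not_lt.1 hlt)
  exact false_of_walks_to_root hp huniq hxy he (exists_walk_of_mem_support hx he)
    ⟨w, fun h => hw (w.fst_mem_support_of_mem_edges h)⟩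

lemma child_of_notMem_support {x y z : V} (hy : y ∉ p.support) (hxy : G.Adj x y)
    (hlt : G.dist v₀ x ≤ G.dist v₀ y) (hyz : G.Adj y z) (hne : z ≠ x) :
    Child G v₀ {e | e ∈ p.edges} y z := by
  refine ⟨hyz, fun he => hy (p.fst_mem_support_of_mem_edges he), ?_⟩
  by_contra h
  exact hy (p.snd_mem_support_of_mem_edges
    (mem_edges_of_two_lower_neighbors hconn hp huniq hne.symm hxy hyz.symm hlt (not_lt.1 h)))

lemma exists_child_finset_of_notMem_support {n : ℕ} (hn : 0 < n)
    (hreg : ∀ v : V, (G.neighborSet v).ncard = n) {x : V} (hx : x ∉ p.support) :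
    ∃ K : Finset V, (∀ y ∈ K, Child G v₀ {e | e ∈ p.edges} x y) ∧ n - 1 ≤ K.card := by
  classical
  have hfin : (G.neighborSet x).Finite := Set.finite_of_ncard_pos (by rw [hreg]; exact hn)
  have hcard : hfin.toFinset.card = n := by rw [← Set.ncard_eq_toFinset_card _ hfin, hreg]
  by_cases hlow : ∃ u, G.Adj u x ∧ G.dist v₀ u ≤ G.dist v₀ x
  · obtain ⟨u, hu, hle⟩ := hlow
    refine ⟨hfin.toFinset.erase u, fun y hy => ?_, hcard ▸ Finset.pred_card_le_card_erase⟩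
    simp only [Finset.mem_erase, Set.Finite.mem_toFinset, mem_neighborSet] at hy
    exact child_of_notMem_support hconn hp huniq hx hu hle hy.2 hy.1
  · push Not at hlow
    refine ⟨hfin.toFinset, fun y hy => ?_, by omega⟩
    simp only [Set.Finite.mem_toFinset, mem_neighborSet] at hy
    exact ⟨hy, fun he => hx (p.fst_mem_support_of_mem_edges he), hlow y hy.symm⟩

lemma exists_child_finset {n : ℕ} (hn : 0 < n)
    (hreg : ∀ v : V, (G.neighborSet v).ncard = n) (x : V) :
    ∃ K : Finset V, (∀ y ∈ K, Child G v₀ {e | e ∈ p.edges} x y) ∧ n - 2 ≤ K.card := by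
  classical
  by_cases hx : x ∈ p.support
  · have hfin : (G.neighborSet x).Finite := Set.finite_of_ncard_pos (by rw [hreg]; exact hn)
    have htwo := hp.ncard_neighborSet_toSubgraph_eq_two hx
    have hfin' : (p.toSubgraph.neighborSet x).Finite :=
      Set.finite_of_ncard_pos (by rw [htwo]; exact two_pos)
    refine ⟨hfin.toFinset \ hfin'.toFinset, fun y hy => ?_, ?_⟩
    · simp only [Finset.mem_sdiff, Set.Finite.mem_toFinset, mem_neighborSet,
        Subgraph.mem_neighborSet] at hy
      exact child_of_mem_support hconn hp huniq hx hy.1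
        (fun he => hy.2 ((Walk.mem_edges_toSubgraph p).2 he))
    · refine le_trans ?_ (Finset.le_card_sdiff _ _)
      rw [← Set.ncard_eq_toFinset_card _ hfin, ← Set.ncard_eq_toFinset_card _ hfin', hreg, htwo]
  · obtain ⟨K, hK, hc⟩ := exists_child_finset_of_notMem_support hconn hp huniq hn hreg hx
    exact ⟨K, hK, by omega⟩

lemma notMem_support_of_transGen {x y : V}
    (h : Relation.TransGen (Child G v₀ {e | e ∈ p.edges}) x y) : y ∉ p.support := by
  cases h with
  | single h => exact h.notMem_support hconn hp huniq
  | tail _ h => exact h.notMem_support hconn hp huniq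

omit hconn hp huniq in
lemma dist_le_of_reflTransGen {E : Set (Sym2 V)} {x y : V}
    (h : Relation.ReflTransGen (Child G v₀ E) x y) : G.dist v₀ x ≤ G.dist v₀ y := by
  induction h with
  | refl => exact le_rfl
  | tail _ h ih => exact ih.trans h.2.2.le

lemma reflTransGen_total {x x' z : V}
    (h : Relation.ReflTransGen (Child G v₀ {e | e ∈ p.edges}) x z)
    (h' : Relation.ReflTransGen (Child G v₀ {e | e ∈ p.edges}) x' z) :
    Relation.ReflTransGen (Child G v₀ {e | e ∈ p.edges}) x x' ∨
      Relation.ReflTransGen (Child G v₀ {e | e ∈ p.edges}) x' x := by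
  induction h with
  | refl => exact Or.inr h'
  | @tail b c hxb hbc ih =>
    rcases Relation.ReflTransGen.cases_tail h' with rfl | ⟨d, hd, hdc⟩
    · exact Or.inl (hxb.tail hbc)
    · rw [hdc.left_unique hconn hp huniq hbc] at hd
      exact ih hd

lemma eq_of_children_of_common_descendant {x y y' z : V}
    (hy : Child G v₀ {e | e ∈ p.edges} x y) (hy' : Child G v₀ {e | e ∈ p.edges} x y')
    (h : Relation.ReflTransGen (Child G v₀ {e | e ∈ p.edges}) y z)
    (h' : Relation.ReflTransGen (Child G v₀ {e | e ∈ p.edges}) y' z) : y = y' := by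
  have key : ∀ {y y' : V}, Child G v₀ {e | e ∈ p.edges} x y →
      Child G v₀ {e | e ∈ p.edges} x y' →
      Relation.ReflTransGen (Child G v₀ {e | e ∈ p.edges}) y y' → y = y' := by
    intro y y' hy hy' h
    rcases Relation.ReflTransGen.cases_tail h with rfl | ⟨d, hd, hdy⟩
    · rfl
    · have := dist_le_of_reflTransGen hd
      rw [hdy.left_unique hconn hp huniq hy'] at this
      exact absurd hy.2.2 (not_lt.2 this)
  rcases reflTransGen_total hconn hp huniq h h' with h | h
  · exact key hy hy' h
  · exact (key hy' hy h).symm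

omit hp huniq in
lemma dist_root_le_succ {x y : V} (h : G.Adj x y) : G.dist v₀ y ≤ G.dist v₀ x + 1 := by
  have := hconn.dist_triangle (u := v₀) (v := x) (w := y)
  rwa [dist_eq_one_iff_adj.2 h] at this

omit hconn hp huniq in
lemma _root_.SatisfiesPolarProperty.exists_ne {P : Set V} (hP : SatisfiesPolarProperty G P)
    {x y : V} (hxy : G.Adj x y) (hx : x ∈ P) (hy : y ∉ P) : ∃ z ∈ P, G.Adj y z ∧ z ≠ x := by
  by_contra! h
  exact hy (hP y ⟨x, ⟨hxy.symm, hx⟩, fun z hz => h z hz.2 hz.1⟩)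

lemma exists_polar_descendant {P : Set V} (hP : SatisfiesPolarProperty G P) {x y : V}
    (hxy : Child G v₀ {e | e ∈ p.edges} x y) (hx : x ∈ P) :
    ∃ z ∈ P, Relation.ReflTransGen (Child G v₀ {e | e ∈ p.edges}) y z ∧ z ∉ p.support ∧
      G.dist v₀ z ≤ G.dist v₀ x + 2 := by
  have hd := dist_root_le_succ (v₀ := v₀) hconn hxy.1
  have hys := hxy.notMem_support hconn hp huniq
  by_cases hy : y ∈ P
  · exact ⟨y, hy, .refl, hys, by omega⟩
  · obtain ⟨z, hz, hyz, hne⟩ := hP.exists_ne hxy.1 hx hy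
    have hc := child_of_notMem_support hconn hp huniq hys hxy.1 hxy.2.2.le hyz hne
    have := dist_root_le_succ (v₀ := v₀) hconn hyz
    exact ⟨z, hz, .single hc, hc.notMem_support hconn hp huniq, by omega⟩

/-- A uniform lower bound `T` for the number of polar descendants within distance `j` of polar
vertices off the cycle propagates to polar vertices with many children. -/
lemma exists_descendants_of_children {P : Set V} (hP : SatisfiesPolarProperty G P) {j T : ℕ}
    (hT : ∀ z ∈ P, z ∉ p.support → ∃ S : Finset V, T ≤ S.card ∧ ∀ w ∈ S, w ∈ P ∧
      Relation.ReflTransGen (Child G v₀ {e | e ∈ p.edges}) z w ∧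
      G.dist v₀ w ≤ G.dist v₀ z + j)
    {x : V} (hx : x ∈ P) {K : Finset V} (hK : ∀ y ∈ K, Child G v₀ {e | e ∈ p.edges} x y) :
    ∃ S : Finset V, 1 + K.card * T ≤ S.card ∧ ∀ w ∈ S, w ∈ P ∧
      Relation.ReflTransGen (Child G v₀ {e | e ∈ p.edges}) x w ∧
      G.dist v₀ w ≤ G.dist v₀ x + (j + 2) := by
  classical
  have hS : ∀ y, ∃ S : Finset V, y ∈ K → T ≤ S.card ∧ ∀ w ∈ S, w ∈ P ∧
      Relation.ReflTransGen (Child G v₀ {e | e ∈ p.edges}) y w ∧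
      G.dist v₀ w ≤ G.dist v₀ x + (j + 2) := by
    intro y
    by_cases hy : y ∈ K
    · obtain ⟨z, hz, hyz, hzs, hd⟩ := exists_polar_descendant hconn hp huniq hP (hK y hy) hx
      obtain ⟨S, hc, hS⟩ := hT z hz hzs
      refine ⟨S, fun _ => ⟨hc, fun w hw => ?_⟩⟩
      obtain ⟨h1, h2, h3⟩ := hS w hw
      exact ⟨h1, hyz.trans h2, by omega⟩
    · exact ⟨∅, fun h => absurd h hy⟩
  choose S hS using hS
  have hxS : x ∉ K.biUnion S := by
    intro h
    obtain ⟨y, hy, hxy⟩ := Finset.mem_biUnion.1 h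
    exact absurd (hK y hy).2.2 (not_lt.2 (dist_le_of_reflTransGen ((hS y hy).2 x hxy).2.1))
  refine ⟨insert x (K.biUnion S), ?_, fun w hw => ?_⟩
  · rw [Finset.card_insert_of_notMem hxS, Finset.card_biUnion, add_comm]
    · have := Finset.card_nsmul_le_sum K (fun y => (S y).card) T (fun y hy => (hS y hy).1)
      rw [smul_eq_mul] at this
      omega
    · intro y hy y' hy' hne
      refine Finset.disjoint_left.2 fun w hw hw' => hne ?_
      exact eq_of_children_of_common_descendant hconn hp huniq (hK y hy) (hK y' hy')
        ((hS y hy).2 w hw).2.1 ((hS y' hy').2 w hw').2.1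
  · rcases Finset.mem_insert.1 hw with rfl | hw
    · exact ⟨hx, .refl, by omega⟩
    · obtain ⟨y, hy, hwy⟩ := Finset.mem_biUnion.1 hw
      obtain ⟨h1, h2, h3⟩ := (hS y hy).2 w hwy
      exact ⟨h1, .head (hK y hy) h2, h3⟩

lemma exists_descendants_of_notMem_support {n : ℕ} (hn : 2 ≤ n)
    (hreg : ∀ v : V, (G.neighborSet v).ncard = n) {P : Set V}
    (hP : SatisfiesPolarProperty G P) (k : ℕ) :
    ∀ x ∈ P, x ∉ p.support → ∃ S : Finset V, (∑ i ∈ Finset.range (k + 1), (n - 1) ^ i) ≤ S.card ∧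
      ∀ w ∈ S, w ∈ P ∧ Relation.ReflTransGen (Child G v₀ {e | e ∈ p.edges}) x w ∧
      G.dist v₀ w ≤ G.dist v₀ x + 2 * k := by
  induction k with
  | zero =>
    intro x hx _
    refine ⟨{x}, by simp, fun w hw => ?_⟩
    rw [Finset.mem_singleton.1 hw]
    exact ⟨hx, .refl, le_rfl⟩
  | succ k ih =>
    intro x hx hxs
    obtain ⟨K, hK, hc⟩ :=
      exists_child_finset_of_notMem_support hconn hp huniq (by omega) hreg hxs
    obtain ⟨S, hS, hS'⟩ := exists_descendants_of_children hconn hp huniq hP ih hx hK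
    refine ⟨S, le_trans ?_ hS, hS'⟩
    rw [Finset.sum_range_succ', pow_zero, add_comm, Nat.add_le_add_iff_left]
    simp_rw [pow_succ']
    rw [← Finset.mul_sum]
    exact Nat.mul_le_mul_right _ hc

lemma exists_descendants {n : ℕ} (hn : 2 ≤ n)
    (hreg : ∀ v : V, (G.neighborSet v).ncard = n) {P : Set V}
    (hP : SatisfiesPolarProperty G P) (k : ℕ) {x : V} (hx : x ∈ P) :
    ∃ S : Finset V, (n - 1) ^ k ≤ S.card ∧
      ∀ w ∈ S, w ∈ P ∧ Relation.ReflTransGen (Child G v₀ {e | e ∈ p.edges}) x w ∧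
      G.dist v₀ w ≤ G.dist v₀ x + 2 * k := by
  cases k with
  | zero =>
    refine ⟨{x}, by simp, fun w hw => ?_⟩
    rw [Finset.mem_singleton.1 hw]
    exact ⟨hx, .refl, le_rfl⟩
  | succ k =>
    obtain ⟨K, hK, hc⟩ := exists_child_finset hconn hp huniq (by omega) hreg x
    obtain ⟨S, hS, hS'⟩ := exists_descendants_of_children hconn hp huniq hP
      (exists_descendants_of_notMem_support hconn hp huniq hn hreg hP k) hx hK
    refine ⟨S, le_trans ?_ hS, hS'⟩
    obtain ⟨m, rfl⟩ := Nat.exists_eq_add_of_le' hn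
    have hgeom := geom_sum_mul_add m (k + 1)
    rw [Nat.add_sub_cancel] at hc
    have hmul := Nat.mul_le_mul_right (∑ i ∈ Finset.range (k + 1), (m + 1) ^ i) hc
    rw [show m + 2 - 1 = m + 1 by omega, ← hgeom]
    linarith

lemma exists_second_polar_vertex {P : Set V} (hP : SatisfiesPolarProperty G P) (hv₀ : v₀ ∈ P) :
    ∃ x ∈ P, G.dist v₀ x ≤ 2 ∧
      ¬ Relation.ReflTransGen (Child G v₀ {e | e ∈ p.edges}) v₀ x ∧
      ¬ Relation.ReflTransGen (Child G v₀ {e | e ∈ p.edges}) x v₀ := by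
  have not_from_root : ∀ {x}, x ∈ p.support → x ≠ v₀ →
      ¬ Relation.ReflTransGen (Child G v₀ {e | e ∈ p.edges}) v₀ x := by
    intro x hx hne h
    rcases Relation.reflTransGen_iff_eq_or_transGen.1 h with h | h
    · exact hne h
    · exact notMem_support_of_transGen hconn hp huniq h hx
  have not_to_root : ∀ {x}, x ≠ v₀ →
      ¬ Relation.ReflTransGen (Child G v₀ {e | e ∈ p.edges}) x v₀ := by
    intro x hne h
    have := dist_le_of_reflTransGen h
    rw [SimpleGraph.dist_self, Nat.le_zero, hconn.dist_eq_zero_iff] at this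
    exact hne this.symm
  have hadj : G.Adj v₀ p.snd := p.adj_snd hp.not_nil
  have hsnd : p.snd ∈ p.support := p.getVert_mem_support 1
  have hd := dist_root_le_succ (v₀ := v₀) hconn hadj
  rw [SimpleGraph.dist_self] at hd
  by_cases ha : p.snd ∈ P
  · exact ⟨_, ha, by omega, not_from_root hsnd hadj.ne', not_to_root hadj.ne'⟩
  obtain ⟨z, hz, haz, hne⟩ := hP.exists_ne hadj hv₀ ha
  have hd' := dist_root_le_succ (v₀ := v₀) hconn haz
  refine ⟨z, hz, by omega, ?_, not_to_root hne⟩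
  by_cases he : s(p.snd, z) ∈ p.edges
  · exact not_from_root (p.snd_mem_support_of_mem_edges he) hne
  · intro h
    have hc := child_of_mem_support hconn hp huniq hsnd haz he
    rcases Relation.ReflTransGen.cases_tail h with h | ⟨d, hd, hdz⟩
    · exact hne h
    · rw [hdz.left_unique hconn hp huniq hc] at hd
      exact not_from_root hsnd hadj.ne' hd

end UniqueCycle

lemma finite_dist_le (hconn : G.Connected) (hfin : ∀ v : V, (G.neighborSet v).Finite) (r : ℕ) :
    {v | G.dist v₀ v ≤ r}.Finite := by
  induction r with
  | zero =>
    refine (Set.finite_singleton v₀).subset fun v hv => ?_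
    exact (hconn.dist_eq_zero_iff.1 (Nat.le_zero.1 hv)).symm
  | succ r ih =>
    refine (ih.union (ih.biUnion fun v _ => hfin v)).subset fun v hv => ?_
    rcases Nat.lt_or_ge r (G.dist v₀ v) with h | h
    · have hv' : G.dist v v₀ = r + 1 := by
        rw [dist_comm]
        exact le_antisymm hv h
      obtain ⟨w, hw⟩ := hconn.exists_walk_length_eq_dist v v₀
      rw [hv'] at hw
      cases w with
      | nil => simp at hw
      | @cons _ u _ hadj w =>
        refine Or.inr (Set.mem_biUnion (x := u) ?_ hadj.symm)
        have := dist_le w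
        rw [dist_comm] at this
        rw [Walk.length_cons] at hw
        exact this.trans (by omega)
    · exact Or.inl h

end Volcano

/-- Let `V(n,c)` (`n ≥ 3`, `c ≥ 3`) be the infinite `n`-regular volcano with crater of length
`c`: an infinite connected simple graph in which every vertex has degree `n`, containing exactly
one cycle (any two cycles have the same edges), that cycle having length `c`; let `v₀` be a root
vertex lying on the cycle.  If `P` is a set of vertices satisfying the polar property and
`v₀ ∈ P`, then for every `r ≥ 2` the number of elements of `P` at distance at most `r` from
`v₀` is at least `(n-1)^⌊r/2⌋ + (n-1)^{⌊r/2⌋-1}`. -/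
theorem volcano_polar_lower_bound {V : Type*} (G : SimpleGraph V) (v₀ : V)
    (n c : ℕ) (hn : 3 ≤ n) (hc : 3 ≤ c)
    (hinf : Infinite V) (hconn : G.Connected)
    (hreg : ∀ v : V, (G.neighborSet v).ncard = n)
    (hcycle : ∃ p : G.Walk v₀ v₀, p.IsCycle ∧ p.length = c)
    (huniq : ∀ (u v : V) (p : G.Walk u u) (q : G.Walk v v),
      p.IsCycle → q.IsCycle → ∀ e : Sym2 V, e ∈ p.edges ↔ e ∈ q.edges)
    (r : ℕ) (hr : 2 ≤ r)
    (P : Set V) (hP : SatisfiesPolarProperty G P) (hv₀ : v₀ ∈ P) :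
    (n - 1) ^ (r / 2) + (n - 1) ^ (r / 2 - 1) ≤ (P ∩ {v | G.dist v₀ v ≤ r}).ncard := by
  classical
  obtain ⟨p, hp, -⟩ := hcycle
  obtain ⟨k, hk⟩ : ∃ k, r / 2 = k + 1 := Nat.exists_eq_succ_of_ne_zero (by omega)
  obtain ⟨x, hx, hdx, hfrom, hto⟩ :=
    Volcano.exists_second_polar_vertex hconn hp huniq hP hv₀
  obtain ⟨S, hS, hS'⟩ :=
    Volcano.exists_descendants hconn hp huniq (by omega) hreg hP (k + 1) hv₀
  obtain ⟨T, hT, hT'⟩ := Volcano.exists_descendants hconn hp huniq (by omega) hreg hP k hx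
  have hdisj : Disjoint S T := by
    refine Finset.disjoint_left.2 fun w hw hw' => ?_
    exact (Volcano.reflTransGen_total hconn hp huniq (hS' w hw).2.1 (hT' w hw').2.1).elim
      hfrom hto
  have hfin : (P ∩ {v | G.dist v₀ v ≤ r}).Finite :=
    (Volcano.finite_dist_le hconn
      (fun v => Set.finite_of_ncard_pos (by rw [hreg]; omega)) r).subset Set.inter_subset_right
  have hsub : (↑(S ∪ T) : Set V) ⊆ P ∩ {v | G.dist v₀ v ≤ r} := by
    intro w hw
    rcases Finset.mem_union.1 hw with hw | hw
    · obtain ⟨h1, -, h3⟩ := hS' w hw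
      rw [SimpleGraph.dist_self] at h3
      exact ⟨h1, h3.trans (by omega)⟩
    · obtain ⟨h1, -, h3⟩ := hT' w hw
      exact ⟨h1, h3.trans (by omega)⟩
  have hcard := Set.ncard_le_ncard hsub hfin
  rw [Set.ncard_coe_finset, Finset.card_union_of_disjoint hdisj] at hcard
  rw [hk, Nat.add_sub_cancel]
  exact (Nat.add_le_add hS hT).trans hcard
end

section
/- Let n ≥ 3 be an integer and let G be an infinite connected simple graph containing at most one cycle in which every vertex has degree n. Then every nonempty set of vertices of G satisfying the polar property is infinite. (This is the combinatorial core of the statement that a nonempty polar condition on an ordinary component of an ℓ-isogeny graph is infinite.) -/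
open SimpleGraph

/-- An acyclic graph on a nonempty finite vertex set has fewer edges than vertices. -/
lemma SimpleGraph.IsAcyclic.card_edgeFinset_lt {W : Type*} [Fintype W] [Nonempty W]
    {H : SimpleGraph W} [Fintype H.edgeSet] (hH : H.IsAcyclic) :
    H.edgeFinset.card < Fintype.card W := by
  classical
  obtain ⟨T, hHT, -, hT⟩ :=
    (connected_top (V := W)).exists_isTree_le_of_le_of_isAcyclic le_top hH
  have hle := Finset.card_le_card (edgeFinset_mono hHT)
  have hcard := hT.card_edgeFinset
  omega

/-- A graph on a nonempty finite vertex set with at most one cycle has at most as many edges as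
vertices. -/
lemma SimpleGraph.card_edgeFinset_le_of_cycles_eq {W : Type*} [Fintype W] [Nonempty W]
    (H : SimpleGraph W) [Fintype H.edgeSet]
    (huniq : ∀ (u v : W) (p : H.Walk u u) (q : H.Walk v v),
      p.IsCycle → q.IsCycle → ∀ e : Sym2 W, e ∈ p.edges ↔ e ∈ q.edges) :
    H.edgeFinset.card ≤ Fintype.card W := by
  classical
  by_cases hH : H.IsAcyclic
  · exact hH.card_edgeFinset_lt.le
  · obtain ⟨u, p, hp⟩ : ∃ (u : W) (p : H.Walk u u), p.IsCycle := by
      simpa [IsAcyclic] using hH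
    obtain ⟨e, he⟩ := p.edges.exists_mem_of_ne_nil <| by simp [hp.not_nil]
    have hacyc : (H.deleteEdges {e}).IsAcyclic := by
      intro v q hq
      have hle : H.deleteEdges {e} ≤ H := deleteEdges_le _
      have heq := (huniq u v p (q.mapLe hle) hp (hq.mapLe hle) e).1 he
      rw [Walk.edges_mapLe_eq_edges] at heq
      simpa using q.edges_subset_edgeSet heq
    have hlt := hacyc.card_edgeFinset_lt
    have hsub : H.edgeFinset ⊆ insert e (H.deleteEdges {e}).edgeFinset := by
      intro f hf
      by_cases hfe : f = e
      · simp [hfe]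
      · simpa [hfe] using hf
    have hcard := (Finset.card_le_card hsub).trans (Finset.card_insert_le _ _)
    omega

/-- The property of having at most one cycle passes to induced subgraphs. -/
lemma SimpleGraph.cycles_eq_induce {V : Type*} {G : SimpleGraph V}
    (huniq : ∀ (u v : V) (p : G.Walk u u) (q : G.Walk v v),
      p.IsCycle → q.IsCycle → ∀ e : Sym2 V, e ∈ p.edges ↔ e ∈ q.edges)
    (S : Set V) (u v : S) (p : (G.induce S).Walk u u) (q : (G.induce S).Walk v v)
    (hp : p.IsCycle) (hq : q.IsCycle) (e : Sym2 S) : e ∈ p.edges ↔ e ∈ q.edges := by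
  let f : G.induce S →g G := (Embedding.induce S).toHom
  have hf : Function.Injective f := Subtype.val_injective
  have h := huniq _ _ (p.map f) (q.map f) (hp.map hf) (hq.map hf) (e.map f)
  simpa only [Walk.edges_map, List.mem_map_of_injective (Sym2.map.injective hf)] using h

lemma SimpleGraph.degree_induce_eq_ncard {V : Type*} (G : SimpleGraph V) (S : Set V) (v : S)
    [Fintype ((G.induce S).neighborSet v)] :
    (G.induce S).degree v = (G.neighborSet v ∩ S).ncard := by
  rw [← card_neighborSet_eq_degree, ← Nat.card_eq_fintype_card, Nat.card_coe_set_eq,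
    ← Set.ncard_image_of_injective _ Subtype.val_injective]
  congr 1
  ext w
  simp [and_comm]


/-- Let `G` be an infinite connected simple graph containing at most one cycle (any two cycles
have the same edges) in which every vertex has degree `n ≥ 3`.  Then every nonempty set of
vertices of `G` satisfying the polar property is infinite. -/
theorem polar_infinite_of_unicyclic_regular {V : Type*} (G : SimpleGraph V)
    (n : ℕ) (hn : 3 ≤ n)
    (hinf : Infinite V) (hconn : G.Connected)
    (hreg : ∀ v : V, (G.neighborSet v).ncard = n)
    (huniq : ∀ (u v : V) (p : G.Walk u u) (q : G.Walk v v),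
      p.IsCycle → q.IsCycle → ∀ e : Sym2 V, e ∈ p.edges ↔ e ∈ q.edges)
    (P : Set V) (hP : SatisfiesPolarProperty G P) (hne : P.Nonempty) :
    P.Infinite := by
  intro hfin
  classical
  have hnfin (v : V) : (G.neighborSet v).Finite :=
    Set.finite_of_ncard_ne_zero (by rw [hreg]; omega)
  set S : Set V := P ∪ ⋃ v ∈ P, G.neighborSet v
  have hSfin : S.Finite := hfin.union (hfin.biUnion fun v _ ↦ hnfin v)
  have : Fintype S := hSfin.fintype
  obtain ⟨x, hx⟩ := hne
  have hxS : x ∈ S := Or.inl hx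
  have : Nonempty S := ⟨⟨x, hxS⟩⟩
  have hdegP (v : S) (hv : v.1 ∈ P) : (G.induce S).degree v = n := by
    rw [degree_induce_eq_ncard, Set.inter_eq_left.2, hreg]
    exact fun w hw ↦ Or.inr (Set.mem_biUnion hv hw)
  have hdeg (v : S) : 2 ≤ (G.induce S).degree v := by
    by_cases hv : v.1 ∈ P
    · rw [hdegP v hv]
      omega
    · obtain ⟨w, hwP, hwv⟩ : ∃ w ∈ P, G.Adj w v := by
        have hvS : v.1 ∈ P ∪ ⋃ w ∈ P, G.neighborSet w := v.2
        simpa only [Set.mem_union, hv, false_or, Set.mem_iUnion, mem_neighborSet,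
          exists_prop] using hvS
      obtain ⟨w', hw', hww⟩ : ∃ w', (G.Adj v w' ∧ w' ∈ P) ∧ w' ≠ w := by
        by_contra! h
        exact hv (hP v ⟨w, ⟨hwv.symm, hwP⟩, h⟩)
      rw [degree_induce_eq_ncard]
      exact (Set.one_lt_ncard ((hnfin v).inter_of_left S)).2
        ⟨w', ⟨hw'.1, Or.inl hw'.2⟩, w, ⟨hwv.symm, Or.inl hwP⟩, hww⟩
  have hsum : ∑ _v : S, 2 < ∑ v : S, (G.induce S).degree v :=
    Finset.sum_lt_sum (fun v _ ↦ hdeg v)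
      ⟨⟨x, hxS⟩, Finset.mem_univ _, by rw [hdegP _ hx]; omega⟩
  have hedge := (G.induce S).card_edgeFinset_le_of_cycles_eq (cycles_eq_induce huniq S)
  rw [sum_degrees_eq_twice_card_edges, Finset.sum_const, Finset.card_univ, smul_eq_mul] at hsum
  omega
end
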